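/- arXiv:1404.7054 — 5 statements merged into one kernel-verified Lean document; each statement's English description precedes it below -/
import Mathlib

section
/- Let X and Y be Polish spaces, μ and ν Borel probability measures on X and Y respectively, and c : X × Y → [0, ∞) a Borel measurable cost function. Suppose π ∈ Π(μ, ν) is a transport plan with finite cost ∫ c dπ < ∞. Then π is optimal for the Monge–Kantorovich problem inf{∫ c dP : P ∈ Π(μ, ν)} if and only if π is c-cyclically monotone. -/
open MeasureTheory

/-- A set `Γ ⊆ X × Y` is `c`-cyclically monotone if for all finite families
`(x₁,y₁),…,(x_l,y_l) ∈ Γ` one has `Σ c(xᵢ,yᵢ) ≤ Σ c(xᵢ,y_{i+1})` (indices cyclic). -/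
def CCyclicallyMonotone {X Y : Type*} (c : X × Y → ℝ) (Γ : Set (X × Y)) : Prop :=
  ∀ (l : ℕ) (pts : Fin (l + 1) → X × Y), (∀ i, pts i ∈ Γ) →
    ∑ i, c (pts i) ≤ ∑ i, c ((pts i).1, (pts (i + 1)).2)

open Set Filter Topology
open scoped ENNReal

/-- Capacitability: a capacity that is continuous along increasing unions and big on the
continuous image of the Baire space is big on every neighbourhood of some compact image. -/
theorem exists_compact_of_range {E : Type*} [TopologicalSpace E] (big : Set E → Prop)
    (big_mono : ∀ {A B : Set E}, A ⊆ B → big A → big B)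
    (big_iUnion : ∀ A : ℕ → Set E, Monotone A → big (⋃ n, A n) → ∃ n, big (A n))
    {f : (ℕ → ℕ) → E} (hf : Continuous f) (hbig : big (range f)) :
    ∃ T : Set (ℕ → ℕ), IsCompact T ∧ ∀ U, IsOpen U → f '' T ⊆ U → big U := by
  have step : ∀ (m : ℕ) (S : {S : Set (ℕ → ℕ) // big (f '' S)}),
      ∃ j, big (f '' (S.1 ∩ {σ | σ m ≤ j})) := by
    rintro m ⟨S, hS⟩
    refine big_iUnion _ (fun a b hab => ?_) (big_mono ?_ hS)
    · exact image_mono (inter_subset_inter_right _ fun σ (h : σ m ≤ a) => h.trans hab)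
    · rintro _ ⟨σ, hσ, rfl⟩
      exact mem_iUnion.2 ⟨σ m, σ, ⟨hσ, le_refl (σ m)⟩, rfl⟩
  choose j hj using step
  let S : ℕ → {S : Set (ℕ → ℕ) // big (f '' S)} := fun m =>
    Nat.rec ⟨univ, by rwa [image_univ]⟩ (fun m S => ⟨_, hj m S⟩) m
  have hS : ∀ m, (S m).1 = {σ | ∀ i < m, σ i ≤ j i (S i)} := by
    intro m
    induction m with
    | zero => ext; simp [S]
    | succ m ih =>
      have : (S (m + 1)).1 = (S m).1 ∩ {σ | σ m ≤ j m (S m)} := rfl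
      rw [this, ih]
      ext σ
      simp only [mem_inter_iff, mem_ofPred_eq, Nat.forall_lt_succ_right]
  set k : ℕ → ℕ := fun i => j i (S i) with hk
  let T : Set (ℕ → ℕ) := univ.pi fun i => Iic (k i)
  have hT : IsCompact T := isCompact_univ_pi fun i => (finite_Iic _).isCompact
  refine ⟨T, hT, fun U hU hTU => ?_⟩
  suffices ∃ m, f '' (S m).1 ⊆ U by
    obtain ⟨m, hm⟩ := this
    exact big_mono hm (S m).2
  by_contra! h
  simp only [not_subset, mem_image] at h
  choose z hz hzU using h
  choose σ hσ hσz using hz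
  let τ : ℕ → ℕ → ℕ := fun m i => min (σ m i) (k i)
  obtain ⟨τ', hτ', φ, hφ, hlim⟩ := hT.tendsto_subseq (x := τ)
    (fun m => fun i _ => mem_Iic.2 (min_le_right _ _))
  have hlim' : Tendsto (fun m => σ (φ m)) atTop (𝓝 τ') := by
    rw [tendsto_pi_nhds] at hlim ⊢
    intro i
    refine (hlim i).congr' ?_
    filter_upwards [eventually_gt_atTop i] with m hm
    have h1 := hσ (φ m)
    rw [hS] at h1
    exact min_eq_left (h1 i (hm.trans_le (hφ.id_le m)))
  have hev := hlim'.eventually ((hU.preimage hf).mem_nhds (hTU ⟨τ', hτ', rfl⟩))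
  obtain ⟨m, hm⟩ := hev.exists
  exact hzU (φ m) (by rw [← hσz]; exact hm)

theorem nullMeasurableSet_of_analyticSet {E : Type*} [TopologicalSpace E] [PolishSpace E]
    [MeasurableSpace E] [BorelSpace E] (μ : Measure E) [IsFiniteMeasure μ]
    {A : Set E} (hA : AnalyticSet A) : NullMeasurableSet A μ := by
  rw [AnalyticSet] at hA
  obtain rfl | ⟨f, hf, rfl⟩ := hA
  · exact nullMeasurableSet_empty
  let := TopologicalSpace.upgradeIsCompletelyMetrizable E
  have key : ∀ δ < μ (range f), ∃ K ⊆ range f, MeasurableSet K ∧ δ ≤ μ K := by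
    intro δ hδ
    obtain ⟨T, hT, hU⟩ := exists_compact_of_range (fun A => δ < μ A)
      (fun hAB h => h.trans_le (measure_mono hAB))
      (fun A hA h => by rwa [hA.measure_iUnion, lt_iSup_iff] at h) hf hδ
    refine ⟨f '' T, image_subset_range _ _, (hT.image hf).measurableSet, ?_⟩
    rw [(f '' T).measure_eq_iInf_isOpen]
    exact le_iInf₂ fun U hTU => le_iInf fun hUo => (hU U hUo hTU).le
  obtain h0 | h0 := eq_or_ne (μ (range f)) 0
  · exact NullMeasurableSet.of_null h0
  obtain ⟨u, -, hu, hlim⟩ := exists_seq_strictMono_tendsto' (pos_iff_ne_zero.2 h0)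
  choose K hK hKm hKμ using fun n => key (u n) (hu n).2
  have hle : μ (range f) ≤ μ (⋃ n, K n) :=
    le_of_tendsto' hlim fun n => (hKμ n).trans (measure_mono (subset_iUnion _ _))
  have hae : (⋃ n, K n : Set E) =ᵐ[μ] range f :=
    ae_eq_of_subset_of_measure_ge (iUnion_subset hK) hle
      (MeasurableSet.iUnion hKm).nullMeasurableSet (measure_ne_top _ _)
  exact (MeasurableSet.iUnion hKm).nullMeasurableSet.congr hae

theorem mem_ae_map_iff_of_nullMeasurableSet {α β : Type*} [MeasurableSpace α] [MeasurableSpace β]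
    {μ : Measure α} {f : α → β} (hf : AEMeasurable f μ) {s : Set β}
    (hs : NullMeasurableSet s (μ.map f)) : s ∈ ae (μ.map f) ↔ f ⁻¹' s ∈ ae μ := by
  rw [mem_ae_iff, mem_ae_iff, Measure.map_apply₀ hf hs.compl, preimage_compl]

theorem aemeasurable_biInf_of_polishSpace {W Y : Type*}
    [TopologicalSpace W] [PolishSpace W] [MeasurableSpace W] [BorelSpace W]
    [TopologicalSpace Y] [PolishSpace Y] [MeasurableSpace Y] [BorelSpace Y]
    (μ : Measure Y) [IsFiniteMeasure μ] {g : W → Y → ℝ}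
    (hg : Measurable (Function.uncurry g)) {D : Set W} (hD : MeasurableSet D) :
    AEMeasurable (fun y => ⨅ w ∈ D, (g w y : EReal)) μ := by
  apply NullMeasurable.aemeasurable
  refine measurable_of_Iio (δ := NullMeasurableSpace Y μ) fun r => ?_
  have heq : (fun y => ⨅ w ∈ D, (g w y : EReal)) ⁻¹' Iio r =
      Prod.snd '' {p : W × Y | p.1 ∈ D ∧ (g p.1 p.2 : EReal) < r} := by
    ext y
    simp [iInf_lt_iff]
  have hm : MeasurableSet {p : W × Y | p.1 ∈ D ∧ (g p.1 p.2 : EReal) < r} :=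
    (measurable_fst hD).inter
      ((measurable_coe_real_ereal.comp hg) measurableSet_Iio)
  have hnull := nullMeasurableSet_of_analyticSet μ (hm.analyticSet_image measurable_snd)
  rw [← heq] at hnull
  exact hnull

namespace CCyclicallyMonotone

variable {X Y : Type*} {c : X × Y → ℝ} {Γ : Set (X × Y)}

theorem sum_range_le (h : CCyclicallyMonotone c Γ) (l : ℕ) {p : ℕ → X × Y}
    (hp : ∀ i, p i ∈ Γ) :
    ∑ i ∈ Finset.range (l + 1), c (p i) ≤
      ∑ i ∈ Finset.range l, c ((p i).1, (p (i + 1)).2) + c ((p l).1, (p 0).2) := by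
  have := h l (fun i => p i) (fun i => hp i)
  rw [Fin.sum_univ_eq_sum_range (fun i => c (p i)), Fin.sum_univ_castSucc] at this
  simpa [Fin.coeSucc_eq_succ, Fin.sum_univ_eq_sum_range (fun i => c ((p i).1, (p (i + 1)).2))]
    using this

/-- The cost balance of the chain `p 0, …, p n` ending in the point `y`. -/
noncomputable def chainCost (c : X × Y → ℝ) (n : ℕ) (p : ℕ → X × Y) (y : Y) : ℝ :=
  ∑ i ∈ Finset.range n, c ((p i).1, (p (i + 1)).2) + c ((p n).1, y) -
    ∑ i ∈ Finset.range (n + 1), c (p i)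

theorem chainCost_update (n : ℕ) (p : ℕ → X × Y) (z : X × Y) (y : Y) :
    chainCost c (n + 1) (Function.update p (n + 1) z) y =
      chainCost c n p z.2 + c (z.1, y) - c z := by
  have h1 : ∀ i ∈ Finset.range (n + 1), c (Function.update p (n + 1) z i) = c (p i) := by
    intro i hi
    rw [Function.update_of_ne (Finset.mem_range.1 hi).ne]
  have h2 : ∀ i ∈ Finset.range n, c ((Function.update p (n + 1) z i).1,
      (Function.update p (n + 1) z (i + 1)).2) = c ((p i).1, (p (i + 1)).2) := by
    intro i hi
    have := Finset.mem_range.1 hi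
    rw [Function.update_of_ne (by lia), Function.update_of_ne (by lia)]
  unfold chainCost
  rw [Finset.sum_range_succ _ (n + 1), Finset.sum_congr rfl h1, Finset.sum_range_succ,
    Finset.sum_congr rfl h2, Function.update_self, Function.update_of_ne (by lia)]
  ring

theorem le_chainCost (h : CCyclicallyMonotone c Γ) (n : ℕ) {p : ℕ → X × Y}
    (hp : ∀ i, p i ∈ Γ) {z : X × Y} (hz : z ∈ Γ) :
    c z - c (z.1, (p 0).2) ≤ chainCost c n p z.2 := by
  have hq : ∀ i, Function.update p (n + 1) z i ∈ Γ := by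
    intro i
    rcases eq_or_ne i (n + 1) with rfl | hi
    · simpa using hz
    · simpa [hi] using hp i
  have h1 := h.sum_range_le (n + 1) hq
  have h2 := chainCost_update (c := c) n p z (p 0).2
  unfold chainCost at h2 ⊢
  rw [Function.update_self] at h1 h2
  rw [Function.update_of_ne (by lia)] at h1
  linarith

theorem measurable_chainCost {X Y : Type*} [MeasurableSpace X] [MeasurableSpace Y]
    {c : X × Y → ℝ} (hc : Measurable c) (n : ℕ) :
    Measurable (Function.uncurry (chainCost c n)) := by
  have h : ∀ i, Measurable fun q : (ℕ → X × Y) × Y => q.1 i :=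
    fun i => (measurable_pi_apply i).comp measurable_fst
  refine Measurable.sub (Measurable.add ?_ ?_) ?_
  · exact Finset.measurable_sum _ fun i _ => hc.comp ((h i).fst.prodMk (h (i + 1)).snd)
  · exact hc.comp ((h n).fst.prodMk measurable_snd)
  · exact Finset.measurable_sum _ fun i _ => hc.comp (h i)

variable [TopologicalSpace X] [PolishSpace X] [MeasurableSpace X] [BorelSpace X]
  [TopologicalSpace Y] [PolishSpace Y] [MeasurableSpace Y] [BorelSpace Y]

/-- The second potential; the first one is its `c`-transform. -/
theorem exists_second_potential (h : CCyclicallyMonotone c Γ) (hc : Measurable c)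
    (hΓ : MeasurableSet Γ) (hne : Γ.Nonempty) (ν : Measure Y) [IsFiniteMeasure ν]
    (hν : ∀ᵐ y ∂ν, y ∈ Prod.snd '' Γ) :
    ∃ (ψ : Y → ℝ) (Y₀ : Set Y), Measurable ψ ∧ MeasurableSet Y₀ ∧ Y₀ ∈ ae ν ∧
      ∀ y ∈ Y₀, ∀ z ∈ Γ, z.2 ∈ Y₀ → ψ y ≤ ψ z.2 + c (z.1, y) - c z := by
  obtain ⟨z₀, hz₀⟩ := hne
  let D : Set (ℕ → X × Y) := {p | p 0 = z₀ ∧ ∀ i, p i ∈ Γ}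
  have hD : MeasurableSet D := by
    have hDeq : D = (fun p => p 0) ⁻¹' {z₀} ∩ ⋂ i, (fun p => p i) ⁻¹' Γ := by
      ext p
      simp [D]
    rw [hDeq]
    exact ((measurable_pi_apply 0) (measurableSet_singleton z₀)).inter
      (MeasurableSet.iInter fun i => (measurable_pi_apply i) hΓ)
  let ψE : Y → EReal := fun y => ⨅ n, ⨅ p ∈ D, (chainCost c n p y : EReal)
  have hψE : AEMeasurable ψE ν := AEMeasurable.iInf fun n =>
    aemeasurable_biInf_of_polishSpace ν (measurable_chainCost hc n) hD
  have hle : ∀ y n, ∀ p ∈ D, ψE y ≤ chainCost c n p y := fun y n p hp =>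
    iInf_le_of_le n (iInf₂_le p hp)
  have htop : ∀ y, ψE y ≠ ⊤ := fun y =>
    ne_top_of_le_ne_top (EReal.coe_ne_top _) (hle y 0 (fun _ => z₀) ⟨rfl, fun _ => hz₀⟩)
  have hbot : ∀ z ∈ Γ, ψE z.2 ≠ ⊥ := by
    intro z hz
    refine ne_bot_of_le_ne_bot (EReal.coe_ne_bot (c z - c (z.1, z₀.2))) ?_
    refine le_iInf fun n => le_iInf₂ fun p hp => EReal.coe_le_coe_iff.2 ?_
    have := h.le_chainCost n hp.2 hz
    rwa [hp.1] at this
  have hstep : ∀ y, ∀ z ∈ Γ, ψE y ≤ ψE z.2 + ((c (z.1, y) - c z : ℝ) : EReal) := by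
    intro y z hz
    rw [← EReal.sub_le_iff_le_add (Or.inl (EReal.coe_ne_bot _)) (Or.inl (EReal.coe_ne_top _))]
    refine le_iInf fun n => le_iInf₂ fun p hp => ?_
    rw [EReal.sub_le_iff_le_add (Or.inl (EReal.coe_ne_bot _)) (Or.inl (EReal.coe_ne_top _))]
    refine (hle y (n + 1) (Function.update p (n + 1) z) ⟨?_, fun i => ?_⟩).trans ?_
    · rw [Function.update_of_ne (by lia)]; exact hp.1
    · rcases eq_or_ne i (n + 1) with rfl | hi
      · simpa using hz
      · simpa [hi] using hp.2 i
    · rw [chainCost_update, add_sub_assoc, EReal.coe_add]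
  obtain ⟨Y₀, hY₀, hY₀m, hY₀p⟩ := (hψE.ae_eq_mk.and hν).exists_measurable_mem
  refine ⟨fun y => (hψE.mk ψE y).toReal, Y₀, hψE.measurable_mk.ereal_toReal, hY₀m, hY₀, ?_⟩
  intro y hy z hz hzY
  simp only [← (hY₀p y hy).1, ← (hY₀p z.2 hzY).1]
  obtain ⟨w, hw, rfl⟩ := (hY₀p y hy).2
  have := hstep w.2 z hz
  rw [← EReal.coe_toReal (htop _) (hbot w hw), ← EReal.coe_toReal (htop _) (hbot z hz),
    ← EReal.coe_add, EReal.coe_le_coe_iff] at this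
  linarith

theorem exists_potentials (h : CCyclicallyMonotone c Γ) (hc : Measurable c)
    (hΓ : MeasurableSet Γ) {π : Measure (X × Y)} [IsProbabilityMeasure π] (hπ : ∀ᵐ z ∂π, z ∈ Γ) :
    ∃ (φ : X → ℝ) (ψ : Y → ℝ), Measurable φ ∧ Measurable ψ ∧
      (∀ P : Measure (X × Y), P.map Prod.fst = π.map Prod.fst → P.map Prod.snd = π.map Prod.snd →
        ∀ᵐ z ∂P, φ z.1 + ψ z.2 ≤ c z) ∧
      ∀ᵐ z ∂π, φ z.1 + ψ z.2 = c z := by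
  have : IsProbabilityMeasure (π.map Prod.fst) :=
    Measure.isProbabilityMeasure_map measurable_fst.aemeasurable
  have : IsProbabilityMeasure (π.map Prod.snd) :=
    Measure.isProbabilityMeasure_map measurable_snd.aemeasurable
  obtain ⟨ψ, Y₀, hψ, hY₀, hY₀ae, hψle⟩ := h.exists_second_potential hc hΓ
    (hπ.exists) (π.map Prod.snd) (by
      have : NullMeasurableSet (Prod.snd '' Γ) (π.map Prod.snd) :=
        nullMeasurableSet_of_analyticSet _ (hΓ.analyticSet_image measurable_snd)
      refine (mem_ae_map_iff_of_nullMeasurableSet measurable_snd.aemeasurable this).2 ?_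
      filter_upwards [hπ] with z hz using ⟨z, hz, rfl⟩)
  have hπY : ∀ᵐ z ∂π, z.2 ∈ Y₀ := ae_of_ae_map measurable_snd.aemeasurable hY₀ae
  let Γ₀ : Set (X × Y) := Γ ∩ Prod.snd ⁻¹' Y₀
  have hΓ₀ : MeasurableSet Γ₀ := hΓ.inter (measurable_snd hY₀)
  let φE : X → EReal := fun x => ⨅ y ∈ Y₀, ((c (x, y) - ψ y : ℝ) : EReal)
  have hφE : AEMeasurable φE (π.map Prod.fst) :=
    aemeasurable_biInf_of_polishSpace (g := fun y x => c (x, y) - ψ y) _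
      ((hc.comp measurable_swap).sub (hψ.comp measurable_fst)) hY₀
  have hφeq : ∀ z ∈ Γ₀, φE z.1 = ((c z - ψ z.2 : ℝ) : EReal) := by
    intro z hz
    refine le_antisymm (iInf₂_le z.2 hz.2) (le_iInf₂ fun y hy => EReal.coe_le_coe_iff.2 ?_)
    have := hψle y hy z hz.1 hz.2
    linarith
  have hX : ∀ᵐ x ∂π.map Prod.fst, x ∈ Prod.fst '' Γ₀ := by
    have : NullMeasurableSet (Prod.fst '' Γ₀) (π.map Prod.fst) :=
      nullMeasurableSet_of_analyticSet _ (hΓ₀.analyticSet_image measurable_fst)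
    refine (mem_ae_map_iff_of_nullMeasurableSet measurable_fst.aemeasurable this).2 ?_
    filter_upwards [hπ, hπY] with z hz hzY using ⟨z, ⟨hz, hzY⟩, rfl⟩
  refine ⟨fun x => (hφE.mk φE x).toReal, ψ, hφE.measurable_mk.ereal_toReal, hψ, ?_, ?_⟩
  · intro P hP₁ hP₂
    have h1 : ∀ᵐ z ∂P, φE z.1 = hφE.mk φE z.1 :=
      ae_of_ae_map measurable_fst.aemeasurable (by rw [hP₁]; exact hφE.ae_eq_mk)
    have h2 : ∀ᵐ z ∂P, z.1 ∈ Prod.fst '' Γ₀ :=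
      ae_of_ae_map measurable_fst.aemeasurable (hP₁ ▸ hX)
    have h3 : ∀ᵐ z ∂P, z.2 ∈ Y₀ :=
      ae_of_ae_map (p := (· ∈ Y₀)) measurable_snd.aemeasurable (hP₂ ▸ hY₀ae)
    filter_upwards [h1, h2, h3] with z hz1 hz2 hz3
    obtain ⟨w, hw, hwz⟩ := hz2
    have hle : φE z.1 ≤ ((c z - ψ z.2 : ℝ) : EReal) := iInf₂_le z.2 hz3
    rw [← hz1, ← hwz, hφeq w hw, EReal.toReal_coe]
    rw [← hwz, hφeq w hw, EReal.coe_le_coe_iff] at hle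
    linarith
  · filter_upwards [ae_of_ae_map measurable_fst.aemeasurable hφE.ae_eq_mk, hπ, hπY]
      with z hz1 hz2 hz3
    rw [← hz1, hφeq z ⟨hz2, hz3⟩, EReal.toReal_coe]
    ring

end CCyclicallyMonotone

theorem clip_add_clip_le {a b r : ℝ} {n : ℝ} (hn : 0 ≤ n) (hr : 0 ≤ r) (h : a + b ≤ r) :
    max (-n) (min n a) + max (-n) (min n b) ≤ r := by
  grind

theorem clip_add_clip_nonneg {a b : ℝ} {n : ℝ} (hn : 0 ≤ n) (h : 0 ≤ a + b) :
    0 ≤ max (-n) (min n a) + max (-n) (min n b) := by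
  grind

theorem tendsto_clip (a : ℝ) :
    Tendsto (fun n : ℕ => max (-(n : ℝ)) (min n a)) atTop (𝓝 a) := by
  refine tendsto_const_nhds.congr' ?_
  obtain ⟨N, hN⟩ := exists_nat_ge |a|
  filter_upwards [eventually_ge_atTop N] with n hn
  have : |a| ≤ n := hN.trans (by exact_mod_cast hn)
  rw [abs_le] at this
  rw [min_eq_right this.2, max_eq_right this.1]

/-- A plan carried by a cyclically monotone set is optimal among plans with its marginals. -/
theorem CCyclicallyMonotone.lintegral_le {X Y : Type*}
    [TopologicalSpace X] [PolishSpace X] [MeasurableSpace X] [BorelSpace X]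
    [TopologicalSpace Y] [PolishSpace Y] [MeasurableSpace Y] [BorelSpace Y]
    {c : X × Y → ℝ} {Γ : Set (X × Y)} (h : CCyclicallyMonotone c Γ) (hc : Measurable c)
    (hc_nonneg : ∀ p, 0 ≤ c p)
    (hΓ : MeasurableSet Γ) {π P : Measure (X × Y)} [IsProbabilityMeasure π]
    [IsProbabilityMeasure P] (hπ : ∀ᵐ z ∂π, z ∈ Γ)
    (hfin : ∫⁻ p, ENNReal.ofReal (c p) ∂π ≠ ⊤)
    (h₁ : P.map Prod.fst = π.map Prod.fst) (h₂ : P.map Prod.snd = π.map Prod.snd) :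
    ∫⁻ p, ENNReal.ofReal (c p) ∂π ≤ ∫⁻ p, ENNReal.ofReal (c p) ∂P := by
  obtain ⟨φ, ψ, hφ, hψ, hle, heq⟩ := h.exists_potentials hc hΓ hπ
  by_cases hfinP : ∫⁻ p, ENNReal.ofReal (c p) ∂P = ⊤
  · simp [hfinP]
  have hint : ∀ {Q : Measure (X × Y)}, ∫⁻ p, ENNReal.ofReal (c p) ∂Q ≠ ⊤ → Integrable c Q :=
    fun hQ => (lintegral_ofReal_ne_top_iff_integrable hc.aestronglyMeasurable
      (ae_of_all _ hc_nonneg)).1 hQ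
  have hcπ := hint hfin
  have hcP := hint hfinP
  rw [← ofReal_integral_eq_lintegral_ofReal hcπ (ae_of_all _ hc_nonneg),
    ← ofReal_integral_eq_lintegral_ofReal hcP (ae_of_all _ hc_nonneg)]
  apply ENNReal.ofReal_le_ofReal
  let u : ℕ → X → ℝ := fun n x => max (-(n : ℝ)) (min n (φ x))
  let v : ℕ → Y → ℝ := fun n y => max (-(n : ℝ)) (min n (ψ y))
  have hu : ∀ n, Measurable (u n) := fun n =>
    measurable_const.max (measurable_const.min hφ)
  have hv : ∀ n, Measurable (v n) := fun n =>
    measurable_const.max (measurable_const.min hψ)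
  have habs : ∀ (n : ℕ) (a : ℝ), ‖max (-(n : ℝ)) (min n a)‖ ≤ n := by
    intro n a
    have : (0 : ℝ) ≤ n := n.cast_nonneg
    rw [Real.norm_eq_abs, abs_le]
    exact ⟨le_max_left _ _, max_le (by linarith) (min_le_left _ _)⟩
  have hintu : ∀ (Q : Measure (X × Y)) [IsProbabilityMeasure Q] (n : ℕ),
      Integrable (fun z => u n z.1) Q := fun Q _ n =>
    Integrable.of_bound ((hu n).comp measurable_fst).aestronglyMeasurable n
      (ae_of_all _ fun z => habs n _)
  have hintv : ∀ (Q : Measure (X × Y)) [IsProbabilityMeasure Q] (n : ℕ),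
      Integrable (fun z => v n z.2) Q := fun Q _ n =>
    Integrable.of_bound ((hv n).comp measurable_snd).aestronglyMeasurable n
      (ae_of_all _ fun z => habs n _)
  have hmarg : ∀ n, ∫ z, (u n z.1 + v n z.2) ∂π = ∫ z, (u n z.1 + v n z.2) ∂P := by
    intro n
    rw [integral_add (hintu π n) (hintv π n), integral_add (hintu P n) (hintv P n),
      ← integral_map measurable_fst.aemeasurable (hu n).aestronglyMeasurable,
      ← integral_map measurable_snd.aemeasurable (hv n).aestronglyMeasurable,
      ← integral_map measurable_fst.aemeasurable (hu n).aestronglyMeasurable,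
      ← integral_map measurable_snd.aemeasurable (hv n).aestronglyMeasurable, h₁, h₂]
  have hlim : Tendsto (fun n => ∫ z, (u n z.1 + v n z.2) ∂π) atTop (𝓝 (∫ z, c z ∂π)) := by
    refine tendsto_integral_of_dominated_convergence c
      (fun n => ((hintu π n).add (hintv π n)).aestronglyMeasurable) hcπ (fun n => ?_) ?_
    · filter_upwards [heq] with z hz
      rw [Real.norm_eq_abs, abs_of_nonneg
        (clip_add_clip_nonneg n.cast_nonneg (hz ▸ hc_nonneg z))]
      exact clip_add_clip_le n.cast_nonneg (hc_nonneg z) hz.le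
    · filter_upwards [heq] with z hz
      rw [← hz]
      exact (tendsto_clip _).add (tendsto_clip _)
  refine le_of_tendsto' hlim fun n => ?_
  rw [hmarg]
  refine integral_mono_ae ((hintu P n).add (hintv P n)) hcP ?_
  filter_upwards [hle P h₁ h₂] with z hz
  exact clip_add_clip_le n.cast_nonneg (hc_nonneg z) hz

/-- `f : Z → [0, 1]` covers `A ⊆ Zᶥ` if `∑ i, f (z i) ≥ 1` on `A`. -/
structure IsCover {ι Z : Type*} [Fintype ι] [MeasurableSpace Z] (A : Set (ι → Z)) (f : Z → ℝ) :
    Prop where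
  measurable : Measurable f
  mem_Icc : ∀ z, f z ∈ Icc (0 : ℝ) 1
  one_le_sum : ∀ z ∈ A, 1 ≤ ∑ i, f (z i)

namespace IsCover

variable {ι Z : Type*} [Fintype ι] [MeasurableSpace Z] {A B : Set (ι → Z)} {f g : Z → ℝ}

theorem mono (hf : IsCover B f) (hAB : A ⊆ B) : IsCover A f :=
  ⟨hf.measurable, hf.mem_Icc, fun z hz => hf.one_le_sum z (hAB hz)⟩

theorem midpoint (hf : IsCover A f) (hg : IsCover A g) : IsCover A fun z => (f z + g z) / 2 := by
  refine ⟨(hf.measurable.add hg.measurable).div_const 2, fun z => ?_, fun z hz => ?_⟩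
  · have h1 := hf.mem_Icc z
    have h2 := hg.mem_Icc z
    exact ⟨by linarith [h1.1, h2.1], by linarith [h1.2, h2.2]⟩
  · have h1 := hf.one_le_sum z hz
    have h2 := hg.one_le_sum z hz
    rw [← Finset.sum_div, Finset.sum_add_distrib]
    linarith

theorem const_one [Nonempty ι] (A : Set (ι → Z)) : IsCover A fun _ => 1 := by
  refine ⟨measurable_const, fun z => by simp, fun z _ => ?_⟩
  simpa using Nat.one_le_iff_ne_zero.2 Fintype.card_ne_zero

theorem memLp (hf : IsCover A f) (π : Measure Z) [IsFiniteMeasure π] (p : ℝ≥0∞) : MemLp f p π :=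
  MemLp.of_bound hf.measurable.aestronglyMeasurable 1 (ae_of_all _ fun z => by
    rw [Real.norm_eq_abs, abs_of_nonneg (hf.mem_Icc z).1]
    exact (hf.mem_Icc z).2)

end IsCover

/-- The least `L²`-energy of a cover of `A`. -/
noncomputable def coverEnergy {ι Z : Type*} [Fintype ι] [MeasurableSpace Z] (π : Measure Z)
    (A : Set (ι → Z)) : ℝ :=
  sInf ((fun f : Z → ℝ => ∫ z, f z ^ 2 ∂π) '' {f | IsCover A f})

section coverEnergy

variable {ι Z : Type*} [Fintype ι] [MeasurableSpace Z] {π : Measure Z} {A B : Set (ι → Z)}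
  {f : Z → ℝ}

theorem coverEnergy_le (hf : IsCover A f) : coverEnergy π A ≤ ∫ z, f z ^ 2 ∂π := by
  refine csInf_le ⟨0, ?_⟩ (mem_image_of_mem _ hf)
  rintro _ ⟨f, -, rfl⟩
  exact integral_nonneg fun z => sq_nonneg _

variable [Nonempty ι]

theorem exists_cover_lt (π : Measure Z) (A : Set (ι → Z)) {ε : ℝ} (hε : 0 < ε) :
    ∃ f, IsCover A f ∧ ∫ z, f z ^ 2 ∂π < coverEnergy π A + ε := by
  obtain ⟨_, ⟨f, hf, rfl⟩, hlt⟩ := exists_lt_of_csInf_lt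
    (show ((fun f : Z → ℝ => ∫ z, f z ^ 2 ∂π) '' {f | IsCover A f}).Nonempty from
      ⟨_, _, IsCover.const_one A, rfl⟩)
    (lt_add_of_pos_right (coverEnergy π A) hε)
  exact ⟨f, hf, hlt⟩

theorem coverEnergy_mono (hAB : A ⊆ B) : coverEnergy π A ≤ coverEnergy π B := by
  refine le_of_forall_pos_lt_add fun ε hε => ?_
  obtain ⟨f, hf, hlt⟩ := exists_cover_lt π B hε
  exact (coverEnergy_le (hf.mono hAB)).trans_lt hlt

theorem norm_toLp_two_sq {h : Z → ℝ} (hh : MemLp h 2 π) :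
    ‖hh.toLp h‖ ^ 2 = ∫ z, h z ^ 2 ∂π := by
  rw [← real_inner_self_eq_norm_sq, L2.inner_def]
  refine integral_congr_ae ?_
  filter_upwards [hh.coeFn_toLp] with z hz
  simp [hz, sq]

/-- Near-minimal covers converge, so the energy is continuous along increasing unions. -/
theorem exists_cover_iUnion [IsFiniteMeasure π] {A : ℕ → Set (ι → Z)} (hA : Monotone A) {δ : ℝ}
    (hδ : ∀ n, coverEnergy π (A n) ≤ δ) :
    ∃ g, IsCover (⋃ n, A n) g ∧ ∫ z, g z ^ 2 ∂π ≤ δ := by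
  let d : ℕ → ℝ := fun n => coverEnergy π (A n)
  let ε : ℕ → ℝ := fun n => 1 / ((n : ℝ) + 1)
  have hε : ∀ n, 0 < ε n := fun n => Nat.one_div_pos_of_nat
  have hεanti : Antitone ε := fun m n hmn => one_div_le_one_div_of_le (by positivity)
    (by gcongr)
  have hε0 : Tendsto ε atTop (𝓝 0) := tendsto_one_div_add_atTop_nhds_zero_nat
  have hd : Monotone d := fun m n hmn => coverEnergy_mono (hA hmn)
  have hbdd : BddAbove (range d) := ⟨δ, by rintro _ ⟨n, rfl⟩; exact hδ n⟩
  have hdlim := tendsto_atTop_ciSup hd hbdd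
  set D := ⨆ n, d n
  have hdD : ∀ n, d n ≤ D := le_ciSup hbdd
  choose f hf hfd using fun n => exists_cover_lt π (A n) (hε n)
  have hL : ∀ n, MemLp (f n) 2 π := fun n => (hf n).memLp π 2
  have hdist : ∀ n m, n ≤ m → ‖(hL n).toLp - (hL m).toLp‖ ^ 2 ≤ 2 * (D - d n) + 4 * ε n := by
    intro n m hnm
    have hmid := ((hf n).midpoint ((hf m).mono (hA hnm)))
    have hle := coverEnergy_le (π := π) hmid
    have heq : (fun z => (f n z - f m z) ^ 2) =
        fun z => 2 * f n z ^ 2 + 2 * f m z ^ 2 - 4 * ((f n z + f m z) / 2) ^ 2 := by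
      ext z; ring
    have hnorm : ‖(hL n).toLp - (hL m).toLp‖ ^ 2 = ∫ z, (f n z - f m z) ^ 2 ∂π := by
      rw [← MemLp.toLp_sub, norm_toLp_two_sq]
      rfl
    have hsum : Integrable (fun z => 2 * f n z ^ 2 + 2 * f m z ^ 2) π :=
      ((hL n).integrable_sq.const_mul 2).add ((hL m).integrable_sq.const_mul 2)
    rw [hnorm, heq, integral_sub hsum ((hmid.memLp π 2).integrable_sq.const_mul 4),
      integral_add ((hL n).integrable_sq.const_mul 2) ((hL m).integrable_sq.const_mul 2),
      integral_const_mul, integral_const_mul, integral_const_mul]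
    have h1 := hfd n
    have h2 := hfd m
    have h3 := hdD m
    have h4 := hεanti hnm
    simp only [d] at *
    linarith
  have hcauchy : CauchySeq fun n => (hL n).toLp := by
    refine cauchySeq_of_le_tendsto_0' (fun n => √(2 * (D - d n) + 4 * ε n)) (fun n m hnm => ?_) ?_
    · rw [dist_eq_norm]
      exact Real.le_sqrt_of_sq_le (hdist n m hnm)
    · have : Tendsto (fun n => 2 * (D - d n) + 4 * ε n) atTop (𝓝 (2 * (D - D) + 4 * 0)) :=
        ((hdlim.const_sub D).const_mul 2).add (hε0.const_mul 4)
      simpa [Function.comp_def] using (Real.continuous_sqrt.tendsto _).comp this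
  obtain ⟨G, hG⟩ := cauchySeq_tendsto_of_complete hcauchy
  obtain ⟨ns, hns, hae⟩ := (tendstoInMeasure_of_tendsto_Lp hG).exists_seq_tendsto_ae
  have hae' : ∀ᵐ z ∂π, Tendsto (fun k => f (ns k) z) atTop (𝓝 (G z)) := by
    have : ∀ᵐ z ∂π, ∀ n, ((hL n).toLp (f n) : Z → ℝ) z = f n z :=
      ae_all_iff.2 fun n => (hL n).coeFn_toLp
    filter_upwards [hae, this] with z hz hz'
    simpa only [hz'] using hz
  obtain ⟨S, hS, hSm, hSlim⟩ := hae'.exists_measurable_mem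
  classical
  let g : Z → ℝ := S.piecewise G fun _ => 1
  have hgS : ∀ z ∈ S, g z = G z := fun z hz => piecewise_eq_of_mem _ _ _ hz
  have hgSc : ∀ z ∉ S, g z = 1 := fun z hz => piecewise_eq_of_notMem _ _ _ hz
  have hgIcc : ∀ z, g z ∈ Icc (0 : ℝ) 1 := by
    intro z
    by_cases hz : z ∈ S
    · rw [hgS z hz]
      exact isClosed_Icc.mem_of_tendsto (hSlim z hz)
        (Eventually.of_forall fun k => (hf (ns k)).mem_Icc z)
    · simp [hgSc z hz]
  refine ⟨g, ⟨Measurable.piecewise hSm (Lp.stronglyMeasurable G).measurable measurable_const,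
    hgIcc, fun z hz => ?_⟩, ?_⟩
  · obtain ⟨N, hN⟩ := mem_iUnion.1 hz
    by_cases h : ∀ i, z i ∈ S
    · have hlim : Tendsto (fun k => ∑ i, f (ns k) (z i)) atTop (𝓝 (∑ i, g (z i))) :=
        tendsto_finsetSum _ fun i _ => by rw [hgS _ (h i)]; exact hSlim _ (h i)
      refine ge_of_tendsto hlim ?_
      filter_upwards [hns.tendsto_atTop.eventually_ge_atTop N] with k hk
      exact (hf (ns k)).one_le_sum z (hA hk hN)
    · push Not at h
      obtain ⟨i, hi⟩ := h
      rw [← hgSc _ hi]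
      exact Finset.single_le_sum (f := fun i => g (z i)) (fun j _ => (hgIcc _).1)
        (Finset.mem_univ i)
  · have hlim : Tendsto (fun k => ∫ z, f (ns k) z ^ 2 ∂π) atTop (𝓝 (∫ z, g z ^ 2 ∂π)) := by
      refine tendsto_integral_of_dominated_convergence (fun _ => 1)
        (fun k => ((hf _).measurable.pow_const 2).aestronglyMeasurable) (integrable_const _)
        (fun k => ae_of_all _ fun z => ?_) ?_
      · rw [Real.norm_eq_abs, abs_of_nonneg (sq_nonneg _)]
        exact pow_le_one₀ ((hf _).mem_Icc z).1 ((hf _).mem_Icc z).2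
      · filter_upwards [hS] with z hz
        rw [hgS z hz]
        exact (hSlim z hz).pow 2
    have hlim' : Tendsto (fun k => δ + ε (ns k)) atTop (𝓝 (δ + 0)) :=
      (hε0.comp hns.tendsto_atTop).const_add δ
    rw [add_zero] at hlim'
    refine le_of_tendsto_of_tendsto' hlim hlim' fun k => ?_
    linarith [hfd (ns k), hδ (ns k)]

theorem exists_null_of_coverEnergy_nonpos [IsFiniteMeasure π] (hA : coverEnergy π A ≤ 0) :
    ∃ N, MeasurableSet N ∧ π N = 0 ∧ ∀ z ∈ A, ∃ i, z i ∈ N := by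
  obtain ⟨g, hg, hg0⟩ := exists_cover_iUnion (π := π) (A := fun _ : ℕ => A) monotone_const
    fun _ => hA
  rw [iUnion_const] at hg
  refine ⟨{z | g z ≠ 0}, (hg.measurable (measurableSet_singleton 0)).compl, ?_, fun z hz => ?_⟩
  · have h0 : ∫ z, g z ^ 2 ∂π = 0 := le_antisymm hg0 (integral_nonneg fun z => sq_nonneg _)
    rw [integral_eq_zero_iff_of_nonneg (fun z => sq_nonneg _)
      (hg.memLp π 2).integrable_sq] at h0
    rw [← ae_iff (p := fun z => g z = 0)]
    filter_upwards [h0] with z hz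
    simpa using hz
  · by_contra! h
    have h1 := hg.one_le_sum z hz
    rw [Finset.sum_eq_zero fun i _ => not_not.1 (h i)] at h1
    linarith

end coverEnergy

theorem measure_le_of_forall_lintegral_le {Z : Type*} [TopologicalSpace Z] [PolishSpace Z]
    [MeasurableSpace Z] [BorelSpace Z] {M π : Measure Z} [IsFiniteMeasure M] [IsFiniteMeasure π]
    (h : ∀ f : BoundedContinuousFunction Z NNReal, ∫⁻ z, f z ∂M ≤ ∫⁻ z, f z ∂π) : M ≤ π := by
  have hclosed : ∀ F : Set Z, IsClosed F → M F ≤ π F := fun F hF =>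
    le_of_tendsto_of_tendsto' (HasOuterApproxClosed.tendsto_lintegral_apprSeq hF M)
      (HasOuterApproxClosed.tendsto_lintegral_apprSeq hF π) fun n => h _
  refine Measure.le_intro fun s hs _ => ?_
  rw [hs.measure_eq_iSup_isClosed_of_ne_top (measure_ne_top M s)]
  exact iSup₂_le fun F hF => iSup_le fun hFc => (hclosed F hFc).trans (measure_mono hF)

/-- Riesz representation on a compact space. -/
theorem exists_measure_of_positive_linearMap {T : Type*} [TopologicalSpace T] [CompactSpace T]
    [T2Space T] [MeasurableSpace T] [BorelSpace T] (L : C(T, ℝ) →ₗ[ℝ] ℝ)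
    (hL : ∀ g : C(T, ℝ), (∀ t, 0 ≤ g t) → 0 ≤ L g) :
    ∃ κ : Measure T, IsFiniteMeasure κ ∧ ∀ g : C(T, ℝ), ∫ t, g t ∂κ = L g := by
  let Λ : CompactlySupportedContinuousMap T ℝ →ₚ[ℝ] ℝ :=
    { toFun := fun g => L g.toContinuousMap
      map_add' := fun g g' => L.map_add g.toContinuousMap g'.toContinuousMap
      map_smul' := fun r g => L.map_smul r g.toContinuousMap
      monotone' := fun g g' hgg' => by
        have := hL (g'.toContinuousMap - g.toContinuousMap) fun t => sub_nonneg.2 (hgg' t)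
        rwa [map_sub, sub_nonneg] at this }
  refine ⟨RealRMK.rieszMeasure Λ, inferInstance, fun g => ?_⟩
  exact RealRMK.integral_rieszMeasure Λ ⟨g, HasCompactSupport.of_compactSpace _⟩

/-- Duality for a compact set of competitors. -/
theorem exists_measure_sum_map_le {ι Z T : Type*} [Fintype ι] [Nonempty ι]
    [TopologicalSpace Z] [PolishSpace Z] [MeasurableSpace Z] [BorelSpace Z]
    [TopologicalSpace T] [CompactSpace T] [T2Space T] [MeasurableSpace T] [BorelSpace T]
    (π : Measure Z) [IsFiniteMeasure π] {F : ι → T → Z} (hF : ∀ i, Continuous (F i))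
    {ε : ℝ} (hε : 0 < ε)
    (h : ∀ f : BoundedContinuousFunction Z ℝ, (∀ z, 0 ≤ f z) → (∀ t, 1 ≤ ∑ i, f (F i t)) →
      ε ≤ ∫ z, f z ∂π) :
    ∃ κ : Measure T, IsFiniteMeasure κ ∧ κ ≠ 0 ∧ ∑ i, κ.map (F i) ≤ π := by
  have hT : Nonempty T := by
    by_contra hT
    have := h 0 (fun _ => le_rfl) (fun t => (hT ⟨t⟩).elim)
    simp at this
    linarith
  let S : C(T, ℝ) → Set (BoundedContinuousFunction Z ℝ) := fun g =>
    {f | (∀ z, 0 ≤ f z) ∧ ∀ t, g t ≤ ∑ i, f (F i t)}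
  let I : BoundedContinuousFunction Z ℝ → ℝ := fun f => ∫ z, f z ∂π
  let N : C(T, ℝ) → ℝ := fun g => sInf (I '' S g)
  have hS : ∀ g, (I '' S g).Nonempty := by
    intro g
    refine ⟨_, BoundedContinuousFunction.const Z ‖g‖, ⟨fun z => norm_nonneg g, fun t => ?_⟩, rfl⟩
    have h1 : (1 : ℝ) ≤ Fintype.card ι := by exact_mod_cast Fintype.card_pos
    simp only [BoundedContinuousFunction.const_apply, Finset.sum_const, Finset.card_univ,
      nsmul_eq_mul]
    nlinarith [norm_nonneg g, (le_abs_self (g t)).trans (g.norm_coe_le_norm t)]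
  have hI0 : ∀ g, ∀ f ∈ S g, 0 ≤ I f := fun g f hf => integral_nonneg hf.1
  have hbdd : ∀ g, BddBelow (I '' S g) := fun g =>
    ⟨0, by rintro _ ⟨f, hf, rfl⟩; exact hI0 g f hf⟩
  have hNle : ∀ g, ∀ f ∈ S g, N g ≤ I f := fun g f hf => csInf_le (hbdd g) ⟨f, hf, rfl⟩
  have hleN : ∀ g r, (∀ f ∈ S g, r ≤ I f) → r ≤ N g := fun g r hr =>
    le_csInf (hS g) (by rintro _ ⟨f, hf, rfl⟩; exact hr f hf)
  have hI_smul : ∀ (r : ℝ) f, I (r • f) = r * I f := fun r f => by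
    simp only [I, BoundedContinuousFunction.coe_smul, smul_eq_mul, integral_const_mul]
  have hI_add : ∀ f f', I (f + f') = I f + I f' := fun f f' =>
    integral_add (f.integrable π) (f'.integrable π)
  have hS_smul : ∀ r : ℝ, 0 < r → ∀ g, ∀ f ∈ S g, r • f ∈ S (r • g) := by
    intro r hr g f hf
    refine ⟨fun z => mul_nonneg hr.le (hf.1 z), fun t => ?_⟩
    simp only [BoundedContinuousFunction.coe_smul, smul_eq_mul, ← Finset.mul_sum,
      ContinuousMap.coe_smul, Pi.smul_apply]
    exact mul_le_mul_of_nonneg_left (hf.2 t) hr.le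
  have hN_smul_le : ∀ r : ℝ, 0 < r → ∀ g, r * N g ≤ N (r • g) := by
    intro r hr g
    refine hleN _ _ fun f hf => ?_
    have h1 := hS_smul r⁻¹ (inv_pos.2 hr) _ f hf
    rw [inv_smul_smul₀ hr.ne'] at h1
    have h2 := hNle g _ h1
    rw [hI_smul] at h2
    calc r * N g ≤ r * (r⁻¹ * I f) := mul_le_mul_of_nonneg_left h2 hr.le
      _ = I f := mul_inv_cancel_left₀ hr.ne' _
  have hN_smul : ∀ r : ℝ, 0 < r → ∀ g, N (r • g) = r * N g := by
    intro r hr g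
    refine le_antisymm ?_ (hN_smul_le r hr g)
    have := hN_smul_le r⁻¹ (inv_pos.2 hr) (r • g)
    rw [inv_smul_smul₀ hr.ne', inv_mul_le_iff₀ hr] at this
    exact this
  have hN_add : ∀ g g', N (g + g') ≤ N g + N g' := by
    intro g g'
    rw [← sub_le_iff_le_add']
    refine hleN _ _ fun f' hf' => ?_
    rw [sub_le_comm]
    refine hleN _ _ fun f hf => ?_
    rw [sub_le_iff_le_add, ← hI_add]
    refine hNle _ _ ⟨fun z => add_nonneg (hf.1 z) (hf'.1 z), fun t => ?_⟩
    simp only [BoundedContinuousFunction.coe_add, Pi.add_apply, Finset.sum_add_distrib,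
      ContinuousMap.coe_add]
    exact add_le_add (hf.2 t) (hf'.2 t)
  have hone : (1 : C(T, ℝ)) ≠ 0 := one_ne_zero
  let L₀ : C(T, ℝ) →ₗ.[ℝ] ℝ := LinearPMap.mkSpanSingleton 1 ε hone
  have hdom : ∀ x : L₀.domain, L₀ x ≤ N x := by
    rintro ⟨x, hx⟩
    obtain ⟨r, rfl⟩ := Submodule.mem_span_singleton.1 hx
    have hx' : L₀ ⟨r • 1, hx⟩ = r * ε := LinearPMap.mkSpanSingleton'_apply _ _ _ r _
    rw [hx']
    rcases le_or_gt r 0 with hr | hr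
    · exact (mul_nonpos_of_nonpos_of_nonneg hr hε.le).trans (hleN _ _ (hI0 _))
    · simp only [hN_smul r hr]
      exact mul_le_mul_of_nonneg_left (hleN _ _ fun f hf => h f hf.1 hf.2) hr.le
  obtain ⟨L, hLdom, hLN⟩ := exists_extension_of_le_sublinear L₀ N hN_smul hN_add hdom
  have hL1 : L 1 = ε := (hLdom ⟨1, Submodule.mem_span_singleton_self _⟩).trans
    (LinearPMap.mkSpanSingleton_apply ℝ ℝ hone ε)
  obtain ⟨κ, hκ, hκL⟩ := exists_measure_of_positive_linearMap L fun g hg => by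
    have h1 := (hLN (-g)).trans (hNle (-g) 0 ⟨fun _ => le_rfl, fun t => by simpa using hg t⟩)
    simp only [map_neg, I, BoundedContinuousFunction.coe_zero, Pi.zero_apply,
      integral_zero] at h1
    linarith
  refine ⟨κ, hκ, ?_, ?_⟩
  · rintro rfl
    have := hκL 1
    rw [hL1, integral_zero_measure] at this
    exact hε.ne this
  · refine measure_le_of_forall_lintegral_le fun f => ?_
    let f' : BoundedContinuousFunction Z ℝ :=
      ⟨⟨fun z => (f z : ℝ), by fun_prop⟩, f.map_bounded'⟩
    rw [← ENNReal.toReal_le_toReal (f.lintegral_lt_top_of_nnreal _).ne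
      (f.lintegral_lt_top_of_nnreal _).ne, f.toReal_lintegral_coe_eq_integral,
      f.toReal_lintegral_coe_eq_integral]
    change ∫ z, f' z ∂_ ≤ I f'
    rw [integral_finsetSum_measure fun i _ => f'.integrable (κ.map (F i))]
    let g : C(T, ℝ) := ⟨fun t => ∑ i, f' (F i t), by fun_prop⟩
    have h1 : L g ≤ I f' := (hLN g).trans (hNle g f' ⟨fun z => (f z).2, fun t => le_rfl⟩)
    rw [← hκL] at h1
    refine le_trans (le_of_eq ?_) h1
    have hint : ∀ i, Integrable (fun t => f' (F i t)) κ := fun i =>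
      (f'.compContinuous ⟨F i, hF i⟩).integrable κ
    change _ = ∫ t, ∑ i, f' (F i t) ∂κ
    rw [integral_finsetSum _ fun i _ => hint i]
    refine Finset.sum_congr rfl fun i _ => ?_
    exact integral_map (hF i).aemeasurable f'.continuous.aestronglyMeasurable

/-- Kellerer's lemma: a Borel set that carries no multicoupling dominated by `π` is covered by
cylinders over a `π`-null set. -/
theorem exists_null_of_forall_sum_map_le {ι Z : Type*} [Fintype ι] [Nonempty ι]
    [TopologicalSpace Z] [PolishSpace Z] [MeasurableSpace Z] [BorelSpace Z]
    (π : Measure Z) [IsFiniteMeasure π] {B : Set (ι → Z)} (hB : MeasurableSet B)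
    (h : ∀ κ : Measure (ι → Z), IsFiniteMeasure κ → κ Bᶜ = 0 →
      ∑ i, κ.map (fun z => z i) ≤ π → κ = 0) :
    ∃ N, MeasurableSet N ∧ π N = 0 ∧ ∀ z ∈ B, ∃ i, z i ∈ N := by
  refine exists_null_of_coverEnergy_nonpos (le_of_not_gt fun hpos => ?_)
  have hBa := hB.analyticSet
  rw [AnalyticSet] at hBa
  obtain rfl | ⟨f, hf, rfl⟩ := hBa
  · have h0 : IsCover (∅ : Set (ι → Z)) fun _ => 0 :=
      ⟨measurable_const, fun _ => by simp, fun z hz => hz.elim⟩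
    have := coverEnergy_le (π := π) h0
    simp at this
    linarith
  obtain ⟨δ, hδ0, hδ⟩ := exists_between hpos
  obtain ⟨T, hT, hTU⟩ := exists_compact_of_range (fun A => δ < coverEnergy π A)
    (fun hAB hA => hA.trans_le (coverEnergy_mono hAB))
    (fun A hA hbig => by
      by_contra! hle
      obtain ⟨g, hg, hgδ⟩ := exists_cover_iUnion hA hle
      exact (hbig.trans_le ((coverEnergy_le hg).trans hgδ)).false) hf hδ
  have := isCompact_iff_compactSpace.1 hT
  have hF : ∀ i, Continuous fun t : T => f t i := fun i => by fun_prop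
  obtain ⟨κ, hκ, hκ0, hκπ⟩ := exists_measure_sum_map_le π hF (half_pos hδ0) fun f₀ hf₀ hcov => by
    let U : Set (ι → Z) := {z | 1 / 2 < ∑ i, f₀ (z i)}
    have hU : IsOpen U := isOpen_lt continuous_const (by fun_prop)
    have hfU : f '' T ⊆ U := by
      rintro _ ⟨t, ht, rfl⟩
      exact one_half_lt_one.trans_le (hcov ⟨t, ht⟩)
    have hg : IsCover U fun z => min (2 * f₀ z) 1 := by
      refine ⟨(by fun_prop : Continuous fun z => min (2 * f₀ z) 1).measurable,
        fun z => ⟨le_min (by linarith [hf₀ z]) zero_le_one, min_le_right _ _⟩, fun z hz => ?_⟩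
      by_cases hbig : ∃ i, 1 ≤ 2 * f₀ (z i)
      · obtain ⟨i, hi⟩ := hbig
        calc (1 : ℝ) = min (2 * f₀ (z i)) 1 := (min_eq_right hi).symm
          _ ≤ _ := Finset.single_le_sum (f := fun i => min (2 * f₀ (z i)) 1)
            (fun j _ => le_min (by linarith [hf₀ (z j)]) zero_le_one) (Finset.mem_univ i)
      · push Not at hbig
        rw [Finset.sum_congr rfl fun i _ => min_eq_left (hbig i).le, ← Finset.mul_sum]
        have : 1 / 2 < ∑ i, f₀ (z i) := hz
        linarith
    have h1 := (hTU U hU hfU).trans_le (coverEnergy_le hg)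
    have h2 : ∫ z, min (2 * f₀ z) 1 ^ 2 ∂π ≤ ∫ z, 2 * f₀ z ∂π := by
      refine integral_mono (hg.memLp π 2).integrable_sq ((f₀.integrable π).const_mul 2) fun z => ?_
      have := (hg.mem_Icc z)
      calc min (2 * f₀ z) 1 ^ 2 ≤ min (2 * f₀ z) 1 := by nlinarith [this.1, this.2]
        _ ≤ 2 * f₀ z := min_le_left _ _
    rw [integral_const_mul] at h2
    linarith
  have hfm : Measurable fun t : T => f t := by fun_prop
  refine hκ0 ((Measure.map_eq_zero_iff hfm.aemeasurable).1
    (h (κ.map fun t : T => f t) inferInstance ?_ ?_))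
  · rw [Measure.map_apply hfm hB.compl]
    convert measure_empty (μ := κ)
    ext t
    simp
  · convert hκπ using 2 with i
    exact Measure.map_map (measurable_pi_apply i) hfm

theorem map_sum_map {ι α β γ : Type*} [Fintype ι] [MeasurableSpace α] [MeasurableSpace β]
    [MeasurableSpace γ] {κ : Measure α} {f : β → γ} (hf : Measurable f) {F : ι → α → β}
    (hF : ∀ i, Measurable (F i)) :
    (∑ i, κ.map (F i)).map f = ∑ i, κ.map (fun z => f (F i z)) := by
  simp_rw [← Measure.mapₗ_apply_of_measurable hf, _root_.map_sum,
    Measure.mapₗ_apply_of_measurable hf, Measure.map_map hf (hF _), Function.comp_def]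

/-- An optimal plan dominates no nonzero multicoupling of tuples whose cost drops when their
second coordinates are shifted cyclically. -/
theorem eq_zero_of_sum_map_le_of_optimal {X Y : Type*} [MeasurableSpace X] [MeasurableSpace Y]
    {c : X × Y → ℝ} (hc : Measurable c) (hc_nonneg : ∀ p, 0 ≤ c p)
    {π : Measure (X × Y)} [IsProbabilityMeasure π]
    (hfin : ∫⁻ p, ENNReal.ofReal (c p) ∂π ≠ ⊤)
    (hopt : ∀ P : Measure (X × Y), IsProbabilityMeasure P →
      P.map Prod.fst = π.map Prod.fst → P.map Prod.snd = π.map Prod.snd →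
      ∫⁻ p, ENNReal.ofReal (c p) ∂π ≤ ∫⁻ p, ENNReal.ofReal (c p) ∂P)
    {l : ℕ} {κ : Measure (Fin (l + 1) → X × Y)} [IsFiniteMeasure κ]
    (hκ : ∀ᵐ z ∂κ, ∑ i, c ((z i).1, (z (i + 1)).2) < ∑ i, c (z i))
    (hκπ : ∑ i, κ.map (fun z => z i) ≤ π) : κ = 0 := by
  by_contra hκ0
  let s : Fin (l + 1) → (Fin (l + 1) → X × Y) → X × Y := fun i z => ((z i).1, (z (i + 1)).2)
  have hs : ∀ i, Measurable (s i) := fun i => by fun_prop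
  have he : ∀ i : Fin (l + 1), Measurable fun z : Fin (l + 1) → X × Y => z i :=
    measurable_pi_apply
  let M : Measure (X × Y) := ∑ i, κ.map (fun z => z i)
  let M' : Measure (X × Y) := ∑ i, κ.map (s i)
  have hMπ : M ≤ π := hκπ
  have hM : IsFiniteMeasure M := isFiniteMeasure_of_le π hMπ
  have hπ : π - M + M = π := Measure.sub_add_cancel_of_le hMπ
  have hfst : M'.map Prod.fst = M.map Prod.fst := by
    rw [map_sum_map measurable_fst hs, map_sum_map measurable_fst he]
  have hsnd : M'.map Prod.snd = M.map Prod.snd := by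
    rw [map_sum_map measurable_snd hs, map_sum_map measurable_snd he]
    exact Equiv.sum_comp (Equiv.addRight (1 : Fin (l + 1))) fun i => κ.map fun z => (z i).2
  have hP₁ : (π - M + M').map Prod.fst = π.map Prod.fst := by
    rw [Measure.map_add _ _ measurable_fst, hfst, ← Measure.map_add _ _ measurable_fst, hπ]
  have hP₂ : (π - M + M').map Prod.snd = π.map Prod.snd := by
    rw [Measure.map_add _ _ measurable_snd, hsnd, ← Measure.map_add _ _ measurable_snd, hπ]
  have hP : IsProbabilityMeasure (π - M + M') := ⟨by
    rw [← preimage_univ (f := Prod.fst), ← Measure.map_apply measurable_fst .univ, hP₁,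
      Measure.map_apply measurable_fst .univ, preimage_univ, measure_univ]⟩
  have hle := hopt _ hP hP₁ hP₂
  have hπ' : ∫⁻ p, ENNReal.ofReal (c p) ∂π =
      ∫⁻ p, ENNReal.ofReal (c p) ∂(π - M) + ∫⁻ p, ENNReal.ofReal (c p) ∂M := by
    rw [← lintegral_add_measure, hπ]
  rw [hπ', lintegral_add_measure] at hle
  rw [hπ'] at hfin
  have hle' := (ENNReal.add_le_add_iff_left (ENNReal.add_ne_top.1 hfin).1).1 hle
  have lint : ∀ F : Fin (l + 1) → (Fin (l + 1) → X × Y) → X × Y, (∀ i, Measurable (F i)) →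
      ∫⁻ p, ENNReal.ofReal (c p) ∂(∑ i, κ.map (F i)) =
        ∫⁻ z, ENNReal.ofReal (∑ i, c (F i z)) ∂κ := by
    intro F hF
    simp_rw [ENNReal.ofReal_sum_of_nonneg fun i _ => hc_nonneg _]
    have hcF : ∀ i, Measurable fun z => ENNReal.ofReal (c (F i z)) := fun i =>
      (hc.comp (hF i)).ennreal_ofReal
    rw [lintegral_finsetSum_measure, lintegral_finsetSum _ fun i _ => hcF i]
    exact Finset.sum_congr rfl fun i _ => lintegral_map hc.ennreal_ofReal (hF i)
  have hMfin := (ENNReal.add_ne_top.1 hfin).2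
  rw [lint _ he, lint _ hs] at hle'
  rw [lint _ he] at hMfin
  refine (lintegral_strict_mono hκ0 ?_ (ne_top_of_le_ne_top hMfin ?_) ?_).not_ge hle'
  · exact (Finset.measurable_sum _ fun i _ => hc.comp (he i)).ennreal_ofReal.aemeasurable
  · exact lintegral_mono_ae (hκ.mono fun z hz => ENNReal.ofReal_le_ofReal hz.le)
  · filter_upwards [hκ] with z hz
    exact (ENNReal.ofReal_lt_ofReal_iff_of_nonneg
      (Finset.sum_nonneg fun i _ => hc_nonneg _)).2 hz

/-- **Theorem (characterization of optimal transport plans).**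
For Borel measurable `c : X × Y → [0,∞)` on Polish spaces and a transport plan
`π ∈ Π(μ,ν)` with finite cost, `π` is optimal if and only if `π` is concentrated on a
`c`-cyclically monotone Borel set. -/
theorem statement0
    {X Y : Type*}
    [TopologicalSpace X] [PolishSpace X] [MeasurableSpace X] [BorelSpace X]
    [TopologicalSpace Y] [PolishSpace Y] [MeasurableSpace Y] [BorelSpace Y]
    (μ : Measure X) (ν : Measure Y)
    [IsProbabilityMeasure μ] [IsProbabilityMeasure ν]
    (c : X × Y → ℝ) (hc_meas : Measurable c) (hc_nonneg : ∀ p, 0 ≤ c p)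
    (π : Measure (X × Y)) [IsProbabilityMeasure π]
    (hπ₁ : π.map Prod.fst = μ) (hπ₂ : π.map Prod.snd = ν)
    (hfin : ∫⁻ p, ENNReal.ofReal (c p) ∂π ≠ ⊤) :
    (∀ P : Measure (X × Y), IsProbabilityMeasure P →
        P.map Prod.fst = μ → P.map Prod.snd = ν →
        ∫⁻ p, ENNReal.ofReal (c p) ∂π ≤ ∫⁻ p, ENNReal.ofReal (c p) ∂P)
      ↔ ∃ Γ : Set (X × Y), MeasurableSet Γ ∧ π Γᶜ = 0 ∧ CCyclicallyMonotone c Γ := by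
  constructor
  · intro hopt
    subst hπ₁ hπ₂
    let B : ∀ l : ℕ, Set (Fin (l + 1) → X × Y) := fun l =>
      {z | ∑ i, c ((z i).1, (z (i + 1)).2) < ∑ i, c (z i)}
    have hB : ∀ l, MeasurableSet (B l) := fun l => measurableSet_lt
      (Finset.measurable_sum _ fun i _ => hc_meas.comp (by fun_prop))
      (Finset.measurable_sum _ fun i _ => hc_meas.comp (by fun_prop))
    choose N hN hN0 hNB using fun l => exists_null_of_forall_sum_map_le π (hB l)
      fun κ hκ hκB hκπ => eq_zero_of_sum_map_le_of_optimal hc_meas hc_nonneg hfin hopt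
        (mem_ae_iff.2 hκB) hκπ
    refine ⟨(⋃ l, N l)ᶜ, (MeasurableSet.iUnion hN).compl, ?_, fun l z hz => ?_⟩
    · rw [compl_compl]
      exact measure_iUnion_null hN0
    · by_contra! hlt
      obtain ⟨i, hi⟩ := hNB l z hlt
      exact hz i (mem_iUnion.2 ⟨l, hi⟩)
  · rintro ⟨Γ, hΓ, hπΓ, hcyc⟩ P hP h₁ h₂
    exact hcyc.lintegral_le hc_meas hc_nonneg hΓ (mem_ae_iff.2 hπΓ) hfin
      (h₁.trans hπ₁.symm) (h₂.trans hπ₂.symm)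
end

section
/- Let E be a Polish space, c : E → ℝ Borel measurable, and F a family of Borel measurable functions on E such that (i) there exists a function g : E → [0, ∞) with the property that every f ∈ F satisfies |f| ≤ a_f · g for some constant a_f ∈ [0, ∞), and (ii) either all members of F are continuous, or F is at most countable. If P* is a minimizer of the generalized moment problem min{∫ c dP : P a Borel probability measure on E with ∫ f dP = 0 for all f ∈ F} and ∫ c dP* is finite, then P* is finitely minimal / c-monotone. -/
open MeasureTheory

/-- `α'` is a competitor of `α` with respect to the family `F`: same total mass and the
same integrals against all functions of `F`. -/
def IsCompetitor {E : Type*} [MeasurableSpace E] (F : Set (E → ℝ))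
    (α α' : Measure E) : Prop :=
  α' Set.univ = α Set.univ ∧ ∀ f ∈ F, ∫ x, f x ∂α' = ∫ x, f x ∂α

/-- A set `Γ ⊆ E` is finitely minimal / `c`-monotone: no finite measure concentrated on
finitely many points of `Γ` has a `c`-better competitor concentrated on finitely many
points of `E`. -/
def FinitelyMinimal {E : Type*} [MeasurableSpace E] (c : E → ℝ) (F : Set (E → ℝ))
    (Γ : Set E) : Prop :=
  ∀ α α' : Measure E, IsFiniteMeasure α → IsFiniteMeasure α' →
    (∃ S : Finset E, ↑S ⊆ Γ ∧ α (↑S : Set E)ᶜ = 0) →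
    (∃ S : Finset E, α' (↑S : Set E)ᶜ = 0) →
    IsCompetitor F α α' →
    ¬ (∫ x, c x ∂α' < ∫ x, c x ∂α)

open Filter Topology

/-- Near-minimizers of the norm along a decreasing sequence of bounded midpoint-convex sets
form a Cauchy sequence. -/
lemma exists_cauchySeq_of_antitone_midpoint_convex {H : Type*} [NormedAddCommGroup H]
    [InnerProductSpace ℝ H] (S : ℕ → Set H) (hS : Antitone S) (hne : ∀ n, (S n).Nonempty)
    (hmid : ∀ n, ∀ x ∈ S n, ∀ y ∈ S n, (2⁻¹ : ℝ) • (x + y) ∈ S n) (R : ℝ)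
    (hR : ∀ n, ∀ x ∈ S n, ‖x‖ ^ 2 ≤ R) :
    ∃ x : ℕ → H, (∀ n, x n ∈ S n) ∧ CauchySeq x := by
  set d : ℕ → ℝ := fun n => sInf ((fun x => ‖x‖ ^ 2) '' S n) with hd
  have hbdd : ∀ n, BddBelow ((fun x => ‖x‖ ^ 2) '' S n) := fun n =>
    ⟨0, by rintro _ ⟨x, -, rfl⟩; positivity⟩
  have hd_le : ∀ n, ∀ x ∈ S n, d n ≤ ‖x‖ ^ 2 := fun n x hx =>
    csInf_le (hbdd n) ⟨x, hx, rfl⟩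
  have hd_mono : Monotone d := fun n m hnm =>
    csInf_le_csInf (hbdd n) ((hne m).image _) (Set.image_mono (hS hnm))
  have hd_bdd : BddAbove (Set.range d) := by
    refine ⟨R, ?_⟩
    rintro _ ⟨n, rfl⟩
    obtain ⟨x, hx⟩ := hne n
    exact (hd_le n x hx).trans (hR n x hx)
  have hd_lim : Tendsto d atTop (𝓝 (⨆ n, d n)) := tendsto_atTop_ciSup hd_mono hd_bdd
  have hex : ∀ n : ℕ, ∃ x ∈ S n, ‖x‖ ^ 2 < d n + 1 / ((n : ℝ) + 1) := by
    intro n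
    have hlt : d n < d n + 1 / ((n : ℝ) + 1) := by
      have : (0 : ℝ) < 1 / ((n : ℝ) + 1) := by positivity
      linarith
    obtain ⟨_, ⟨x, hx, rfl⟩, hlt⟩ := exists_lt_of_csInf_lt ((hne n).image _) hlt
    exact ⟨x, hx, hlt⟩
  choose x hxS hx using hex
  refine ⟨x, hxS, ?_⟩
  have hb : Tendsto (fun n : ℕ => √(4 * ((⨆ n, d n) - d n) + 4 * (1 / ((n : ℝ) + 1)))) atTop
      (𝓝 0) := by
    have h1 : Tendsto (fun n : ℕ => 4 * ((⨆ n, d n) - d n) + 4 * (1 / ((n : ℝ) + 1))) atTop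
        (𝓝 (4 * ((⨆ n, d n) - (⨆ n, d n)) + 4 * 0)) :=
      ((tendsto_const_nhds.sub hd_lim).const_mul 4).add
        (tendsto_one_div_add_atTop_nhds_zero_nat.const_mul 4)
    simpa using h1.sqrt
  refine cauchySeq_of_le_tendsto_0' _ (fun n m hnm => ?_) hb
  rw [dist_eq_norm]
  refine Real.le_sqrt_of_sq_le ?_
  have hpar := parallelogram_law_with_norm ℝ (x n) (x m)
  have hmidle := hd_le n _ (hmid n _ (hxS n) _ (hS hnm (hxS m)))
  rw [norm_smul, mul_pow] at hmidle
  norm_num at hmidle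
  have hdn := le_ciSup hd_bdd n
  have hdm := le_ciSup hd_bdd m
  have hxn := hx n
  have hxm := hx m
  have hfrac : 1 / ((m : ℝ) + 1) ≤ 1 / ((n : ℝ) + 1) := by
    have : (n : ℝ) ≤ m := by exact_mod_cast hnm
    gcongr
  nlinarith

/-- `f` is a measurable function with values in `[0, 1]` such that `∑ i, f ∘ h i` dominates the
indicator of `A`. -/
def IsFractionalCover {ι Z E : Type*} [Fintype ι] [MeasurableSpace E] (h : ι → Z → E)
    (A : Set Z) (f : E → ℝ) : Prop :=
  Measurable f ∧ (∀ x, f x ∈ Set.Icc (0 : ℝ) 1) ∧ ∀ z ∈ A, 1 ≤ ∑ i, f (h i z)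

namespace IsFractionalCover

variable {ι Z E : Type*} [Fintype ι] [MeasurableSpace E] {h : ι → Z → E}
  {A B : Set Z} {f f' : E → ℝ}

lemma anti (hf : IsFractionalCover h B f) (hAB : A ⊆ B) : IsFractionalCover h A f :=
  ⟨hf.1, hf.2.1, fun z hz => hf.2.2 z (hAB hz)⟩

lemma midpoint (hf : IsFractionalCover h A f) (hf' : IsFractionalCover h A f') :
    IsFractionalCover h A ((2⁻¹ : ℝ) • (f + f')) := by
  refine ⟨(hf.1.add hf'.1).const_smul _, fun x => ?_, fun z hz => ?_⟩
  · have h1 := hf.2.1 x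
    have h2 := hf'.2.1 x
    simp only [Set.mem_Icc, Pi.smul_apply, Pi.add_apply, smul_eq_mul] at *
    constructor <;> linarith
  · have h1 := hf.2.2 z hz
    have h2 := hf'.2.2 z hz
    simp only [Pi.smul_apply, Pi.add_apply, smul_eq_mul, ← Finset.mul_sum,
      Finset.sum_add_distrib]
    linarith

lemma norm_le (hf : IsFractionalCover h A f) (x : E) : ‖f x‖ ≤ 1 := by
  rw [Real.norm_of_nonneg (hf.2.1 x).1]
  exact (hf.2.1 x).2

lemma memLp (hf : IsFractionalCover h A f) (m : Measure E) [IsFiniteMeasure m] (p : ENNReal) :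
    MemLp f p m :=
  MemLp.of_bound hf.1.aestronglyMeasurable 1 (ae_of_all _ hf.norm_le)

lemma integrable (hf : IsFractionalCover h A f) (m : Measure E) [IsFiniteMeasure m] :
    Integrable f m :=
  memLp_one_iff_integrable.1 (hf.memLp m 1)

end IsFractionalCover

/-- The minimal mass of a fractional cover is continuous along increasing unions. -/
lemma exists_isFractionalCover_iUnion {ι Z E : Type*} [Fintype ι] [MeasurableSpace E]
    (m : Measure E) [IsFiniteMeasure m] (h : ι → Z → E) (A : ℕ → Set Z) (hA : Monotone A)
    (s : ℝ) (hs : ∀ n, ∃ f, IsFractionalCover h (A n) f ∧ ∫ x, f x ∂m ≤ s) :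
    ∃ f, IsFractionalCover h (⋃ n, A n) f ∧ ∫ x, f x ∂m ≤ s := by
  have hLp : ∀ {n : ℕ} {f : E → ℝ}, IsFractionalCover h (A n) f → MemLp f 2 m :=
    fun hf => hf.memLp m 2
  let S : ℕ → Set (Lp ℝ 2 m) := fun n =>
    {F | ∃ f, ∃ hf : IsFractionalCover h (A n) f, ∫ x, f x ∂m ≤ s ∧ (hLp hf).toLp f = F}
  obtain ⟨F, hFS, hF⟩ := exists_cauchySeq_of_antitone_midpoint_convex S
    (fun n k hnk F => by
      rintro ⟨f, hf, hfs, rfl⟩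
      exact ⟨f, hf.anti (hA hnk), hfs, rfl⟩)
    (fun n => by
      obtain ⟨f, hf, hfs⟩ := hs n
      exact ⟨_, f, hf, hfs, rfl⟩)
    (fun n F hF G hG => by
      obtain ⟨f, hf, hfs, rfl⟩ := hF
      obtain ⟨g, hg, hgs, rfl⟩ := hG
      refine ⟨_, hf.midpoint hg, ?_, rfl⟩
      simp only [Pi.smul_apply, Pi.add_apply]
      rw [integral_smul, integral_add (hf.integrable m) (hg.integrable m), smul_eq_mul]
      linarith)
    (((measureUnivNNReal m : ℝ) ^ ((2 : ENNReal).toReal)⁻¹ * 1) ^ 2)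
    (fun n F hF => by
      obtain ⟨f, hf, hfs, rfl⟩ := hF
      have hle := Lp.norm_le_of_ae_bound (f := (hLp hf).toLp f) zero_le_one (by
        filter_upwards [(hLp hf).coeFn_toLp] with x hx
        rw [hx]
        exact hf.norm_le x)
      gcongr)
  choose f hf hfs hfF using hFS
  obtain ⟨G, hG⟩ := cauchySeq_tendsto_of_complete hF
  obtain ⟨ns, hns, hlim⟩ := (tendstoInMeasure_of_tendsto_Lp hG).exists_seq_tendsto_ae
  have hlim' : ∀ᵐ x ∂m, Tendsto (fun i => f (ns i) x) atTop (𝓝 (G x)) := by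
    have hall : ∀ᵐ x ∂m, ∀ n, F n x = f n x := by
      rw [ae_all_iff]
      intro n
      rw [← hfF n]
      exact (hLp (hf n)).coeFn_toLp
    filter_upwards [hlim, hall] with x hx hx'
    simpa [hx'] using hx
  have hbdd : ∀ x, IsBoundedUnder (· ≤ ·) atTop (fun i => f (ns i) x) := fun x =>
    isBoundedUnder_of ⟨1, fun i => ((hf _).2.1 x).2⟩
  have hbdd' : ∀ x, IsBoundedUnder (· ≥ ·) atTop (fun i => f (ns i) x) := fun x =>
    isBoundedUnder_of ⟨0, fun i => ((hf _).2.1 x).1⟩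
  refine ⟨fun x => limsup (fun i => f (ns i) x) atTop,
    ⟨Measurable.limsup fun i => (hf _).1, fun x => ⟨?_, ?_⟩, fun z hz => ?_⟩, ?_⟩
  · exact le_limsup_of_le (hbdd x) fun b hb => by
      obtain ⟨i, hi⟩ := hb.exists
      exact ((hf _).2.1 x).1.trans hi
  · exact limsup_le_of_le (hbdd' x).isCoboundedUnder_le
      (Eventually.of_forall fun i => ((hf _).2.1 x).2)
  · refine le_of_forall_pos_lt_add fun ε hε => ?_
    obtain ⟨n, hn⟩ := Set.mem_iUnion.1 hz
    have hδ : 0 < ε / (Fintype.card ι + 1) := by positivity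
    have hev : ∀ᶠ i in atTop, ∀ j, f (ns i) (h j z)
        < limsup (fun i => f (ns i) (h j z)) atTop + ε / (Fintype.card ι + 1) := by
      rw [eventually_all]
      exact fun j => eventually_lt_of_limsup_lt (by linarith) (hbdd _)
    obtain ⟨i, hi, hin⟩ := (hev.and (eventually_ge_atTop n)).exists
    have h1 : 1 ≤ ∑ j, f (ns i) (h j z) :=
      (hf _).2.2 z (hA (hin.trans (hns.id_le i)) hn)
    have h2 := Finset.sum_le_sum fun j (_ : j ∈ Finset.univ) => (hi j).le
    rw [Finset.sum_add_distrib, Finset.sum_const, Finset.card_univ, nsmul_eq_mul] at h2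
    have h3 : (Fintype.card ι : ℝ) * (ε / (Fintype.card ι + 1)) < ε := by
      rw [mul_div_assoc', div_lt_iff₀ (by positivity)]
      nlinarith
    linarith
  · have hconv : Tendsto (fun i => ∫ x, f (ns i) x ∂m) atTop
        (𝓝 (∫ x, limsup (fun i => f (ns i) x) atTop ∂m)) := by
      refine tendsto_integral_of_dominated_convergence (fun _ => 1)
        (fun i => (hf _).1.aestronglyMeasurable) (integrable_const _)
        (fun i => ae_of_all _ (hf _).norm_le) ?_
      filter_upwards [hlim'] with x hx
      rwa [hx.limsup_eq]
    exact le_of_tendsto hconv (Eventually.of_forall fun i => hfs _)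

/-- If fractional covers of the whole space can have arbitrarily small mass, then the whole space
is covered by null sets. -/
lemma exists_null_cover {ι Z E : Type*} [Fintype ι] [MeasurableSpace E]
    (m : Measure E) [IsFiniteMeasure m] (h : ι → Z → E)
    (hs : ∀ δ > 0, ∃ f, IsFractionalCover h Set.univ f ∧ ∫ x, f x ∂m < δ) :
    ∃ N : Set E, m N = 0 ∧ ∀ z, ∃ i, h i z ∈ N := by
  have hs' : ∀ n : ℕ, ∃ f, IsFractionalCover h Set.univ f ∧ ∫ x, f x ∂m < (1 / 2 : ℝ) ^ n :=
    fun n => hs _ (by positivity)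
  choose f hf hfs using hs'
  let g : ℕ → E → ENNReal := fun n x => ENNReal.ofReal (f n x)
  have hgm : ∀ n, Measurable (g n) := fun n => (hf n).1.ennreal_ofReal
  refine ⟨{x | ⊤ ≤ ∑' n, g n x}, ?_, fun z => ?_⟩
  · suffices hae : ∀ᵐ x ∂m, ∑' n, g n x < ⊤ by simpa [ae_iff] using hae
    refine ae_lt_top (Measurable.tsum hgm) ?_
    rw [lintegral_tsum fun n => (hgm n).aemeasurable]
    refine ne_top_of_le_ne_top (b := ∑' n : ℕ, ENNReal.ofReal ((1 / 2 : ℝ) ^ n)) ?_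
      (ENNReal.tsum_le_tsum fun n => ?_)
    · rw [← ENNReal.ofReal_tsum_of_nonneg (fun n => by positivity) summable_geometric_two]
      exact ENNReal.ofReal_ne_top
    · rw [← ofReal_integral_eq_lintegral_ofReal ((hf n).integrable m)
        (ae_of_all _ fun x => ((hf n).2.1 x).1)]
      exact ENNReal.ofReal_le_ofReal (hfs n).le
  · by_contra! hcon
    replace hcon : ∀ i, ∑' n, g n (h i z) < ⊤ := fun i => not_le.1 (hcon i)
    have hfin : ∑' n, ∑ i, g n (h i z) < ⊤ := by
      rw [Summable.tsum_finsetSum fun i _ => ENNReal.summable]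
      exact ENNReal.sum_lt_top.2 fun i _ => hcon i
    have hone : ∀ n, 1 ≤ ∑ i, g n (h i z) := fun n => by
      rw [← ENNReal.ofReal_sum_of_nonneg fun i _ => ((hf n).2.1 _).1, ← ENNReal.ofReal_one]
      exact ENNReal.ofReal_le_ofReal ((hf n).2.2 z (Set.mem_univ _))
    have hle := ENNReal.tsum_le_tsum hone
    rw [ENNReal.tsum_const_eq_top_of_ne_zero one_ne_zero, top_le_iff] at hle
    exact hfin.ne hle

/-- An open set containing the box `{z | ∀ i, z i ≤ b i}` in Baire space contains a box that
constrains finitely many coordinates only. -/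
lemma exists_finite_box_subset (b : ℕ → ℕ) {U : Set (ℕ → ℕ)} (hU : IsOpen U)
    (hbU : {z : ℕ → ℕ | ∀ i, z i ≤ b i} ⊆ U) :
    ∃ n, {z : ℕ → ℕ | ∀ i < n, z i ≤ b i} ⊆ U := by
  by_contra! hcon
  have hex : ∀ n, ∃ z : ℕ → ℕ, (∀ i < n, z i ≤ b i) ∧ z ∉ U := fun n => by
    obtain ⟨z, hz, hzU⟩ := Set.not_subset.1 (hcon n)
    exact ⟨z, hz, hzU⟩
  choose z hz hzU using hex
  have hK : IsCompact (Set.pi Set.univ fun i => Set.Iic (b i)) :=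
    isCompact_univ_pi fun i => (Set.finite_Iic (b i)).isCompact
  obtain ⟨t, ht, φ, hφ, hlim⟩ := hK.tendsto_subseq (x := fun n i => min (z n i) (b i))
    fun n i _ => min_le_right (z n i) (b i)
  have htU : t ∈ U := hbU fun i => ht i (Set.mem_univ i)
  have hlim' : Tendsto (fun n => z (φ n)) atTop (𝓝 t) := by
    rw [tendsto_pi_nhds] at hlim ⊢
    intro i
    refine (hlim i).congr' ?_
    filter_upwards [eventually_gt_atTop i] with n hn
    exact min_eq_left (hz _ i (hn.trans_le (hφ.id_le n)))
  obtain ⟨n, hn⟩ := (hlim'.eventually (hU.mem_nhds htU)).exists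
  exact hzU _ hn

/-- If fractional covers of Baire space have mass bounded below, then so do fractional covers of
the neighbourhoods of a suitable compact set. -/
lemma exists_isCompact_forall_isFractionalCover {ι E : Type*} [Fintype ι] [MeasurableSpace E]
    (m : Measure E) [IsFiniteMeasure m] (h : ι → (ℕ → ℕ) → E) {δ δ' : ℝ} (hδ : δ' < δ)
    (hs : ∀ f, IsFractionalCover h Set.univ f → δ ≤ ∫ x, f x ∂m) :
    ∃ K : Set (ℕ → ℕ), IsCompact K ∧ ∀ U, IsOpen U → K ⊆ U →
      ∀ f, IsFractionalCover h U f → δ' ≤ ∫ x, f x ∂m := by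
  let P : Set (ℕ → ℕ) → Prop := fun A =>
    ∃ s, δ' < s ∧ ∀ f, IsFractionalCover h A f → s ≤ ∫ x, f x ∂m
  have hstep : ∀ (n : ℕ) (A : {A // P A}), ∃ b : ℕ, P (A.1 ∩ {z | z n ≤ b}) := by
    rintro n ⟨A, s, hs, hA⟩
    by_contra hcon
    obtain ⟨r, hr, hrs⟩ := exists_between hs
    have hex : ∀ b : ℕ, ∃ f, IsFractionalCover h (A ∩ {z | z n ≤ b}) f ∧ ∫ x, f x ∂m ≤ r := by
      intro b
      by_contra! hcon'
      exact hcon ⟨b, r, hr, fun f hf => (hcon' f hf).le⟩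
    obtain ⟨f, hf, hfr⟩ := exists_isFractionalCover_iUnion m h
      (fun b => A ∩ {z | z n ≤ b})
      (fun b b' hb z hz => ⟨hz.1, le_trans hz.2 hb⟩) r hex
    have := hA f (hf.anti fun z hz => Set.mem_iUnion.2 ⟨z n, hz, le_refl (z n)⟩)
    linarith
  choose b hb using hstep
  let A : ℕ → {A // P A} := fun n =>
    Nat.rec ⟨Set.univ, δ, hδ, hs⟩ (fun n A => ⟨A.1 ∩ {z | z n ≤ b n A}, hb n A⟩) n
  have hA : ∀ n, (A n).1 = {z | ∀ i < n, z i ≤ b i (A i)} := by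
    intro n
    induction n with
    | zero => ext z; simp [A]
    | succ n ih =>
      have : (A (n + 1)).1 = (A n).1 ∩ {z | z n ≤ b n (A n)} := rfl
      rw [this, ih]
      ext z
      exact Nat.forall_lt_succ_right.symm
  refine ⟨Set.pi Set.univ fun i => Set.Iic (b i (A i)),
    isCompact_univ_pi fun i => (Set.finite_Iic _).isCompact, fun U hU hKU f hf => ?_⟩
  obtain ⟨n, hn⟩ := exists_finite_box_subset (fun i => b i (A i)) hU
    fun z hz => hKU fun i _ => hz i
  obtain ⟨s, hs, hAs⟩ := (A n).2
  exact hs.le.trans (hAs f (hf.anti ((hA n).subset.trans hn)))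

/-- Finite Borel measures are ordered as soon as the integrals of all nonnegative bounded
continuous functions are. -/
lemma measure_le_of_forall_lintegral_le_s1 {E : Type*} [TopologicalSpace E] [MeasurableSpace E]
    [BorelSpace E] [TopologicalSpace.PseudoMetrizableSpace E] (μ ν : Measure E)
    [IsFiniteMeasure μ] [IsFiniteMeasure ν]
    (hle : ∀ f : BoundedContinuousFunction E NNReal, ∫⁻ x, f x ∂μ ≤ ∫⁻ x, f x ∂ν) : μ ≤ ν := by
  have hclosed : ∀ F, IsClosed F → μ F ≤ ν F := fun F hF =>
    le_of_tendsto_of_tendsto' (HasOuterApproxClosed.tendsto_lintegral_apprSeq hF μ)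
      (HasOuterApproxClosed.tendsto_lintegral_apprSeq hF ν) fun n => hle _
  refine Measure.le_iff.2 fun s hs => ?_
  rw [hs.measure_eq_iSup_isClosed_of_ne_top (measure_ne_top μ s)]
  exact iSup_le fun F => iSup_le fun hFs => iSup_le fun hF =>
    (hclosed F hF).trans (measure_mono hFs)

/-- A positive linear functional on the continuous functions on a compact Hausdorff space is
represented by a finite measure. -/
lemma exists_measure_integral_eq {K : Type*} [TopologicalSpace K] [T2Space K] [CompactSpace K]
    [MeasurableSpace K] [BorelSpace K] (L : C(K, ℝ) →ₗ[ℝ] ℝ) (hL : ∀ φ, 0 ≤ φ → 0 ≤ L φ) :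
    ∃ η : Measure K, IsFiniteMeasure η ∧ ∀ φ : C(K, ℝ), ∫ z, φ z ∂η = L φ := by
  let T : CompactlySupportedContinuousMap K ℝ →ₗ[ℝ] C(K, ℝ) :=
    { toFun := fun φ => φ.toContinuousMap
      map_add' := fun _ _ => rfl
      map_smul' := fun _ _ => rfl }
  let Λ : CompactlySupportedContinuousMap K ℝ →ₚ[ℝ] ℝ :=
    PositiveLinearMap.mk₀ (L ∘ₗ T) fun φ hφ => hL _ fun z => hφ z
  have : (RealRMK.rieszMeasure Λ).Regular := RealRMK.regular_rieszMeasure Λ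
  refine ⟨RealRMK.rieszMeasure Λ, inferInstance, fun φ => ?_⟩
  exact RealRMK.integral_rieszMeasure Λ (CompactlySupportedContinuousMap.continuousMapEquiv φ)

/-- If the fractional covers of neighbourhoods of a compact set `K` have mass bounded below, then
there is a nonzero measure whose images under the maps `h i` are dominated by a multiple
of `m`. -/
lemma exists_measure_sum_map_le_of_isCompact {ι Z E : Type*} [Fintype ι]
    [TopologicalSpace E] [MeasurableSpace E] [BorelSpace E]
    [TopologicalSpace.PseudoMetrizableSpace E]
    [TopologicalSpace Z] [T2Space Z] [MeasurableSpace Z] [BorelSpace Z]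
    (m : Measure E) [IsFiniteMeasure m] (h : ι → Z → E) (hh : ∀ i, Continuous (h i))
    {K : Set Z} (hK : IsCompact K) {δ : ℝ} (hδ : 0 < δ)
    (hs : ∀ U, IsOpen U → K ⊆ U → ∀ f, IsFractionalCover h U f → δ ≤ ∫ x, f x ∂m) :
    ∃ η : Measure Z, IsFiniteMeasure η ∧ η ≠ 0 ∧
      ∃ C : NNReal, ∑ i, η.map (h i) ≤ C • m := by
  have : CompactSpace K := isCompact_iff_compactSpace.1 hK
  let ψ : BoundedContinuousFunction E ℝ → C(K, ℝ) := fun f =>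
    ⟨fun z => ∑ i, f (h i z), by fun_prop⟩
  let A : Set C(K, ℝ) := {φ | ∃ f : BoundedContinuousFunction E ℝ,
    (∀ x, 0 ≤ f x) ∧ ∫ x, f x ∂m < δ ∧ ∀ z, φ z < ψ f z}
  have hA_open : IsOpen A := by
    have hA : A = ⋃ f : {f : BoundedContinuousFunction E ℝ //
        (∀ x, 0 ≤ f x) ∧ ∫ x, f x ∂m < δ},
        (fun φ => ψ f.1 - φ) ⁻¹' {θ : C(K, ℝ) | Set.MapsTo θ Set.univ (Set.Ioi 0)} := by
      ext φ
      simp [A, Set.MapsTo, and_assoc]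
    rw [hA]
    exact isOpen_iUnion fun f =>
      (ContinuousMap.isOpen_setOfPred_mapsTo isCompact_univ isOpen_Ioi).preimage (by fun_prop)
  have hA_convex : Convex ℝ A := by
    rintro φ ⟨f, hf0, hfδ, hφ⟩ φ' ⟨f', hf0', hfδ', hφ'⟩ a b ha hb hab
    refine ⟨a • f + b • f', fun x => ?_, ?_, fun z => ?_⟩
    · have := hf0 x
      have := hf0' x
      simp only [BoundedContinuousFunction.coe_add, BoundedContinuousFunction.coe_smul,
        Pi.add_apply, smul_eq_mul]
      positivity
    · simp only [BoundedContinuousFunction.coe_add, BoundedContinuousFunction.coe_smul,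
        Pi.add_apply]
      change ∫ x, (a • ⇑f) x + (b • ⇑f') x ∂m < δ
      rw [integral_add ((f.integrable m).smul a) ((f'.integrable m).smul b)]
      simp only [Pi.smul_apply]
      rw [integral_smul, integral_smul]
      exact convex_Iio δ hfδ hfδ' ha hb hab
    · have h1 := hφ z
      have h2 := hφ' z
      simp only [ψ, ContinuousMap.coe_mk, BoundedContinuousFunction.coe_add,
        BoundedContinuousFunction.coe_smul, Pi.add_apply, smul_eq_mul, Finset.sum_add_distrib,
        ← Finset.mul_sum, ContinuousMap.add_apply, ContinuousMap.smul_apply] at h1 h2 ⊢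
      rcases ha.eq_or_lt with rfl | ha
      · obtain rfl : b = 1 := by linarith
        linarith
      · nlinarith [mul_lt_mul_of_pos_left h1 ha, mul_le_mul_of_nonneg_left h2.le hb]
  have hA_one : (1 : C(K, ℝ)) ∉ A := by
    rintro ⟨f, hf0, hfδ, hφ⟩
    have hcover : IsFractionalCover h {z | 1 < ∑ i, f (h i z)} fun x => min (f x) 1 := by
      refine ⟨f.continuous.measurable.min measurable_const,
        fun x => ⟨le_min (hf0 x) zero_le_one, min_le_right _ _⟩, fun z hz => ?_⟩
      by_cases hex : ∃ i, 1 ≤ f (h i z)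
      · obtain ⟨i, hi⟩ := hex
        have := Finset.single_le_sum (f := fun i => min (f (h i z)) 1)
          (fun i _ => le_min (hf0 _) zero_le_one) (Finset.mem_univ i)
        rwa [min_eq_right hi] at this
      · push Not at hex
        rw [Finset.sum_congr rfl fun i _ => min_eq_left (hex i).le]
        exact hz.le
    have hle := hs {z | 1 < ∑ i, f (h i z)} (isOpen_lt continuous_const (by fun_prop))
      (fun z hz => hφ ⟨z, hz⟩) _ hcover
    have hmono : ∫ x, min (f x) 1 ∂m ≤ ∫ x, f x ∂m :=
      integral_mono (hcover.integrable m) (f.integrable m) fun x => min_le_left _ _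
    linarith
  obtain ⟨L, hL⟩ := geometric_hahn_banach_open_point hA_convex hA_open hA_one
  have hL_neg : ∀ φ : C(K, ℝ), (∀ z, φ z < 0) → L φ < L 1 := fun φ hφ =>
    hL φ ⟨0, fun x => le_rfl, by simpa using hδ, fun z => by simpa [ψ] using hφ z⟩
  have hL_one : 0 < L 1 := by
    have := hL_neg (-1) fun z => by simp
    rw [map_neg] at this
    linarith
  have hL_nonneg : ∀ φ, 0 ≤ φ → 0 ≤ L φ := by
    intro φ hφ
    by_contra! hneg
    have hlt := hL_neg (-((2 * L 1 / -L φ) • φ) - 1) fun z => by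
      have h1 : 0 ≤ 2 * L 1 / -L φ := div_nonneg (by linarith) (by linarith)
      have h2 : 0 ≤ 2 * L 1 / -L φ * φ z := mul_nonneg h1 (hφ z)
      simp only [ContinuousMap.sub_apply, ContinuousMap.neg_apply, ContinuousMap.smul_apply,
        ContinuousMap.one_apply, smul_eq_mul]
      linarith
    rw [map_sub, map_neg, map_smul, smul_eq_mul] at hlt
    have : 2 * L 1 / -L φ * L φ = -(2 * L 1) := by
      rw [div_neg, neg_mul, div_mul_cancel₀ _ hneg.ne]
    linarith
  have hL_le : ∀ f : BoundedContinuousFunction E ℝ, (∀ x, 0 ≤ f x) →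
      L (ψ f) ≤ 4 * L 1 / δ * ∫ x, f x ∂m := by
    intro f hf
    have hI : 0 ≤ ∫ x, f x ∂m := integral_nonneg hf
    have hC : 0 < 4 * L 1 / δ := by positivity
    refine le_of_forall_pos_le_add fun ε hε => ?_
    obtain ⟨r, hr, hrε⟩ : ∃ r > 0, 4 * L 1 / δ * r = ε :=
      ⟨ε / (4 * L 1 / δ), by positivity, by field_simp⟩
    set I := ∫ x, f x ∂m with hIdef
    have hlt := hL ((δ / (2 * (I + r))) • ψ f - 1) ⟨(δ / (2 * (I + r))) • f, fun x => by
        have := hf x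
        simp only [BoundedContinuousFunction.coe_smul, smul_eq_mul]
        positivity, by
        simp only [BoundedContinuousFunction.coe_smul]
        rw [integral_smul, ← hIdef, smul_eq_mul, div_mul_eq_mul_div, div_lt_iff₀ (by positivity)]
        nlinarith, fun z => by
        simp [ψ, Finset.mul_sum]⟩
    rw [map_sub, map_smul, smul_eq_mul] at hlt
    have hlt' : δ / (2 * (I + r)) * L (ψ f) < 2 * L 1 := by linarith
    rw [div_mul_eq_mul_div, div_lt_iff₀ (by positivity)] at hlt'
    rw [← hrε, ← mul_add, div_mul_eq_mul_div, le_div_iff₀ hδ]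
    linarith
  obtain ⟨η, hη, hηL⟩ := exists_measure_integral_eq (K := K) L.toLinearMap hL_nonneg
  have hη0 : η ≠ 0 := by
    rintro rfl
    have := hηL 1
    simp at this
    linarith
  refine ⟨η.map Subtype.val, inferInstance, ?_, (4 * L 1 / δ).toNNReal, ?_⟩
  · rwa [Ne, Measure.map_eq_zero_iff measurable_subtype_coe.aemeasurable]
  · have hfin : ∀ i, IsFiniteMeasure ((η.map Subtype.val).map (h i)) := fun i => inferInstance
    refine measure_le_of_forall_lintegral_le_s1 _ _ fun f => ?_
    let f' : BoundedContinuousFunction E ℝ :=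
      BoundedContinuousFunction.ofNormedAddCommGroup (fun x => (f x : ℝ)) (by fun_prop) (nndist f 0)
        fun x => by
          refine (Real.norm_of_nonneg (f x).2).trans_le ?_
          exact NNReal.coe_le_coe.2 (BoundedContinuousFunction.NNReal.upper_bound f x)
    have hψ : ∀ z, 0 ≤ ψ f' z := fun z => Finset.sum_nonneg fun i _ => (f _).2
    calc ∫⁻ x, f x ∂(∑ i, (η.map Subtype.val).map (h i))
        = ∫⁻ z : K, ∑ i, (f (h i z) : ENNReal) ∂η := by
          rw [lintegral_finsetSum_measure, lintegral_finsetSum _ fun i _ => by fun_prop]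
          refine Finset.sum_congr rfl fun i _ => ?_
          rw [lintegral_map (by fun_prop) (by fun_prop), lintegral_map (by fun_prop) (by fun_prop)]
      _ = ENNReal.ofReal (∫ z, ψ f' z ∂η) := by
          rw [ofReal_integral_eq_lintegral_ofReal _ (ae_of_all _ hψ)]
          · refine lintegral_congr fun z => ?_
            simp [ψ, f', ENNReal.ofReal_sum_of_nonneg]
          · exact (BoundedContinuousFunction.mkOfCompact (ψ f')).integrable η
      _ ≤ ENNReal.ofReal (4 * L 1 / δ * ∫ x, f' x ∂m) := by
          rw [hηL]
          exact ENNReal.ofReal_le_ofReal (hL_le f' fun x => (f x).2)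
      _ = ∫⁻ x, f x ∂((4 * L 1 / δ).toNNReal • m) := by
          rw [ENNReal.ofReal_mul (by positivity), lintegral_smul_measure,
            ofReal_integral_eq_lintegral_ofReal (f'.integrable m) (ae_of_all _ fun x => (f x).2)]
          simp [f', ENNReal.ofReal, ENNReal.smul_def]

/-- Kellerer's dichotomy, parametrized by Baire space: either every point `z` has a coordinate
`h i z` in a fixed null set, or there is a nonzero measure whose marginals are dominated by a
multiple of `m`. -/
lemma exists_null_cover_or_exists_measure {ι E : Type*} [Fintype ι]
    [TopologicalSpace E] [MeasurableSpace E] [BorelSpace E]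
    [TopologicalSpace.PseudoMetrizableSpace E]
    (m : Measure E) [IsFiniteMeasure m] (h : ι → (ℕ → ℕ) → E) (hh : ∀ i, Continuous (h i)) :
    (∃ N : Set E, m N = 0 ∧ ∀ z, ∃ i, h i z ∈ N) ∨
    ∃ η : Measure (ℕ → ℕ), IsFiniteMeasure η ∧ η ≠ 0 ∧
      ∃ C : NNReal, ∑ i, η.map (h i) ≤ C • m := by
  by_cases hs : ∀ δ > 0, ∃ f, IsFractionalCover h Set.univ f ∧ ∫ x, f x ∂m < δ
  · exact Or.inl (exists_null_cover m h hs)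
  · push Not at hs
    obtain ⟨δ, hδ, hs⟩ := hs
    obtain ⟨K, hK, hKs⟩ := exists_isCompact_forall_isFractionalCover m h (half_lt_self hδ) hs
    exact Or.inr (exists_measure_sum_map_le_of_isCompact m h hh hK (half_pos hδ) hKs)

section Mixture

variable {ι Z E : Type*} [Fintype ι] [MeasurableSpace Z] [MeasurableSpace E]

/-- The mixture over `η` of the finitely supported measures with atoms `(p i z).1` of weight
`(p i z).2`. -/
noncomputable def mixture (η : Measure Z) (p : ι → Z → E × ℝ) : Measure E :=
  ∑ i, (η.withDensity fun z => ENNReal.ofReal (p i z).2).map fun z => (p i z).1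

variable {η : Measure Z} {p : ι → Z → E × ℝ} {R : ℝ}

lemma mixture_le (hp : ∀ i, Measurable (p i)) (hw : ∀ i z, (p i z).2 ∈ Set.Icc 0 R) :
    mixture η p ≤ R.toNNReal • ∑ i, η.map fun z => (p i z).1 := by
  rw [mixture, Finset.smul_sum]
  refine Finset.sum_le_sum fun i _ => ?_
  rw [← Measure.map_smul]
  refine Measure.map_mono ?_ (hp i).fst
  calc η.withDensity (fun z => ENNReal.ofReal (p i z).2)
      ≤ η.withDensity fun _ => (R.toNNReal : ENNReal) :=
        withDensity_mono (ae_of_all _ fun z => ENNReal.ofReal_le_ofReal (hw i z).2)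
    _ = R.toNNReal • η := by rw [withDensity_const]; rfl

lemma integral_mixture [IsFiniteMeasure η] (hp : ∀ i, Measurable (p i)) (hw : ∀ i z, (p i z).2 ∈ Set.Icc 0 R)
    {f : E → ℝ} (hf : Measurable f) {b : ℝ} (hb : ∀ i z, |f (p i z).1| ≤ b) :
    Integrable f (mixture η p) ∧
      Integrable (fun z => ∑ i, (p i z).2 * f (p i z).1) η ∧
      ∫ x, f x ∂(mixture η p) = ∫ z, ∑ i, (p i z).2 * f (p i z).1 ∂η := by
  have hint : ∀ i, Integrable (fun z => (p i z).2 * f (p i z).1) η := fun i => by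
    refine Integrable.of_bound
      ((hp i).snd.mul (hf.comp (hp i).fst)).aestronglyMeasurable (R * b) (ae_of_all _ fun z => ?_)
    rw [norm_mul, Real.norm_of_nonneg (hw i z).1]
    exact mul_le_mul (hw i z).2 (hb i z) (norm_nonneg _) ((hw i z).1.trans (hw i z).2)
  have hd : ∀ i, Measurable fun z => (p i z).2.toNNReal := fun i => (hp i).snd.real_toNNReal
  have hmap : ∀ i, Integrable f
      ((η.withDensity fun z => ENNReal.ofReal (p i z).2).map fun z => (p i z).1) := fun i => by
    rw [integrable_map_measure hf.aestronglyMeasurable (hp i).fst.aemeasurable]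
    refine (integrable_withDensity_iff_integrable_smul (hd i)).2 ((hint i).congr ?_)
    refine ae_of_all _ fun z => ?_
    simp [NNReal.smul_def, Real.coe_toNNReal _ (hw i z).1]
  refine ⟨integrable_finsetSum_measure.2 fun i _ => hmap i,
    integrable_finsetSum _ fun i _ => hint i, ?_⟩
  rw [mixture, integral_finsetSum_measure fun i _ => hmap i, integral_finsetSum _ fun i _ => hint i]
  refine Finset.sum_congr rfl fun i _ => ?_
  rw [integral_map (hp i).fst.aemeasurable hf.aestronglyMeasurable]
  refine (integral_withDensity_eq_integral_smul (hd i) _).trans (integral_congr_ae ?_)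
  refine ae_of_all _ fun z => ?_
  simp [NNReal.smul_def, Real.coe_toNNReal _ (hw i z).1]

lemma isFiniteMeasure_mixture [IsFiniteMeasure η] (hp : ∀ i, Measurable (p i))
    (hw : ∀ i z, (p i z).2 ∈ Set.Icc 0 R) :
    IsFiniteMeasure (mixture η p) :=
  isFiniteMeasure_of_le _ (mixture_le hp hw)

end Mixture

/-- Weighted points at which the weight, the cost `c` and all functions of `F` satisfy bounds
governed by `R`. -/
def boundedAtoms {E : Type*} (c : E → ℝ) (F : Set (E → ℝ)) (a : (E → ℝ) → ℝ) (R : ℝ) :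
    Set (E × ℝ) :=
  {p | p.2 ∈ Set.Icc 0 R ∧ |c p.1| ≤ R ∧ ∀ f ∈ F, f p.1 ∈ Set.Icc (-(a f * R)) (a f * R)}

/-- Pairs of finitely supported measures with bounded atoms, of which the second is a `c`-better
competitor of the first. -/
def improvingPairs {E : Type*} (c : E → ℝ) (F : Set (E → ℝ)) (a : (E → ℝ) → ℝ) (R : ℝ)
    (ι κ : Type*) [Fintype ι] [Fintype κ] : Set ((ι → E × ℝ) × (κ → E × ℝ)) :=
  {z | (∀ i, z.1 i ∈ boundedAtoms c F a R) ∧ (∀ j, z.2 j ∈ boundedAtoms c F a R) ∧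
    ∑ j, (z.2 j).2 = ∑ i, (z.1 i).2 ∧
    (∀ f ∈ F, ∑ j, (z.2 j).2 * f (z.2 j).1 - ∑ i, (z.1 i).2 * f (z.1 i).1 ∈ ({0} : Set ℝ)) ∧
    ∑ j, (z.2 j).2 * c (z.2 j).1 < ∑ i, (z.1 i).2 * c (z.1 i).1}

/-- A family of closed conditions indexed by `F` is measurable if the conditions are closed
or if `F` is countable. -/
lemma measurableSet_forall_mem {E X : Type*} [TopologicalSpace E] [MeasurableSpace E]
    [TopologicalSpace X] [MeasurableSpace X] [OpensMeasurableSpace X] {F : Set (E → ℝ)}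
    (hFmeas : ∀ f ∈ F, Measurable f) (hFcc : (∀ f ∈ F, Continuous f) ∨ F.Countable)
    (Φ : (E → ℝ) → X → ℝ) (T : (E → ℝ) → Set ℝ) (hT : ∀ f, IsClosed (T f))
    (hcont : ∀ f, Continuous f → Continuous (Φ f))
    (hmeas : ∀ f, Measurable f → Measurable (Φ f)) :
    MeasurableSet {x | ∀ f ∈ F, Φ f x ∈ T f} := by
  have heq : {x | ∀ f ∈ F, Φ f x ∈ T f} = ⋂ f ∈ F, Φ f ⁻¹' T f := by ext x; simp
  rw [heq]
  rcases hFcc with hF | hF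
  · exact (isClosed_biInter fun f hf => (hT f).preimage (hcont f (hF f hf))).measurableSet
  · exact MeasurableSet.biInter hF fun f hf => hmeas f (hFmeas f hf) (hT f).measurableSet

lemma measurableSet_boundedAtoms
    {E : Type*} [TopologicalSpace E] [MeasurableSpace E] [BorelSpace E]
    {c : E → ℝ} (hc : Measurable c) {F : Set (E → ℝ)} (hFmeas : ∀ f ∈ F, Measurable f)
    (hFcc : (∀ f ∈ F, Continuous f) ∨ F.Countable) (a : (E → ℝ) → ℝ) (R : ℝ) :
    MeasurableSet (boundedAtoms c F a R) := by
  have h1 : MeasurableSet {p : E × ℝ | p.2 ∈ Set.Icc 0 R} := measurable_snd measurableSet_Icc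
  have h2 : MeasurableSet {p : E × ℝ | |c p.1| ≤ R} :=
    measurableSet_le (hc.comp measurable_fst).abs measurable_const
  have h3 := measurableSet_forall_mem (X := E × ℝ) hFmeas hFcc (fun f p => f p.1)
    (fun f => Set.Icc (-(a f * R)) (a f * R)) (fun f => isClosed_Icc)
    (fun f hf => hf.comp continuous_fst) (fun f hf => hf.comp measurable_fst)
  exact h1.inter (h2.inter h3)

lemma measurableSet_improvingPairs
    {E : Type*} [TopologicalSpace E] [SecondCountableTopology E] [MeasurableSpace E] [BorelSpace E]
    {c : E → ℝ} (hc : Measurable c) {F : Set (E → ℝ)} (hFmeas : ∀ f ∈ F, Measurable f)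
    (hFcc : (∀ f ∈ F, Continuous f) ∨ F.Countable) (a : (E → ℝ) → ℝ) (R : ℝ)
    (ι κ : Type*) [Fintype ι] [Fintype κ] : MeasurableSet (improvingPairs c F a R ι κ) := by
  have hat := measurableSet_boundedAtoms hc hFmeas hFcc a R
  have hsum : ∀ f : E → ℝ, Measurable f → Measurable
      (fun z : (ι → E × ℝ) × (κ → E × ℝ) => ∑ i, (z.1 i).2 * f (z.1 i).1) ∧ Measurable
      (fun z : (ι → E × ℝ) × (κ → E × ℝ) => ∑ j, (z.2 j).2 * f (z.2 j).1) := fun f hf =>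
    ⟨by fun_prop, by fun_prop⟩
  have h1 : MeasurableSet {z : (ι → E × ℝ) × (κ → E × ℝ) | ∀ i, z.1 i ∈ boundedAtoms c F a R} := by
    rw [Set.ofPred_forall]
    exact MeasurableSet.iInter fun i => hat.preimage (by fun_prop)
  have h2 : MeasurableSet {z : (ι → E × ℝ) × (κ → E × ℝ) | ∀ j, z.2 j ∈ boundedAtoms c F a R} := by
    rw [Set.ofPred_forall]
    exact MeasurableSet.iInter fun i => hat.preimage (by fun_prop)
  have h3 : MeasurableSet {z : (ι → E × ℝ) × (κ → E × ℝ) |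
      ∑ j, (z.2 j).2 = ∑ i, (z.1 i).2} :=
    measurableSet_eq_fun (by fun_prop) (by fun_prop)
  have h4 := measurableSet_forall_mem (X := (ι → E × ℝ) × (κ → E × ℝ)) hFmeas hFcc
    (fun f z => ∑ j, (z.2 j).2 * f (z.2 j).1 - ∑ i, (z.1 i).2 * f (z.1 i).1)
    (fun f => {0}) (fun f => isClosed_singleton) (fun f hf => by fun_prop)
    (fun f hf => (hsum f hf).2.sub (hsum f hf).1)
  have h5 : MeasurableSet {z : (ι → E × ℝ) × (κ → E × ℝ) |
      ∑ j, (z.2 j).2 * c (z.2 j).1 < ∑ i, (z.1 i).2 * c (z.1 i).1} :=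
    measurableSet_lt (hsum c hc).2 (hsum c hc).1
  exact h1.inter (h2.inter (h3.inter (h4.inter h5)))

/-- Replacing a dominated part `α` of a finite measure `P` by `α'`. -/
lemma exists_measure_replace {E : Type*} [MeasurableSpace E] (P α α' : Measure E)
    [IsProbabilityMeasure P] [IsFiniteMeasure α] (hmass : α' Set.univ = α Set.univ)
    (hle : α ≤ P) :
    ∃ Q : Measure E, IsProbabilityMeasure Q ∧ ∀ f : E → ℝ, Integrable f P → Integrable f α' →
      Integrable f Q ∧ ∫ x, f x ∂Q = ∫ x, f x ∂P - ∫ x, f x ∂α + ∫ x, f x ∂α' := by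
  have hsub : P - α + α = P := Measure.sub_add_cancel_of_le hle
  refine ⟨P - α + α', ⟨?_⟩, fun f hf hf' => ?_⟩
  · rw [Measure.add_apply, hmass, ← Measure.add_apply, hsub, measure_univ]
  · have h1 : Integrable f (P - α) := hf.mono_measure Measure.sub_le
    have h2 : Integrable f α := hf.mono_measure hle
    refine ⟨h1.add_measure hf', ?_⟩
    have h3 := integral_add_measure h1 h2
    rw [hsub] at h3
    rw [integral_add_measure h1 hf', h3]
    ring

/-- A minimizer of the moment problem does not dominate the first marginals of a nonzero measure
on improving pairs. -/
lemma not_exists_measure_improvingPairs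
    {E Z ι κ : Type*} [MeasurableSpace E] [MeasurableSpace Z] [Fintype ι] [Fintype κ]
    {c : E → ℝ} (hc : Measurable c)
    {F : Set (E → ℝ)} (hFmeas : ∀ f ∈ F, Measurable f) (a : (E → ℝ) → ℝ) (R : ℝ)
    {Pstar : Measure E} [IsProbabilityMeasure Pstar]
    (hconstr : ∀ f ∈ F, Integrable f Pstar ∧ ∫ x, f x ∂Pstar = 0)
    (hopt : ∀ P : Measure E, IsProbabilityMeasure P →
      (∀ f ∈ F, Integrable f P ∧ ∫ x, f x ∂P = 0) →
      Integrable c P → ∫ x, c x ∂Pstar ≤ ∫ x, c x ∂P)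
    (hfin : Integrable c Pstar) (ζ : Z → (ι → E × ℝ) × (κ → E × ℝ)) (hζ : Measurable ζ)
    (hζ_mem : ∀ z, ζ z ∈ improvingPairs c F a R ι κ)
    (η : Measure Z) [IsFiniteMeasure η] (hη : η ≠ 0) (C : NNReal) :
    ¬ ∑ i, η.map (fun z => ((ζ z).1 i).1) ≤ C • Pstar := by
  intro hle
  let p : ι → Z → E × ℝ := fun i z => (ζ z).1 i
  let q : κ → Z → E × ℝ := fun j z => (ζ z).2 j
  have hp : ∀ i, Measurable (p i) := fun i => by fun_prop
  have hq : ∀ j, Measurable (q j) := fun j => by fun_prop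
  have hpw : ∀ i z, (p i z).2 ∈ Set.Icc 0 R := fun i z => ((hζ_mem z).1 i).1
  have hqw : ∀ j z, (q j z).2 ∈ Set.Icc 0 R := fun j z => ((hζ_mem z).2.1 j).1
  have hpf : IsFiniteMeasure (mixture η p) := isFiniteMeasure_mixture hp hpw
  have hqf : IsFiniteMeasure (mixture η q) := isFiniteMeasure_mixture hq hqw
  have hF : ∀ f ∈ F, Integrable f (mixture η q) ∧
      ∫ x, f x ∂(mixture η q) = ∫ x, f x ∂(mixture η p) := fun f hf => by
    have h1 := integral_mixture (η := η) hp hpw (hFmeas f hf) (b := a f * R) fun i z =>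
      abs_le.2 (((hζ_mem z).1 i).2.2 f hf)
    have h2 := integral_mixture (η := η) hq hqw (hFmeas f hf) (b := a f * R) fun j z =>
      abs_le.2 (((hζ_mem z).2.1 j).2.2 f hf)
    refine ⟨h2.1, h2.2.2.trans (Eq.trans ?_ h1.2.2.symm)⟩
    exact integral_congr_ae (ae_of_all _ fun z => sub_eq_zero.1 ((hζ_mem z).2.2.2.1 f hf))
  have hmass : mixture η q Set.univ = mixture η p Set.univ := by
    have h1 := (integral_mixture (η := η) hp hpw (f := fun _ => 1) measurable_const (b := 1)
      fun i z => by simp).2.2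
    have h2 := (integral_mixture (η := η) hq hqw (f := fun _ => 1) measurable_const (b := 1)
      fun i z => by simp).2.2
    simp only [integral_const, smul_eq_mul, mul_one] at h1 h2
    rw [← ENNReal.toReal_eq_toReal_iff' (measure_ne_top _ _) (measure_ne_top _ _)]
    refine h2.trans (Eq.trans ?_ h1.symm)
    exact integral_congr_ae (ae_of_all _ fun z => (hζ_mem z).2.2.1)
  have hcost : Integrable c (mixture η q) ∧
      ∫ x, c x ∂(mixture η q) < ∫ x, c x ∂(mixture η p) := by
    have h1 := integral_mixture (η := η) hp hpw hc (b := R) fun i z => ((hζ_mem z).1 i).2.1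
    have h2 := integral_mixture (η := η) hq hqw hc (b := R) fun j z => ((hζ_mem z).2.1 j).2.1
    refine ⟨h2.1, ?_⟩
    rw [h1.2.2, h2.2.2, ← sub_pos, ← integral_sub h1.2.1 h2.2.1]
    have hpos : ∀ z, 0 < ∑ i, (p i z).2 * c (p i z).1 - ∑ j, (q j z).2 * c (q j z).1 :=
      fun z => sub_pos.2 (hζ_mem z).2.2.2.2
    rw [integral_pos_iff_support_of_nonneg (fun z => (hpos z).le) (h1.2.1.sub h2.2.1)]
    rw [Function.support_eq_univ fun z => (hpos z).ne']
    exact Measure.measure_univ_pos.2 hη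
  let M : NNReal := R.toNNReal * C + 1
  have hM : M ≠ 0 := by positivity
  have hsmul : ∀ (r : NNReal) {μ ν : Measure E}, μ ≤ ν → r • μ ≤ r • ν := fun r μ ν h s => by
    simp only [Measure.smul_apply, ENNReal.smul_def, smul_eq_mul]
    exact mul_le_mul_right (h s) _
  have hdom : M⁻¹ • mixture η p ≤ Pstar := by
    calc M⁻¹ • mixture η p ≤ M⁻¹ • (M • Pstar) := by
          refine hsmul _ ((mixture_le hp hpw).trans ((hsmul _ hle).trans ?_))
          rw [smul_smul]
          simp only [M, add_smul, one_smul]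
          exact Measure.le_add_right le_rfl
      _ = Pstar := by rw [smul_smul, inv_mul_cancel₀ hM, one_smul]
  obtain ⟨Q, hQ, hQint⟩ := exists_measure_replace Pstar (M⁻¹ • mixture η p) (M⁻¹ • mixture η q)
    (by simp only [Measure.smul_apply, hmass]) hdom
  have hcQ := hQint c hfin (hcost.1.smul_measure_nnreal)
  have hle := hopt Q hQ (fun f hf => by
    have h := hQint f (hconstr f hf).1 ((hF f hf).1.smul_measure_nnreal)
    refine ⟨h.1, ?_⟩
    rw [h.2, (hconstr f hf).2, integral_smul_nnreal_measure, integral_smul_nnreal_measure,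
      (hF f hf).2]
    ring) hcQ.1
  rw [hcQ.2, integral_smul_nnreal_measure, integral_smul_nnreal_measure, NNReal.smul_def,
    NNReal.smul_def, smul_eq_mul, smul_eq_mul] at hle
  have hMpos : (0 : ℝ) < (M⁻¹ : NNReal) := by positivity
  nlinarith [mul_lt_mul_of_pos_left hcost.2 hMpos]

lemma integral_eq_sum_of_measure_compl_eq_zero {E : Type*} [MeasurableSpace E]
    [MeasurableSingletonClass E] (α : Measure E) [IsFiniteMeasure α] (S : Finset E)
    (hS : α (↑S : Set E)ᶜ = 0) (f : E → ℝ) :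
    ∫ x, f x ∂α = ∑ i : Fin S.card, α.real {(S.equivFin.symm i : E)} * f (S.equivFin.symm i) := by
  have hres : α.restrict S = α := Measure.restrict_eq_self_of_ae_mem (by rwa [ae_iff])
  rw [Equiv.sum_comp S.equivFin.symm fun x : S => α.real {(x : E)} * f x,
    Finset.sum_coe_sort S fun x => α.real {x} * f x]
  conv_lhs => rw [← hres]
  exact setIntegral_finset S IntegrableOn.finset

/-- **Main Theorem.** A minimizer (with finite cost) of the generalized moment problem
`min {∫ c dP : P probability on E, ∫ f dP = 0 for all f ∈ F}` is finitely minimal /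
`c`-monotone, provided `F` is dominated by a single function `g ≥ 0` and is either
countable or consists of continuous functions. -/
theorem statement1
    {E : Type*} [TopologicalSpace E] [PolishSpace E] [MeasurableSpace E] [BorelSpace E]
    (c : E → ℝ) (hc : Measurable c)
    (F : Set (E → ℝ)) (hFmeas : ∀ f ∈ F, Measurable f)
    (g : E → ℝ) (hg : ∀ x, 0 ≤ g x)
    (hdom : ∀ f ∈ F, ∃ a : ℝ, 0 ≤ a ∧ ∀ x, |f x| ≤ a * g x)
    (hFcc : (∀ f ∈ F, Continuous f) ∨ F.Countable)
    (Pstar : Measure E) [IsProbabilityMeasure Pstar]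
    (hconstr : ∀ f ∈ F, Integrable f Pstar ∧ ∫ x, f x ∂Pstar = 0)
    (hopt : ∀ P : Measure E, IsProbabilityMeasure P →
      (∀ f ∈ F, Integrable f P ∧ ∫ x, f x ∂P = 0) →
      Integrable c P → ∫ x, c x ∂Pstar ≤ ∫ x, c x ∂P)
    (hfin : Integrable c Pstar) :
    ∃ Γ : Set E, MeasurableSet Γ ∧ Pstar Γᶜ = 0 ∧ FinitelyMinimal c F Γ := by
  choose! a ha hag using hdom
  have hnull : ∀ n k R : ℕ, ∃ N : Set E, Pstar N = 0 ∧
      ∀ z ∈ improvingPairs c F a R (Fin n) (Fin k), ∃ i, (z.1 i).1 ∈ N := by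
    intro n k R
    have han := (measurableSet_improvingPairs hc hFmeas hFcc a R (Fin n) (Fin k)).analyticSet
    rw [AnalyticSet] at han
    rcases han with hempty | ⟨ζ, hζ, hrange⟩
    · exact ⟨∅, measure_empty, by simp [hempty]⟩
    rcases exists_null_cover_or_exists_measure Pstar (fun i z => ((ζ z).1 i).1)
      (fun i => by fun_prop) with ⟨N, hN, hcov⟩ | ⟨η, hη, hη0, C, hC⟩
    · refine ⟨N, hN, fun z hz => ?_⟩
      rw [← hrange] at hz
      obtain ⟨w, rfl⟩ := hz
      exact hcov w
    · exact absurd hC (not_exists_measure_improvingPairs hc hFmeas a R hconstr hopt hfin ζ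
        hζ.measurable (fun z => hrange ▸ Set.mem_range_self z) η hη0 C)
  choose N hN hNcov using hnull
  refine ⟨(toMeasurable Pstar (⋃ n, ⋃ k, ⋃ R, N n k R))ᶜ,
    (measurableSet_toMeasurable _ _).compl, ?_, ?_⟩
  · rw [compl_compl, measure_toMeasurable]
    simp only [measure_iUnion_null_iff]
    exact hN
  rintro α α' hα hα' ⟨S, hSΓ, hS⟩ ⟨T, hT⟩ ⟨hmass, hF⟩ hlt
  have hbdd : ∀ (x : E) (β : Measure E), ∀ᶠ R : ℕ in atTop,
      (x, β.real {x}) ∈ boundedAtoms c F a R := by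
    intro x β
    filter_upwards [eventually_ge_atTop ⌈β.real {x}⌉₊, eventually_ge_atTop ⌈|c x|⌉₊,
      eventually_ge_atTop ⌈g x⌉₊] with R h1 h2 h3
    refine ⟨⟨measureReal_nonneg, Nat.ceil_le.1 h1⟩, Nat.ceil_le.1 h2, fun f hf => ?_⟩
    refine abs_le.1 ((hag f hf x).trans ?_)
    exact mul_le_mul_of_nonneg_left (Nat.ceil_le.1 h3) (ha f hf)
  obtain ⟨R, hRS, hRT⟩ := ((eventually_all.2 fun i => hbdd (S.equivFin.symm i) α).and
    (eventually_all.2 fun j => hbdd (T.equivFin.symm j) α')).exists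
  have hint := integral_eq_sum_of_measure_compl_eq_zero α S hS
  have hint' := integral_eq_sum_of_measure_compl_eq_zero α' T hT
  obtain ⟨i, hi⟩ := hNcov S.card T.card R
    (fun i => (S.equivFin.symm i, α.real {(S.equivFin.symm i : E)}),
      fun j => (T.equivFin.symm j, α'.real {(T.equivFin.symm j : E)}))
    ⟨hRS, hRT, by
      have h1 := hint fun _ => 1
      have h2 := hint' fun _ => 1
      simp only [integral_const, smul_eq_mul, mul_one] at h1 h2
      exact h2.symm.trans ((congrArg ENNReal.toReal hmass).trans h1),
      fun f hf => sub_eq_zero.2 ((hint' f).symm.trans ((hF f hf).trans (hint f))),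
      (hint' c).symm.trans_lt (hlt.trans_eq (hint c))⟩
  exact hSΓ (S.equivFin.symm i).2 (subset_toMeasurable _ _
    (Set.mem_iUnion.2 ⟨_, Set.mem_iUnion.2 ⟨_, Set.mem_iUnion.2 ⟨_, hi⟩⟩⟩))
end

section
/- Let (E, m) be a Polish probability space, l a positive integer, and M an analytic subset of E^l. Then exactly one of the following holds: (i) there exist m-null sets M₁, …, M_l ⊆ E such that M ⊆ ⋃_{i=1}^l p_i^{-1}(M_i), where p_i : E^l → E is the i-th coordinate projection; or (ii) there exists a finite Borel measure η on E^l with η(M) > 0 and p_i(η) ≤ m for all i = 1, …, l. -/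
open MeasureTheory

open Filter Topology
open scoped ENNReal NNReal CompactlySupported

/-- The least total mass of a measurable `F ≥ 0` whose sum along the maps `π i` dominates `φ`. -/
noncomputable def coverCost {ι X Y : Type*} [Fintype ι] [MeasurableSpace Y] (μ : Measure Y)
    (π : ι → X → Y) (φ : X → ℝ≥0∞) : ℝ≥0∞ :=
  ⨅ (F : Y → ℝ≥0∞) (_ : Measurable F) (_ : ∀ x, φ x ≤ ∑ i, F (π i x)), ∫⁻ y, F y ∂μ

section coverCost

variable {ι X Y : Type*} [Fintype ι] [MeasurableSpace Y] {μ : Measure Y} {π : ι → X → Y}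
  {φ ψ : X → ℝ≥0∞}

lemma coverCost_le {F : Y → ℝ≥0∞} (hF : Measurable F) (h : ∀ x, φ x ≤ ∑ i, F (π i x)) :
    coverCost μ π φ ≤ ∫⁻ y, F y ∂μ :=
  iInf_le_of_le F (iInf_le_of_le hF (iInf_le _ h))

lemma exists_lintegral_lt_of_coverCost_lt {c : ℝ≥0∞} (h : coverCost μ π φ < c) :
    ∃ F : Y → ℝ≥0∞, Measurable F ∧ (∀ x, φ x ≤ ∑ i, F (π i x)) ∧ ∫⁻ y, F y ∂μ < c := by
  simpa only [coverCost, iInf_lt_iff, exists_prop] using h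

lemma coverCost_mono (h : ∀ x, φ x ≤ ψ x) : coverCost μ π φ ≤ coverCost μ π ψ :=
  le_iInf fun _ => le_iInf fun hF => le_iInf fun hψ =>
    coverCost_le hF fun x => (h x).trans (hψ x)

lemma coverCost_add_le : coverCost μ π (φ + ψ) ≤ coverCost μ π φ + coverCost μ π ψ := by
  refine ENNReal.le_of_forall_pos_le_add fun ε hε hlt => ?_
  have hε' : (ε : ℝ≥0∞) / 2 ≠ 0 := by simp [hε.ne']
  obtain ⟨hφ, hψ⟩ := ENNReal.add_lt_top.1 hlt
  obtain ⟨F, hF, hFφ, hFi⟩ := exists_lintegral_lt_of_coverCost_lt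
    (ENNReal.lt_add_right hφ.ne hε')
  obtain ⟨G, hG, hGψ, hGi⟩ := exists_lintegral_lt_of_coverCost_lt
    (ENNReal.lt_add_right hψ.ne hε')
  calc coverCost μ π (φ + ψ) ≤ ∫⁻ y, (F + G) y ∂μ :=
        coverCost_le (hF.add hG) fun x => by
          simpa [Finset.sum_add_distrib] using add_le_add (hFφ x) (hGψ x)
    _ = ∫⁻ y, F y ∂μ + ∫⁻ y, G y ∂μ := lintegral_add_left hF _
    _ ≤ (coverCost μ π φ + ε / 2) + (coverCost μ π ψ + ε / 2) := add_le_add hFi.le hGi.le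
    _ = coverCost μ π φ + coverCost μ π ψ + ε := by
        rw [add_add_add_comm, ENNReal.add_halves]

lemma coverCost_const_mul {c : ℝ≥0∞} (hc : c ≠ 0) (hc' : c ≠ ∞) :
    coverCost μ π (fun x => c * φ x) = c * coverCost μ π φ := by
  have key : ∀ (c : ℝ≥0∞) (φ : X → ℝ≥0∞), c ≠ 0 → c ≠ ∞ →
      coverCost μ π (fun x => c * φ x) ≤ c * coverCost μ π φ := fun c φ hc hc' => by
    rw [mul_comm, ← ENNReal.div_le_iff hc hc']
    refine le_iInf fun F => le_iInf fun hF => le_iInf fun h => ?_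
    rw [ENNReal.div_le_iff hc hc', mul_comm, ← lintegral_const_mul c hF]
    refine coverCost_le (hF.const_mul c) fun x => ?_
    rw [← Finset.mul_sum]
    gcongr
    exact h x
  refine (key c φ hc hc').antisymm ?_
  have := key c⁻¹ (fun x => c * φ x) (ENNReal.inv_ne_zero.2 hc') (ENNReal.inv_ne_top.2 hc)
  simp only [← mul_assoc, ENNReal.inv_mul_cancel hc hc', one_mul] at this
  calc c * coverCost μ π φ ≤ c * (c⁻¹ * coverCost μ π fun x => c * φ x) := by gcongr
    _ = _ := by rw [← mul_assoc, ENNReal.mul_inv_cancel hc hc', one_mul]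

lemma coverCost_ne_top [Nonempty ι] [IsFiniteMeasure μ] {c : ℝ≥0∞} (hc : c ≠ ∞)
    (h : ∀ x, φ x ≤ c) : coverCost μ π φ ≠ ∞ := by
  refine ne_top_of_le_ne_top ?_ (coverCost_le (F := fun _ => c) measurable_const fun x => ?_)
  · simpa using ENNReal.mul_ne_top hc (measure_ne_top μ _)
  · exact (h x).trans
      (Finset.single_le_sum (f := fun _ : ι => c) (fun _ _ => zero_le)
        (Finset.mem_univ (Classical.arbitrary ι)))

/-- Zero covering cost yields a null set that every point meets through some `π i`. -/
lemma exists_null_cover_of_coverCost_eq_zero (h : coverCost μ π 1 = 0) :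
    ∃ N : Set Y, μ N = 0 ∧ ∀ x, ∃ i, π i x ∈ N := by
  obtain ⟨ε, hε, hsum⟩ := ENNReal.exists_pos_sum_of_countable' one_ne_zero ℕ
  choose F hF hcov hint using fun n =>
    exists_lintegral_lt_of_coverCost_lt (h.trans_lt (hε n))
  refine ⟨{y | ¬ ∑' n, F n y < ∞}, ?_, fun x => ?_⟩
  · refine ae_iff.1 (ae_lt_top' (AEMeasurable.tsum fun n => (hF n).aemeasurable) ?_)
    rw [lintegral_tsum fun n => (hF n).aemeasurable]
    exact ((ENNReal.tsum_le_tsum fun n => (hint n).le).trans_lt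
      (hsum.trans ENNReal.one_lt_top)).ne
  · by_contra! hx
    replace hx : ∀ i, ∑' n, F n (π i x) < ∞ := by simpa [lt_top_iff_ne_top] using hx
    have ht : Tendsto (fun n => ∑ i, F n (π i x)) atTop (𝓝 (∑ _i : ι, 0)) :=
      tendsto_finsetSum _ fun i _ => ENNReal.tendsto_atTop_zero_of_tsum_ne_top (hx i).ne
    have := ge_of_tendsto' ht fun n => hcov n x
    simp at this

/-- Covering costs of sets are outer regular. -/
lemma exists_isOpen_coverCost_lt [TopologicalSpace X] [TopologicalSpace Y] [BorelSpace Y]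
    [μ.WeaklyRegular] [IsFiniteMeasure μ] (hπ : ∀ i, Continuous (π i)) {A : Set X} {c : ℝ≥0∞}
    (h : coverCost μ π (A.indicator 1) < c) :
    ∃ U, IsOpen U ∧ A ⊆ U ∧ coverCost μ π (U.indicator 1) < c := by
  obtain ⟨F, hF, hcov, hint⟩ := exists_lintegral_lt_of_coverCost_lt h
  obtain ⟨b, hb, hbc⟩ := exists_between hint
  obtain ⟨G, hFG, hG, hGint⟩ := exists_le_lowerSemicontinuous_lintegral_ge μ F hF
    (tsub_pos_of_lt hb).ne'
  rw [add_tsub_cancel_of_le hb.le] at hGint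
  obtain ⟨t, ht1, htc⟩ : ∃ t : ℝ≥0∞, t < 1 ∧ b / t < c := by
    have : Tendsto (fun t : ℝ≥0∞ => b / t) (𝓝[<] 1) (𝓝 (b / 1)) :=
      (ENNReal.Tendsto.const_div tendsto_id (Or.inr hbc.ne_top)).mono_left nhdsWithin_le_nhds
    rw [div_one] at this
    have hne : (𝓝[<] (1 : ℝ≥0∞)).NeBot := nhdsLT_neBot_of_exists_lt ⟨0, one_pos⟩
    obtain ⟨t, h1, h2⟩ := ((this.eventually_lt_const hbc).and self_mem_nhdsWithin).exists
    exact ⟨t, h2, h1⟩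
  have hlsc : LowerSemicontinuous fun x => ∑ i, G (π i x) :=
    lowerSemicontinuous_sum fun i _ => hG.comp (hπ i)
  refine ⟨{x | t < ∑ i, G (π i x)}, hlsc.isOpen_preimage t, fun x hx => ?_, ?_⟩
  · have := hcov x
    rw [Set.indicator_of_mem hx] at this
    exact ht1.trans_le (this.trans (Finset.sum_le_sum fun i _ => hFG _))
  · refine lt_of_le_of_lt (coverCost_le (F := fun y => G y / t) (hG.measurable.div_const t) ?_) ?_
    · refine Set.indicator_le fun x hx => ?_
      simp only [div_eq_mul_inv, ← Finset.sum_mul]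
      rw [← div_eq_mul_inv, Pi.one_apply]
      have hx' : t < ∑ i, G (π i x) := hx
      exact (ENNReal.le_div_iff_mul_le (Or.inr hx'.ne_bot) (Or.inl ht1.ne_top)).2
        (by rw [one_mul]; exact hx'.le)
    · simp only [div_eq_mul_inv]
      rw [lintegral_mul_const _ hG.measurable, ← div_eq_mul_inv]
      exact (ENNReal.div_le_div_right hGint t).trans_lt htc

end coverCost

/-- Decreasing convex sets of `[0, 1]`-valued functions admit an almost everywhere convergent
sequence of representatives. -/
lemma exists_mem_forall_ae_tendsto_of_antitone {Y : Type*} [MeasurableSpace Y] {μ : Measure Y}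
    [IsFiniteMeasure μ] {S : ℕ → Set (Y → ℝ)} (hS : Antitone S) (hne : ∀ n, (S n).Nonempty)
    (hmeas : ∀ n, ∀ G ∈ S n, Measurable G) (hbdd : ∀ n, ∀ G ∈ S n, ∀ y, 0 ≤ G y ∧ G y ≤ 1)
    (hmid : ∀ n, ∀ G ∈ S n, ∀ H ∈ S n, (fun y => (G y + H y) / 2) ∈ S n) :
    ∃ G : ℕ → Y → ℝ, (∀ n, G n ∈ S n) ∧
      ∀ᵐ y ∂μ, ∃ a, Tendsto (fun n => G n y) atTop (𝓝 a) := by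
  set Q : (Y → ℝ) → ℝ := fun G => ∫ y, G y ^ 2 ∂μ
  have hint : ∀ n, ∀ G ∈ S n, Integrable (fun y => G y ^ 2) μ := fun n G hG =>
    Integrable.of_bound ((hmeas n G hG).pow_const 2).aestronglyMeasurable 1
      (Eventually.of_forall fun y => by
        obtain ⟨h0, h1⟩ := hbdd n G hG y
        rw [Real.norm_of_nonneg (sq_nonneg _)]
        nlinarith)
  have hQ0 : ∀ G, 0 ≤ Q G := fun G => integral_nonneg fun y => sq_nonneg _
  have hbelow : ∀ n, BddBelow (Q '' S n) := fun n =>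
    ⟨0, by rintro _ ⟨G, -, rfl⟩; exact hQ0 G⟩
  set α : ℕ → ℝ := fun n => sInf (Q '' S n)
  have hα : Monotone α := fun i j hij =>
    csInf_le_csInf (hbelow i) ((hne j).image Q) (Set.image_mono (hS hij))
  have hαle : ∀ n, ∀ G ∈ S n, α n ≤ Q G := fun n G hG =>
    csInf_le (hbelow n) (Set.mem_image_of_mem Q hG)
  have hαbdd : BddAbove (Set.range α) := by
    refine ⟨∫ _, (1 : ℝ) ∂μ, ?_⟩
    rintro _ ⟨n, rfl⟩
    obtain ⟨G, hG⟩ := hne n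
    refine (hαle n G hG).trans (integral_mono (hint n G hG) (integrable_const 1) fun y => ?_)
    obtain ⟨h0, h1⟩ := hbdd n G hG y
    show G y ^ 2 ≤ 1
    nlinarith
  have hlim := tendsto_atTop_ciSup hα hαbdd
  set a := ⨆ n, α n
  set δ : ℕ → ℝ := fun k => (1 / 4) ^ k / 16
  have hδ : ∀ k, 0 < δ k := fun k => by positivity
  have hδanti : Antitone δ := fun i j hij => by
    have := pow_le_pow_of_le_one (a := (1 / 4 : ℝ)) (by norm_num) (by norm_num) hij
    simp only [δ]
    linarith
  obtain ⟨n, hn, hna⟩ := extraction_forall_of_eventually (P := fun k j => a - δ k < α j)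
    fun k => hlim.eventually_const_lt (sub_lt_self a (hδ k))
  have : ∀ k, ∃ G ∈ S (n k), Q G < a + δ k := fun k => by
    have hlt : sInf (Q '' S (n k)) < a + δ k :=
      (le_ciSup hαbdd (n k)).trans_lt (by linarith [hδ k])
    obtain ⟨_, ⟨G, hG, rfl⟩, hlt⟩ := exists_lt_of_csInf_lt ((hne _).image Q) hlt
    exact ⟨G, hG, hlt⟩
  choose G hG hGQ using this
  refine ⟨G, fun k => hS (hn.le_apply) (hG k), ?_⟩
  have hGm : ∀ k, Measurable (G k) := fun k => hmeas _ _ (hG k)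
  refine Lp.ae_tendsto_of_cauchy_eLpNorm (p := 2) (fun k => (hGm k).aestronglyMeasurable)
    (by norm_num) (B := fun k => ENNReal.ofReal ((1 / 2) ^ k)) ?_ fun N j k hj hk => ?_
  · rw [← ENNReal.ofReal_tsum_of_nonneg (fun k => by positivity)
      (summable_geometric_of_lt_one (by norm_num) (by norm_num))]
    exact ENNReal.ofReal_ne_top
  · have hGj : G j ∈ S (n N) := hS (hn.monotone hj) (hG j)
    have hGk : G k ∈ S (n N) := hS (hn.monotone hk) (hG k)
    have hmd := hmid _ _ hGj _ hGk
    have hQm := (hna N).trans_le (hαle _ _ hmd)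
    have hpar : ∫ y, (G j y - G k y) ^ 2 ∂μ
        = 2 * Q (G j) + 2 * Q (G k) - 4 * Q fun y => (G j y + G k y) / 2 := by
      have h1 := (hint _ _ hGj).const_mul 2
      have h2 := (hint _ _ hGk).const_mul 2
      have h3 := (hint _ _ hmd).const_mul 4
      simp only [Q]
      rw [← integral_const_mul, ← integral_const_mul, ← integral_const_mul,
        ← integral_add h1 h2,
        ← integral_sub (f := fun y => 2 * G j y ^ 2 + 2 * G k y ^ 2) (h1.add h2) h3]
      exact integral_congr_ae (Eventually.of_forall fun y => by ring)
    have hj' := hGQ j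
    have hk' := hGQ k
    have hle : ∫ y, (G j y - G k y) ^ 2 ∂μ < ((1 / 2) ^ N) ^ 2 := by
      have e : ((1 / 2 : ℝ) ^ N) ^ 2 = 16 * δ N := by
        simp only [δ]
        rw [← pow_mul, mul_comm N, pow_mul]
        norm_num
        ring
      rw [hpar, e]
      linarith [hδanti hj, hδanti hk, hδ N]
    have hLp : MemLp (G j - G k) 2 μ :=
      MemLp.of_bound ((hGm j).sub (hGm k)).aestronglyMeasurable 1
        (Eventually.of_forall fun y => by
          obtain ⟨_, _⟩ := hbdd _ _ hGj y
          obtain ⟨_, _⟩ := hbdd _ _ hGk y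
          rw [Real.norm_eq_abs, abs_le, Pi.sub_apply]
          constructor <;> linarith)
    rw [hLp.eLpNorm_eq_integral_rpow_norm two_ne_zero ENNReal.ofNat_ne_top]
    refine (ENNReal.ofReal_lt_ofReal_iff (by positivity)).2 ?_
    have e : ∫ y, ‖(G j - G k) y‖ ^ (2 : ℝ≥0∞).toReal ∂μ = ∫ y, (G j y - G k y) ^ 2 ∂μ := by
      simp
    rw [e, ENNReal.toReal_ofNat, ← one_div, ← Real.sqrt_eq_rpow]
    exact (Real.sqrt_lt' (by positivity)).2 hle

section coverCost

variable {ι X Y : Type*} [Fintype ι] [MeasurableSpace Y] {μ : Measure Y} {π : ι → X → Y}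

/-- Covering costs of sets are continuous along increasing sequences. -/
lemma exists_lt_coverCost_of_lt_iUnion [IsFiniteMeasure μ] {A : ℕ → Set X} (hA : Monotone A)
    {c : ℝ≥0∞} (h : c < coverCost μ π ((⋃ n, A n).indicator 1)) :
    ∃ n, c < coverCost μ π ((A n).indicator 1) := by
  by_contra! hle
  obtain ⟨b, hcb, hb⟩ := exists_between h
  refine hb.not_ge ?_
  let S : ℕ → Set (Y → ℝ) := fun n => {G | Measurable G ∧ (∀ y, 0 ≤ G y ∧ G y ≤ 1) ∧
    (∀ x ∈ A n, 1 ≤ ∑ i, G (π i x)) ∧ ∫ y, G y ∂μ ≤ b.toReal}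
  have hint : ∀ n, ∀ G ∈ S n, Integrable G μ := fun n G hG =>
    Integrable.of_bound hG.1.aestronglyMeasurable 1 (Eventually.of_forall fun y => by
      rw [Real.norm_of_nonneg (hG.2.1 y).1]
      exact (hG.2.1 y).2)
  obtain ⟨G, hG, hGlim⟩ := exists_mem_forall_ae_tendsto_of_antitone (μ := μ) (S := S)
    (fun i j hij G hG => ⟨hG.1, hG.2.1, fun x hx => hG.2.2.1 x (hA hij hx), hG.2.2.2⟩)
    (fun n => by
      obtain ⟨F, hF, hcov, hFb⟩ := exists_lintegral_lt_of_coverCost_lt ((hle n).trans_lt hcb)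
      have hfin : ∀ y, min (F y) 1 ≠ ∞ := fun y =>
        ne_top_of_le_ne_top ENNReal.one_ne_top (min_le_right _ _)
      refine ⟨fun y => (min (F y) 1).toReal, (hF.min measurable_const).ennreal_toReal,
        fun y => ⟨ENNReal.toReal_nonneg, ?_⟩, fun x hx => ?_, ?_⟩
      · exact ENNReal.toReal_le_of_le_ofReal zero_le_one (by simp)
      · rw [← ENNReal.toReal_sum fun i _ => hfin _, ← ENNReal.toReal_one]
        refine ENNReal.toReal_mono (ENNReal.sum_ne_top.2 fun i _ => hfin _) ?_
        have hx' := hcov x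
        rw [Set.indicator_of_mem hx, Pi.one_apply] at hx'
        by_cases hbig : ∃ i, 1 ≤ F (π i x)
        · obtain ⟨i, hi⟩ := hbig
          exact (le_min hi le_rfl).trans
            (Finset.single_le_sum (f := fun i => min (F (π i x)) 1) (fun _ _ => zero_le)
              (Finset.mem_univ i))
        · push Not at hbig
          simpa only [min_eq_left (hbig _).le] using hx'
      · rw [integral_toReal (hF.min measurable_const).aemeasurable
          (Eventually.of_forall fun y => (hfin y).lt_top)]
        exact ENNReal.toReal_mono hb.ne_top
          ((lintegral_mono fun y => min_le_left _ _).trans hFb.le))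
    (fun n G hG => hG.1) (fun n G hG => hG.2.1)
    (fun n G hG H hH => by
      refine ⟨(hG.1.add hH.1).div_const 2, fun y => ?_, fun x hx => ?_, ?_⟩
      · obtain ⟨_, _⟩ := hG.2.1 y
        obtain ⟨_, _⟩ := hH.2.1 y
        constructor <;> linarith
      · rw [← Finset.sum_div, Finset.sum_add_distrib]
        linarith [hG.2.2.1 x hx, hH.2.2.1 x hx]
      · rw [integral_div, integral_add (hint n G hG) (hint n H hH)]
        linarith [hG.2.2.2, hH.2.2.2])
  set F : ℕ → Y → ℝ≥0∞ := fun n y => ENNReal.ofReal (G n y)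
  have hF : ∀ n, Measurable (F n) := fun n => (hG n).1.ennreal_ofReal
  have hFint : ∀ n, ∫⁻ y, F n y ∂μ ≤ b := fun n => by
    rw [← ofReal_integral_eq_lintegral_ofReal (hint n _ (hG n))
      (Eventually.of_forall fun y => ((hG n).2.1 y).1)]
    exact ENNReal.ofReal_le_of_le_toReal (hG n).2.2.2
  have hFlim : ∀ᵐ y ∂μ, Tendsto (fun n => F n y) atTop (𝓝 (limsup (fun n => F n y) atTop)) := by
    filter_upwards [hGlim] with y ⟨a, ha⟩
    have := ENNReal.tendsto_ofReal ha
    rwa [this.limsup_eq]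
  have hconv := tendsto_lintegral_of_dominated_convergence (bound := fun _ => 1) hF
    (fun n => Eventually.of_forall fun y => by
      simpa [F] using ((hG n).2.1 y).2) (by simp) hFlim
  refine (coverCost_le (Measurable.limsup hF) ?_).trans (le_of_tendsto' hconv hFint)
  refine Set.indicator_le fun x hx => ?_
  obtain ⟨N, hN⟩ := Set.mem_iUnion.1 hx
  have hev : ∀ᶠ n in atTop, (1 : ℝ≥0∞) ≤ ∑ i, F n (π i x) := by
    filter_upwards [eventually_ge_atTop N] with n hn
    rw [← ENNReal.ofReal_sum_of_nonneg fun i _ => ((hG n).2.1 _).1]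
    exact ENNReal.one_le_ofReal.2 ((hG n).2.2.1 x (hA hn hN))
  rw [Pi.one_apply]
  refine ENNReal.le_of_forall_pos_le_add fun ε hε hlt => ?_
  obtain ⟨δ, hδ, hδε⟩ := ENNReal.exists_pos_sum_of_countable (ε := ε) (by simpa using hε.ne') ι
  rw [tsum_fintype] at hδε
  have hfin : ∀ i, limsup (fun n => F n (π i x)) atTop ≠ ∞ := fun i =>
    (ENNReal.lt_top_of_sum_ne_top hlt.ne (Finset.mem_univ i)).ne
  have hev' : ∀ᶠ n in atTop, ∀ i, F n (π i x) <
      limsup (fun n => F n (π i x)) atTop + δ i :=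
    eventually_all.2 fun i => eventually_lt_of_limsup_lt
      (ENNReal.lt_add_right (hfin i) (by simpa using (hδ i).ne'))
  obtain ⟨n, h1, h2⟩ := (hev.and hev').exists
  calc (1 : ℝ≥0∞) ≤ ∑ i, F n (π i x) := h1
    _ ≤ ∑ i, (limsup (fun n => F n (π i x)) atTop + δ i) :=
        Finset.sum_le_sum fun i _ => (h2 i).le
    _ ≤ _ := by
        rw [Finset.sum_add_distrib]
        gcongr

/-- On a compact space, positive covering cost is witnessed by a measure. -/
lemma exists_measure_of_coverCost_ne_zero [Nonempty ι] [TopologicalSpace X] [CompactSpace X]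
    [T2Space X] [MeasurableSpace X] [BorelSpace X] [TopologicalSpace Y]
    [TopologicalSpace.PseudoMetrizableSpace Y] [BorelSpace Y] [IsFiniteMeasure μ]
    (hπ : ∀ i, Continuous (π i)) (h : coverCost μ π 1 ≠ 0) :
    ∃ η : Measure X, IsFiniteMeasure η ∧ η Set.univ ≠ 0 ∧ ∑ i, η.map (π i) ≤ μ := by
  let N : C_c(X, ℝ) → ℝ := fun f => (coverCost μ π fun x => ENNReal.ofReal (f x)).toReal
  have hNfin : ∀ f : C_c(X, ℝ), coverCost μ π (fun x => ENNReal.ofReal (f x)) ≠ ∞ := fun f => by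
    obtain ⟨c, hc⟩ := f.hasCompactSupport.exists_bound_of_continuous f.continuous
    exact coverCost_ne_top (c := ENNReal.ofReal c) ENNReal.ofReal_ne_top fun x =>
      ENNReal.ofReal_le_ofReal ((le_abs_self _).trans (hc x))
  have hN0 : ∀ f, 0 ≤ N f := fun f => ENNReal.toReal_nonneg
  have hNhom : ∀ c : ℝ, 0 < c → ∀ f, N (c • f) = c * N f := fun c hc f => by
    have := coverCost_const_mul (μ := μ) (π := π) (φ := fun x => ENNReal.ofReal (f x))
      (c := ENNReal.ofReal c) (by simpa using hc) ENNReal.ofReal_ne_top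
    simp only [← ENNReal.ofReal_mul hc.le] at this
    simp only [N, CompactlySupportedContinuousMap.smul_apply, smul_eq_mul, this,
      ENNReal.toReal_mul, ENNReal.toReal_ofReal hc.le]
  have hNadd : ∀ f g, N (f + g) ≤ N f + N g := fun f g => by
    simp only [N]
    rw [← ENNReal.toReal_add (hNfin f) (hNfin g)]
    exact ENNReal.toReal_mono (ENNReal.add_ne_top.2 ⟨hNfin f, hNfin g⟩)
      ((coverCost_mono fun x => ENNReal.ofReal_add_le).trans coverCost_add_le)
  let o : C_c(X, ℝ) := ⟨1, HasCompactSupport.of_compactSpace 1⟩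
  have hNo : N o = (coverCost μ π 1).toReal := by
    simp only [N]
    congr 2
    ext x
    exact ENNReal.ofReal_one
  have hNo_pos : 0 < N o := by
    rw [hNo]
    refine ENNReal.toReal_pos h (coverCost_ne_top ENNReal.one_ne_top fun x => le_rfl)
  have hN_zero : N 0 = 0 := by
    have := hNhom 2 two_pos 0
    rw [smul_zero] at this
    linarith
  have ho : o ≠ 0 := fun ho => by
    rw [ho, hN_zero] at hNo_pos
    exact hNo_pos.false
  obtain ⟨L, hLo, hLN⟩ := exists_extension_of_le_sublinear
    (LinearPMap.mkSpanSingleton o (N o) ho) N hNhom hNadd (by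
      rintro ⟨f, hf⟩
      obtain ⟨t, rfl⟩ := Submodule.mem_span_singleton.1 hf
      rw [LinearPMap.mkSpanSingleton'_apply]
      rcases le_or_gt t 0 with ht | ht
      · exact (mul_nonpos_of_nonpos_of_nonneg ht (hN0 o)).trans (hN0 _)
      · exact (hNhom t ht o).ge)
  replace hLo : L o = N o := by
    have := hLo ⟨o, Submodule.mem_span_singleton_self o⟩
    exact this.trans (LinearPMap.mkSpanSingleton'_apply_self _ _ _ _)
  have hLpos : ∀ f, 0 ≤ f → 0 ≤ L f := fun f hf => by
    have h1 : N (-f) = N 0 := by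
      simp only [N]
      congr 2
      ext x
      have : 0 ≤ f x := hf x
      simp [this]
    have h2 := hLN (-f)
    rw [h1, hN_zero, map_neg] at h2
    linarith
  let Λ : C_c(X, ℝ) →ₚ[ℝ] ℝ := PositiveLinearMap.mk₀ L hLpos
  have hΛ : ∀ f, ∫ x, f x ∂(RealRMK.rieszMeasure Λ) = L f := RealRMK.integral_rieszMeasure Λ
  set η := RealRMK.rieszMeasure Λ
  refine ⟨η, inferInstance, fun h0 => ?_, ?_⟩
  · have := hΛ o
    rw [Measure.measure_univ_eq_zero.1 h0, integral_zero_measure, hLo] at this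
    exact hNo_pos.ne this
  have hmeas : ∀ i, Measurable (π i) := fun i => (hπ i).measurable
  have hbc : ∀ f : BoundedContinuousFunction Y ℝ≥0,
      ∫⁻ y, f y ∂(∑ i, η.map (π i)) ≤ ∫⁻ y, f y ∂μ := fun f => by
    have hfm : Measurable fun y => (f y : ℝ≥0∞) := f.continuous.measurable.coe_nnreal_ennreal
    let g : C_c(X, ℝ) := ⟨⟨fun x => ∑ i, (f (π i x) : ℝ), by fun_prop⟩,
      HasCompactSupport.of_compactSpace _⟩
    have hg : ∀ x, ENNReal.ofReal (g x) = ∑ i, (f (π i x) : ℝ≥0∞) := fun x => by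
      change ENNReal.ofReal (∑ i, (f (π i x) : ℝ)) = _
      rw [ENNReal.ofReal_sum_of_nonneg fun i _ => NNReal.coe_nonneg _]
      simp
    calc ∫⁻ y, f y ∂(∑ i, η.map (π i)) = ∫⁻ x, ENNReal.ofReal (g x) ∂η := by
          rw [lintegral_finsetSum_measure]
          simp_rw [hg, lintegral_map hfm (hmeas _)]
          exact (lintegral_finsetSum _ fun i _ => hfm.comp (hmeas i)).symm
      _ = ENNReal.ofReal (L g) := by
          rw [← hΛ g, ofReal_integral_eq_lintegral_ofReal g.integrable
            (Eventually.of_forall fun x => Finset.sum_nonneg fun i _ => NNReal.coe_nonneg _)]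
      _ ≤ ENNReal.ofReal (N g) := ENNReal.ofReal_le_ofReal (hLN g)
      _ = coverCost μ π fun x => ENNReal.ofReal (g x) := ENNReal.ofReal_toReal (hNfin g)
      _ ≤ ∫⁻ y, f y ∂μ := coverCost_le hfm fun x => (hg x).le
  have hfin : IsFiniteMeasure (∑ i, η.map (π i)) := inferInstance
  refine Measure.le_iff.2 fun s hs => ?_
  rw [hs.measure_eq_iSup_isClosed_of_ne_top (measure_ne_top _ _)]
  refine iSup₂_le fun K hKs => iSup_le fun hK => le_trans ?_ (measure_mono hKs)
  exact le_of_tendsto_of_tendsto' (HasOuterApproxClosed.tendsto_lintegral_apprSeq hK _)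
    (HasOuterApproxClosed.tendsto_lintegral_apprSeq hK μ) fun n => hbc _

end coverCost

/-- Positive covering cost of the Baire space is inherited by a compact subset. -/
lemma exists_isCompact_coverCost_ne_zero {ι Y : Type*} [Fintype ι] [TopologicalSpace Y]
    [MeasurableSpace Y] [BorelSpace Y] {μ : Measure Y} [IsFiniteMeasure μ] [μ.WeaklyRegular]
    {π : ι → (ℕ → ℕ) → Y} (hπ : ∀ i, Continuous (π i)) (h : coverCost μ π 1 ≠ 0) :
    ∃ C : Set (ℕ → ℕ), IsCompact C ∧ coverCost μ π (C.indicator 1) ≠ 0 := by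
  obtain ⟨a, ha0, ha⟩ := exists_between (pos_iff_ne_zero.2 h)
  have step : ∀ (k : ℕ) (A : {A : Set (ℕ → ℕ) // a < coverCost μ π (A.indicator 1)}),
      ∃ N, a < coverCost μ π ((A.1 ∩ {σ | σ k ≤ N}).indicator 1) := fun k A => by
    refine exists_lt_coverCost_of_lt_iUnion (A := fun N => A.1 ∩ {σ | σ k ≤ N})
      (fun i j hij σ hσ => ⟨hσ.1, le_trans hσ.2 hij⟩) ?_
    rw [← Set.inter_iUnion, Set.iUnion_eq_univ_iff.2 fun σ => ⟨σ k, by simp⟩, Set.inter_univ]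
    exact A.2
  choose N hN using step
  let B : ℕ → {A : Set (ℕ → ℕ) // a < coverCost μ π (A.indicator 1)} := fun k =>
    Nat.rec ⟨Set.univ, by simpa using ha⟩ (fun k A => ⟨_, hN k A⟩) k
  set n : ℕ → ℕ := fun k => N k (B k)
  have hB : ∀ k, (B k).1 = {σ | ∀ i < k, σ i ≤ n i} := fun k => by
    induction k with
    | zero => simp [B]
    | succ k ih =>
      change (B k).1 ∩ {σ | σ k ≤ n k} = _
      rw [ih]
      ext σ
      simp [Nat.lt_succ_iff_lt_or_eq, -Order.lt_add_one_iff, or_imp, forall_and]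
  have hC : IsCompact (Set.univ.pi fun i => Set.Iic (n i)) :=
    isCompact_univ_pi fun i => (Set.finite_Iic (n i)).isCompact
  refine ⟨_, hC, fun h0 => ?_⟩
  obtain ⟨U, hU, hCU, hUa⟩ := exists_isOpen_coverCost_lt hπ (h0.trans_lt ha0)
  have hnot : ∀ k, ∃ σ ∈ (B k).1, σ ∉ U := fun k => by
    by_contra! hsub
    exact ((B k).2.trans_le (coverCost_mono
      (Set.indicator_le_indicator_of_subset hsub fun _ => zero_le))).not_gt hUa
  choose σ hσB hσU using hnot
  obtain ⟨τ, hτ, φ, hφ, hlim⟩ := hC.tendsto_subseq (x := fun k i => min (σ k i) (n i))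
    fun k i _ => Set.mem_Iic.2 (min_le_right _ _)
  have hlim' : Tendsto (fun k => σ (φ k)) atTop (𝓝 τ) := by
    refine tendsto_pi_nhds.2 fun i => (tendsto_pi_nhds.1 hlim i).congr' ?_
    filter_upwards [eventually_gt_atTop i] with k hk
    have := hσB (φ k)
    rw [hB] at this
    exact min_eq_left (this i (hk.trans_le hφ.le_apply))
  obtain ⟨k, hk⟩ := (hlim'.eventually_mem (hU.mem_nhds (hCU hτ))).exists
  exact hσU _ hk



/-- **Lemma (Kellerer-type dichotomy).** Let `(E, m)` be a Polish probability space,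
`l ≥ 1`, and `M` an analytic subset of `E^l`. Then exactly one of the following holds:
(i) `M` is covered by the union of the coordinate preimages of `l` many `m`-null sets, or
(ii) there is a finite measure `η` on `E^l` with `η(M) > 0` whose marginals are all
dominated by `m`. -/
theorem statement4
    {E : Type*} [TopologicalSpace E] [PolishSpace E] [MeasurableSpace E] [BorelSpace E]
    (m : Measure E) [IsProbabilityMeasure m]
    (l : ℕ) (hl : 0 < l)
    (M : Set (Fin l → E)) (hM : MeasureTheory.AnalyticSet M) :
    Xor'
      (∃ N : Fin l → Set E, (∀ i, m (N i) = 0) ∧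
        M ⊆ ⋃ i, (fun z : Fin l → E => z i) ⁻¹' (N i))
      (∃ η : Measure (Fin l → E), IsFiniteMeasure η ∧ 0 < η M ∧
        ∀ i, η.map (fun z => z i) ≤ m) := by
  refine xor_iff_or_and_not_and _ _ |>.2 ⟨?_, ?_⟩
  · rw [AnalyticSet] at hM
    obtain rfl | ⟨f, hf, rfl⟩ := hM
    · exact Or.inl ⟨fun _ => ∅, fun _ => measure_empty, Set.empty_subset _⟩
    have : Nonempty (Fin l) := ⟨⟨0, hl⟩⟩
    let μ : Measure (Fin l × E) := Measure.count.prod m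
    let π : Fin l → (ℕ → ℕ) → Fin l × E := fun i σ => (i, f σ i)
    have hπ : ∀ i, Continuous (π i) := fun i => by fun_prop
    have hμ : ∀ i (s : Set E), μ ({i} ×ˢ s) = m s := fun i s => by
      rw [Measure.prod_prod, Measure.count_singleton, one_mul]
    by_cases h : coverCost μ π 1 = 0
    · obtain ⟨N, hN, hcov⟩ := exists_null_cover_of_coverCost_eq_zero h
      refine Or.inl ⟨fun i => {e | (i, e) ∈ N}, fun i => ?_, ?_⟩
      · rw [← hμ i]
        refine measure_mono_null ?_ hN
        rintro ⟨j, e⟩ ⟨rfl, he⟩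
        exact he
      · rintro _ ⟨σ, rfl⟩
        exact Set.mem_iUnion.2 (hcov σ)
    · obtain ⟨C, hC, hC0⟩ := exists_isCompact_coverCost_ne_zero hπ h
      have : CompactSpace C := isCompact_iff_compactSpace.1 hC
      have hπC : ∀ i, Continuous fun σ : C => π i σ := fun i =>
        (hπ i).comp continuous_subtype_val
      obtain ⟨η, hη, hη0, hηle⟩ := exists_measure_of_coverCost_ne_zero (μ := μ)
        (π := fun i (σ : C) => π i σ) hπC fun h0 => hC0 <| le_zero_iff.1 <| h0 ▸
          le_iInf fun F => le_iInf fun hF => le_iInf fun hcov => coverCost_le hF <|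
            Set.indicator_le fun σ hσ => hcov ⟨σ, hσ⟩
      have hfC : Measurable fun σ : C => f σ := (hf.comp continuous_subtype_val).measurable
      refine Or.inr ⟨η.map fun σ : C => f σ, inferInstance, ?_, fun i => ?_⟩
      · refine (pos_iff_ne_zero.2 hη0).trans_le ?_
        refine le_trans (measure_mono fun σ _ => ?_) (Measure.le_map_apply hfC.aemeasurable _)
        exact Set.mem_range_self _
      · rw [Measure.map_map (measurable_pi_apply i) hfC]
        refine Measure.le_iff.2 fun s hs => ?_
        have hsm : MeasurableSet (({i} : Set (Fin l)) ×ˢ s) := (measurableSet_singleton i).prod hs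
        rw [← hμ i s, Measure.map_apply ((measurable_pi_apply i).comp hfC) hs]
        refine le_trans ?_ (hηle _)
        rw [Measure.finsetSum_apply]
        refine le_trans (le_of_eq ?_) (Finset.single_le_sum
          (f := fun j => η.map (fun σ : C => π j σ) ({i} ×ˢ s)) (fun _ _ => zero_le)
          (Finset.mem_univ i))
        rw [Measure.map_apply (hπC i).measurable hsm]
        congr 1
        ext σ
        simp [π]
  · rintro ⟨⟨N, hN, hMN⟩, η, -, hηM, hη⟩
    refine hηM.ne' (measure_mono_null hMN (measure_iUnion_null fun i => ?_))
    refine le_zero_iff.1 ((Measure.le_map_apply (measurable_pi_apply i).aemeasurable _).trans ?_)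
    exact (hη i _).trans (hN i).le
end

section
/- Let (μ_t)_{t∈[0,1]} be a weakly continuous family of Borel probability measures on ℝ and let P be a Borel probability measure on C[0,1] whose marginal at each time t equals μ_t. If there is a monotone Borel set M ⊆ C[0,1] with P(M) = 1, then P = π*, the quantile measure of the family (μ_t). -/
open MeasureTheory
open scoped ENNReal Classical

noncomputable instance (T : ℝ) : MeasurableSpace C(Set.Icc (0:ℝ) T, ℝ) := borel _
instance (T : ℝ) : BorelSpace C(Set.Icc (0:ℝ) T, ℝ) := ⟨rfl⟩

/-- The quantile function of a probability measure `μ` on `ℝ`: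
`quantile μ x = inf {y : μ((-∞, y]) ≥ x}`. -/
noncomputable def quantile (μ : Measure ℝ) (x : ℝ) : ℝ :=
  sInf {y : ℝ | x ≤ (μ (Set.Iic y)).toReal}

/-- The quantile path `t ↦ q_t(x)`, as a continuous function on `[0,T]` (under weak
continuity of the marginals this map is indeed continuous for `x ∈ (0,1)`). -/
noncomputable def quantilePath {T : ℝ} (μ : Set.Icc (0:ℝ) T → Measure ℝ) (x : ℝ) :
    C(Set.Icc (0:ℝ) T, ℝ) :=
  if hc : Continuous (fun t => quantile (μ t) x) then ⟨_, hc⟩ else 0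

/-- The quantile measure `π*`: the push-forward of Lebesgue measure on `(0,1)` under
`x ↦ (q_t(x))_{t ∈ [0,T]}`. -/
noncomputable def quantileMeasure {T : ℝ} (μ : Set.Icc (0:ℝ) T → Measure ℝ) :
    Measure C(Set.Icc (0:ℝ) T, ℝ) :=
  ((volume : Measure ℝ).restrict (Set.Ioo 0 1)).map (quantilePath μ)

open Set Filter Topology

lemma quantile_le_iff (μ : Measure ℝ) [IsProbabilityMeasure μ] {x : ℝ} (hx : x ∈ Ioo (0 : ℝ) 1)
    (y : ℝ) : quantile μ x ≤ y ↔ x ≤ (μ (Iic y)).toReal := by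
  have hcdf : ∀ z, (μ (Iic z)).toReal = ProbabilityTheory.cdf μ z := fun z =>
    (ProbabilityTheory.cdf_eq_real μ z).symm
  unfold quantile
  simp only [hcdf]
  have hne : {z : ℝ | x ≤ ProbabilityTheory.cdf μ z}.Nonempty :=
    ((ProbabilityTheory.tendsto_cdf_atTop μ).eventually (eventually_ge_nhds hx.2)).exists
  obtain ⟨b, hb⟩ :=
    ((ProbabilityTheory.tendsto_cdf_atBot μ).eventually (eventually_lt_nhds hx.1)).exists
  have hbdd : BddBelow {z : ℝ | x ≤ ProbabilityTheory.cdf μ z} := by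
    refine ⟨b, fun z hz => ?_⟩
    by_contra! hzb
    exact absurd (hz.trans (ProbabilityTheory.monotone_cdf μ hzb.le)) (not_le.2 hb)
  refine ⟨fun h => ?_, fun h => csInf_le hbdd h⟩
  have hlim : Tendsto (ProbabilityTheory.cdf μ) (𝓝[>] y) (𝓝 (ProbabilityTheory.cdf μ y)) :=
    ((ProbabilityTheory.cdf μ).right_continuous y).mono_left
      (nhdsWithin_mono y Ioi_subset_Ici_self)
  refine ge_of_tendsto hlim ?_
  filter_upwards [self_mem_nhdsWithin] with z hz
  obtain ⟨w, hw, hwz⟩ := exists_lt_of_csInf_lt hne (h.trans_lt hz)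
  exact le_trans hw (ProbabilityTheory.monotone_cdf μ hwz.le)

lemma quantile_monotoneOn (μ : Measure ℝ) [IsProbabilityMeasure μ] :
    MonotoneOn (quantile μ) (Ioo 0 1) := fun _ hx _ hy hxy =>
  (quantile_le_iff μ hx _).2 (hxy.trans ((quantile_le_iff μ hy _).1 le_rfl))

lemma volume_quantile_le (μ : Measure ℝ) [IsProbabilityMeasure μ] (a : ℝ) :
    (volume : Measure ℝ).restrict (Ioo 0 1) {x | quantile μ x ≤ a} = μ (Iic a) := by
  have hfin : μ (Iic a) ≠ ∞ := measure_ne_top _ _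
  have hle : (μ (Iic a)).toReal ≤ 1 := by
    simpa using ENNReal.toReal_mono ENNReal.one_ne_top (prob_le_one (μ := μ) (s := Iic a))
  have hae : ({x | quantile μ x ≤ a} : Set ℝ) =ᵐ[(volume : Measure ℝ).restrict (Ioo 0 1)]
      (Iic (μ (Iic a)).toReal : Set ℝ) := by
    filter_upwards [ae_restrict_mem measurableSet_Ioo] with x hx
    exact propext (quantile_le_iff μ hx a)
  rw [measure_congr hae, Measure.restrict_congr_set Ioo_ae_eq_Ioc,
    Measure.restrict_apply measurableSet_Iic]
  have : Iic (μ (Iic a)).toReal ∩ Ioc 0 1 = Ioc 0 (μ (Iic a)).toReal := by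
    ext x
    simp only [mem_inter_iff, mem_Iic, mem_Ioc]
    constructor
    · rintro ⟨h1, h2, -⟩
      exact ⟨h2, h1⟩
    · rintro ⟨h1, h2⟩
      exact ⟨h2, h1, h2.trans hle⟩
  rw [this, Real.volume_Ioc, sub_zero, ENNReal.ofReal_toReal hfin]

lemma exists_measure_biInter_eq_of_chain {α ι : Type*} [MeasurableSpace α] {ν : Measure α}
    {M : Set α} (hM : ν Mᶜ = 0) {B : ι → Set α}
    (h : ∀ i j, M ∩ B i ⊆ B j ∨ M ∩ B j ⊆ B i) {s : Finset ι} (hs : s.Nonempty) :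
    ∃ i ∈ s, ν (⋂ j ∈ s, B j) = ν (B i) := by
  obtain ⟨i, his, hi⟩ : ∃ i ∈ s, ∀ j ∈ s, M ∩ B i ⊆ B j := by
    induction hs using Finset.Nonempty.cons_induction with
    | singleton a => exact ⟨a, by simp, by simp⟩
    | cons a s ha hs ih =>
      obtain ⟨i, his, hi⟩ := ih
      rcases h i a with hia | hai
      · exact ⟨i, by simp [his], by simpa using ⟨hia, hi⟩⟩
      · refine ⟨a, by simp, ?_⟩
        simp only [Finset.mem_cons, forall_eq_or_imp, inter_subset_right, true_and]
        exact fun j hj => fun f hf => hi j hj ⟨hf.1, hai hf⟩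
  refine ⟨i, his, le_antisymm (measure_mono (biInter_subset_of_mem his)) ?_⟩
  have hsub : B i ⊆ (⋂ j ∈ s, B j) ∪ Mᶜ := by
    intro f hf
    by_cases hfM : f ∈ M
    · exact Or.inl (mem_iInter₂.2 fun j hj => hi j hj ⟨hfM, hf⟩)
    · exact Or.inr hfM
  calc ν (B i) ≤ ν ((⋂ j ∈ s, B j) ∪ Mᶜ) := measure_mono hsub
    _ ≤ ν (⋂ j ∈ s, B j) + ν Mᶜ := measure_union_le _ _
    _ = ν (⋂ j ∈ s, B j) := by rw [hM, add_zero]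

lemma measure_biInter_eq_of_chains {α β ι : Type*} [MeasurableSpace α] [MeasurableSpace β]
    {ν : Measure α} {ν' : Measure β} {M : Set α} {M' : Set β} (hM : ν Mᶜ = 0) (hM' : ν' M'ᶜ = 0)
    {B : ι → Set α} {B' : ι → Set β}
    (h : ∀ i j, M ∩ B i ⊆ B j ∨ M ∩ B j ⊆ B i) (h' : ∀ i j, M' ∩ B' i ⊆ B' j ∨ M' ∩ B' j ⊆ B' i)
    (heq : ∀ i, ν (B i) = ν' (B' i)) {s : Finset ι} (hs : s.Nonempty) :
    ν (⋂ j ∈ s, B j) = ν' (⋂ j ∈ s, B' j) := by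
  obtain ⟨i, his, hi⟩ := exists_measure_biInter_eq_of_chain hM h hs
  obtain ⟨k, hks, hk⟩ := exists_measure_biInter_eq_of_chain hM' h' hs
  apply le_antisymm
  · rw [hk, ← heq]
    exact measure_mono (biInter_subset_of_mem hks)
  · rw [hi, heq]
    exact measure_mono (biInter_subset_of_mem his)

lemma measure_pi_ext_of_Iic {ι : Type*} {ν ν' : Measure (ι → ℝ)} [IsProbabilityMeasure ν]
    [IsProbabilityMeasure ν']
    (h : ∀ s : Finset ι, s.Nonempty → ∀ a : ι → ℝ,
      ν (⋂ i ∈ s, {f | f i ≤ a i}) = ν' (⋂ i ∈ s, {f | f i ≤ a i})) : ν = ν' := by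
  let π : ι → Set (Set (ι → ℝ)) := fun i => {S | ∃ a : ℝ, {f | f i ≤ a} = S}
  have hmeas : ∀ i (a : ℝ), MeasurableSet {f : ι → ℝ | f i ≤ a} := fun i a =>
    measurableSet_le (measurable_pi_apply i) measurable_const
  refine ext_of_generate_finite (piiUnionInter π univ) (le_antisymm ?_ ?_)
    (isPiSystem_piiUnionInter π (fun i => ?_) univ) ?_ (by simp)
  · refine iSup_le fun i => ?_
    change MeasurableSpace.comap (fun f : ι → ℝ => f i) Real.measurableSpace ≤ _
    have : Real.measurableSpace = MeasurableSpace.generateFrom (range Iic) := by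
      rw [← borel_eq_generateFrom_Iic ℝ]
      exact BorelSpace.measurable_eq
    rw [this, MeasurableSpace.comap_generateFrom]
    refine MeasurableSpace.generateFrom_mono ?_
    rintro _ ⟨_, ⟨a, rfl⟩, rfl⟩
    exact subset_piiUnionInter (mem_univ i) ⟨a, rfl⟩
  · refine generateFrom_piiUnionInter_le π (fun i => MeasurableSpace.generateFrom_le ?_) univ
    rintro _ ⟨a, rfl⟩
    exact hmeas i a
  · rintro _ ⟨a, rfl⟩ _ ⟨b, rfl⟩ -
    exact ⟨min a b, by ext f; simp⟩
  · rintro _ ⟨s, -, B, hB, rfl⟩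
    rcases s.eq_empty_or_nonempty with rfl | hs
    · simp
    · choose! a ha using hB
      have : (⋂ i ∈ s, B i) = ⋂ i ∈ s, {f : ι → ℝ | f i ≤ a i} :=
        iInter₂_congr fun i hi => (ha i hi).symm
      rw [this]
      exact h s hs a

section WeaklyContinuous

variable {X : Type*} [TopologicalSpace X] {μ : X → ProbabilityMeasure ℝ} {D : Set X} {g : X → ℝ}
  {t : X}

lemma quantile_le_of_continuousAt (hμ : Continuous μ) (hD : Dense D) {x : ℝ}
    (hx : x ∈ Ioo (0 : ℝ) 1) (hg : ContinuousAt g t)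
    (hgD : ∀ s ∈ D, g s = quantile (μ s : Measure ℝ) x) :
    quantile (μ t : Measure ℝ) x ≤ g t := by
  refine le_of_forall_gt_imp_ge_of_dense fun y hy => ?_
  rw [quantile_le_iff _ hx, ← ENNReal.ofReal_le_iff_le_toReal (measure_ne_top _ _)]
  refine le_trans ?_ (ProbabilityMeasure.limsup_measure_closed_le_of_tendsto
    (hμ.tendsto t) (isClosed_Iic (a := y)))
  refine le_limsup_of_frequently_le ?_
  refine ((mem_closure_iff_frequently.1 (hD t)).and_eventually
    (hg.eventually (eventually_lt_nhds hy))).mono ?_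
  rintro s ⟨hs, hsy⟩
  rw [ENNReal.ofReal_le_iff_le_toReal (measure_ne_top _ _), ← quantile_le_iff _ hx, ← hgD s hs]
  exact hsy.le

lemma le_quantile_of_continuousAt (hμ : Continuous μ) (hD : Dense D) {x y : ℝ}
    (hx : x ∈ Ioo (0 : ℝ) 1) (hy : y ∈ Ioo (0 : ℝ) 1) (hxy : x < y) (hg : ContinuousAt g t)
    (hgD : ∀ s ∈ D, g s = quantile (μ s : Measure ℝ) x) :
    g t ≤ quantile (μ t : Measure ℝ) y := by
  by_contra! hlt
  obtain ⟨z, hz, hzg⟩ := exists_between hlt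
  have h1 : ENNReal.ofReal y ≤ (μ t : Measure ℝ) (Iio z) := by
    rw [ENNReal.ofReal_le_iff_le_toReal (measure_ne_top _ _)]
    refine ((quantile_le_iff (μ t : Measure ℝ) hy _).1 le_rfl).trans ?_
    exact ENNReal.toReal_mono (measure_ne_top _ _) (measure_mono (Iic_subset_Iio.2 hz))
  have h2 : liminf (fun s => (μ s : Measure ℝ) (Iio z)) (𝓝 t) ≤ ENNReal.ofReal x := by
    refine liminf_le_of_frequently_le ?_
    refine ((mem_closure_iff_frequently.1 (hD t)).and_eventually
      (hg.eventually (eventually_gt_nhds hzg))).mono ?_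
    rintro s ⟨hs, hsz⟩
    have : (((μ s : Measure ℝ) (Iic z)).toReal) < x := by
      rw [← not_le, ← quantile_le_iff _ hx, ← hgD s hs, not_le]
      exact hsz
    exact (measure_mono Iio_subset_Iic_self).trans
      ((ENNReal.le_ofReal_iff_toReal_le (measure_ne_top _ _) hx.1.le).2 this.le)
  have h3 := (h1.trans (ProbabilityMeasure.le_liminf_measure_open_of_tendsto
    (hμ.tendsto t) isOpen_Iio)).trans h2
  exact absurd ((ENNReal.ofReal_le_ofReal_iff hx.1.le).1 h3) (not_le.2 hxy)

lemma countable_quantile_ne [CompactSpace X] [SecondCountableTopology C(X, ℝ)]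
    (hμ : Continuous μ) (hD : Dense D) (G : ℝ → C(X, ℝ)) :
    {x ∈ Ioo (0 : ℝ) 1 | (∀ s ∈ D, G x s = quantile (μ s : Measure ℝ) x) ∧
      ∃ t, G x t ≠ quantile (μ t : Measure ℝ) x}.Countable := by
  let B : ℕ → Set ℝ := fun n => {x ∈ Ioo (0 : ℝ) 1 |
    (∀ s ∈ D, G x s = quantile (μ s : Measure ℝ) x) ∧
      ∃ t, quantile (μ t : Measure ℝ) x + 1 / ((n : ℝ) + 1) < G x t}
  have hB : ∀ n, (B n).Countable := by
    intro n
    have hpos : (0 : ℝ) < 1 / ((n : ℝ) + 1) := by positivity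
    have hsep : ∀ x ∈ B n, ∀ y ∈ B n, x < y → 1 / ((n : ℝ) + 1) < dist (G x) (G y) := by
      rintro x ⟨hx, hxD, -⟩ y ⟨hy, -, t, ht⟩ hxy
      have h1 := le_quantile_of_continuousAt hμ hD hx hy hxy (G x).continuous.continuousAt
        (t := t) hxD
      have h2 := ContinuousMap.dist_apply_le_dist (f := G x) (g := G y) t
      rw [Real.dist_eq] at h2
      linarith [neg_abs_le (G x t - G y t)]
    refine PairwiseDisjoint.countable_of_isOpen
      (s := fun x => Metric.ball (G x) (1 / ((n : ℝ) + 1) / 2)) ?_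
      (fun _ _ => Metric.isOpen_ball) (fun x _ => ⟨G x, Metric.mem_ball_self (by positivity)⟩)
    intro x hx y hy hxy
    refine Metric.ball_disjoint_ball ?_
    rcases lt_or_gt_of_ne hxy with hlt | hlt
    · linarith [hsep x hx y hy hlt]
    · rw [dist_comm]
      linarith [hsep y hy x hx hlt]
  refine (countable_iUnion hB).mono ?_
  rintro x ⟨hx, hxD, t, ht⟩
  have hlt := lt_of_le_of_ne
    (quantile_le_of_continuousAt hμ hD hx (G x).continuous.continuousAt (t := t) hxD) ht.symm
  obtain ⟨n, hn⟩ := exists_nat_one_div_lt (sub_pos.2 hlt)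
  exact mem_iUnion.2 ⟨n, hx, hxD, t, by linarith⟩

end WeaklyContinuous

lemma quantilePath_apply {T : ℝ} {μ : Icc (0 : ℝ) T → Measure ℝ} {x : ℝ} {g : C(Icc (0 : ℝ) T, ℝ)}
    (hg : ∀ t, g t = quantile (μ t) x) (t : Icc (0 : ℝ) T) :
    quantilePath μ x t = quantile (μ t) x := by
  have hc : Continuous (fun t => quantile (μ t) x) := by
    simpa only [← hg] using g.continuous
  simp [quantilePath, hc]

/-- If the law of the quantiles along a dense sequence of times is that of the evaluations of a
random continuous function, then almost every family of quantiles is continuous in time. -/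
lemma ae_quantilePath_apply {T : ℝ} {μ : Icc (0 : ℝ) T → ProbabilityMeasure ℝ}
    (hμ : Continuous μ) {d : ℕ → Icc (0 : ℝ) T} (hd : DenseRange d)
    (h : ∀ᵐ x ∂(volume : Measure ℝ).restrict (Ioo 0 1),
      ∃ g : C(Icc (0 : ℝ) T, ℝ), ∀ n, g (d n) = quantile (μ (d n) : Measure ℝ) x) :
    ∀ᵐ x ∂(volume : Measure ℝ).restrict (Ioo 0 1),
      ∀ t, quantilePath (fun t => (μ t : Measure ℝ)) x t = quantile (μ t : Measure ℝ) x := by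
  have hch : ∀ x, ∃ G : C(Icc (0 : ℝ) T, ℝ),
      (∃ g : C(Icc (0 : ℝ) T, ℝ), ∀ n, g (d n) = quantile (μ (d n) : Measure ℝ) x) →
        ∀ n, G (d n) = quantile (μ (d n) : Measure ℝ) x := fun x => by
    by_cases hx : ∃ g : C(Icc (0 : ℝ) T, ℝ), ∀ n, g (d n) = quantile (μ (d n) : Measure ℝ) x
    · obtain ⟨g, hg⟩ := hx
      exact ⟨g, fun _ => hg⟩
    · exact ⟨0, fun h => absurd h hx⟩
  choose G hG using hch
  filter_upwards [h, ae_restrict_mem measurableSet_Ioo,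
    (countable_quantile_ne hμ hd G).ae_notMem _] with x hx hx01 hxB
  refine quantilePath_apply (g := G x) fun t => ?_
  by_contra hne
  exact hxB ⟨hx01, by rintro _ ⟨n, rfl⟩; exact hG x hx n, t, hne⟩

lemma measurableEmbedding_eval_denseRange {T : ℝ} {d : ℕ → Icc (0 : ℝ) T} (hd : DenseRange d) :
    MeasurableEmbedding (fun (f : C(Icc (0 : ℝ) T, ℝ)) n => f (d n)) := by
  refine Continuous.measurableEmbedding
    (continuous_pi fun n => continuous_eval_const (d n)) fun f g hfg => ?_
  exact DFunLike.coe_injective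
    (hd.equalizer f.continuous g.continuous (funext fun n => congrFun hfg n))

/-- **Lemma.** Let `(μ_t)_{t∈[0,1]}` be a weakly continuous family of probability
measures on `ℝ` and `P` a probability measure on `C[0,1]` whose marginal at each time `t`
is `μ_t`. If `P` is concentrated on a monotone Borel set (a set on which the pointwise
order of functions is total), then `P` equals the quantile measure `π*`. -/
theorem statement6
    (μ : Set.Icc (0:ℝ) 1 → ProbabilityMeasure ℝ) (hweak : Continuous μ)
    (P : Measure C(Set.Icc (0:ℝ) 1, ℝ)) [IsProbabilityMeasure P]
    (hmarg : ∀ t, P.map (fun f => f t) = (μ t : Measure ℝ))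
    (M : Set C(Set.Icc (0:ℝ) 1, ℝ)) (hM : MeasurableSet M)
    (hmono : ∀ f ∈ M, ∀ g ∈ M, (∀ t, f t ≤ g t) ∨ (∀ t, g t ≤ f t))
    (hPM : P M = 1) :
    P = quantileMeasure (fun t => (μ t : Measure ℝ)) := by
  let d : ℕ → Icc (0 : ℝ) 1 := TopologicalSpace.denseSeq _
  have hd : DenseRange d := TopologicalSpace.denseRange_denseSeq _
  let R : C(Icc (0 : ℝ) 1, ℝ) → ℕ → ℝ := fun f n => f (d n)
  have hR : MeasurableEmbedding R := measurableEmbedding_eval_denseRange hd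
  let Q : ℝ → ℕ → ℝ := fun x n => quantile (μ (d n) : Measure ℝ) x
  set ν : Measure ℝ := (volume : Measure ℝ).restrict (Ioo 0 1) with hν
  have : IsProbabilityMeasure ν := ⟨by simp [hν]⟩
  have hQ : AEMeasurable Q ν := aemeasurable_pi_lambda _ fun n =>
    aemeasurable_restrict_of_monotoneOn measurableSet_Ioo (quantile_monotoneOn _)
  have hν0 : ν (Ioo 0 1)ᶜ = 0 := by
    simp [hν, Measure.restrict_apply measurableSet_Ioo.compl]
  have hP0 : P Mᶜ = 0 := (prob_compl_eq_zero_iff hM).2 hPM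
  have hlaw : P.map R = ν.map Q := by
    have := Measure.isProbabilityMeasure_map (μ := P) hR.measurable.aemeasurable
    have := Measure.isProbabilityMeasure_map hQ
    refine measure_pi_ext_of_Iic fun s hs a => ?_
    have hmeas : MeasurableSet (⋂ i ∈ s, {f : ℕ → ℝ | f i ≤ a i}) :=
      Finset.measurableSet_biInter _ fun i _ =>
        measurableSet_le (measurable_pi_apply i) measurable_const
    rw [Measure.map_apply hR.measurable hmeas, Measure.map_apply_of_aemeasurable hQ hmeas]
    simp only [preimage_iInter]
    refine measure_biInter_eq_of_chains hP0 hν0 (fun i j => ?_) (fun i j => ?_) (fun i => ?_) hs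
    · by_contra! hcon
      obtain ⟨f, ⟨hfM, hfi⟩, hfj⟩ := not_subset.1 hcon.1
      obtain ⟨g, ⟨hgM, hgj⟩, hgi⟩ := not_subset.1 hcon.2
      rcases hmono f hfM g hgM with hfg | hgf
      · exact hfj ((hfg (d j)).trans hgj)
      · exact hgi ((hgf (d i)).trans hfi)
    · by_contra! hcon
      obtain ⟨x, ⟨hx, hxi⟩, hxj⟩ := not_subset.1 hcon.1
      obtain ⟨y, ⟨hy, hyj⟩, hyi⟩ := not_subset.1 hcon.2
      rcases le_total x y with hxy | hyx
      · exact hxj ((quantile_monotoneOn (μ (d j) : Measure ℝ) hx hy hxy).trans hyj)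
      · exact hyi ((quantile_monotoneOn (μ (d i) : Measure ℝ) hy hx hyx).trans hxi)
    · refine Eq.trans ?_ (volume_quantile_le (μ (d i) : Measure ℝ) (a i)).symm
      rw [← hmarg (d i), Measure.map_apply
        (continuous_eval_const (d i)).measurable measurableSet_Iic]
      rfl
  have hrange : ∀ᵐ x ∂ν, Q x ∈ range R := by
    refine ae_of_ae_map hQ ?_
    rw [← hlaw, hR.ae_map_iff]
    exact ae_of_all _ mem_range_self
  have hpath := ae_quantilePath_apply hweak hd
    (hrange.mono fun x ⟨g, hg⟩ => ⟨g, fun n => congrFun hg n⟩)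
  have hRQ : R ∘ quantilePath (fun t => (μ t : Measure ℝ)) =ᵐ[ν] Q :=
    hpath.mono fun x hx => funext fun n => hx (d n)
  have hmeas : AEMeasurable (quantilePath fun t => (μ t : Measure ℝ)) ν :=
    (hR.aemeasurable_comp_iff).1 (hQ.congr hRQ.symm)
  rw [← hR.comap_map P, ← hR.comap_map (quantileMeasure _)]
  congr 1
  rw [hlaw, quantileMeasure, AEMeasurable.map_map_of_aemeasurable hR.measurable.aemeasurable hmeas]
  exact (Measure.map_congr hRQ).symm
end

section
/- Let Q = [0,1] ∩ ℚ, h : ℝ → ℝ concave, increasing and non-positive, (μ_q)_{q∈Q} Borel probability measures on ℝ with ∫ |x| dμ_q < ∞ and ∫ |h| dμ_q < ∞ for all q ∈ Q, and (𝒫_n) an increasing sequence of finite partitions of [0,1] contained in Q with union Q. Define s_n(f) = Σ_{t_i ∈ 𝒫_n} f(t_i)(t_i − t_{i−1}) and φ_n(f) = sup_{k ≥ n} s_k(f) for f ∈ ℝ^Q. Then for each n, the operators S_n : P ↦ ∫ h∘s_n dP and Φ_n : P ↦ ∫ h∘φ_n dP are lower semi-continuous with respect to weak convergence on Π_Q(μ_q),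 each attains its minimum on Π_Q(μ_q), and the minimal values are finite. -/
open MeasureTheory
open scoped ENNReal

/-- The index set `Q = [0,1] ∩ ℚ`. -/
abbrev Q01 : Type := {q : ℚ // 0 ≤ q ∧ q ≤ 1}

/-- The real value of an element of `Q`. -/
noncomputable def qval (q : Q01) : ℝ := ((q : ℚ) : ℝ)

def zeroQ : Q01 := ⟨0, by norm_num⟩

def oneQ : Q01 := ⟨1, by norm_num⟩

/-- The predecessor `t_{i-1}` of `t = t_i` in the finite partition `S` (it is `0` if
there is no partition point below `t`). -/
noncomputable def prevPt (S : Finset Q01) (t : Q01) : ℝ :=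
  sSup (insert (0:ℝ) (qval '' {s : Q01 | s ∈ S ∧ s < t}))

/-- The Riemann sum `s_n`: `Σ_{t_i ∈ S} f(t_i)(t_i − t_{i-1})` of `f : ℝ^Q → ℝ` over the
finite partition `S` (the lowest partition point contributes `0`). -/
noncomputable def riemannSum (S : Finset Q01) (f : Q01 → ℝ) : ℝ :=
  ∑ t ∈ S, f t * (qval t - prevPt S t)

/-- `φ_n(f) = sup_{k ≥ n} s_k(f)`, with values in `ℝ ∪ {∞}` (an extended real). -/
noncomputable def phiSup (P : ℕ → Finset Q01) (n : ℕ) (f : Q01 → ℝ) : EReal :=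
  ⨆ k, ⨆ _ : n ≤ k, ((riemannSum (P k) f : ℝ) : EReal)

/-- The monotone extension of an increasing function `h : ℝ → ℝ` to `EReal`
(`⊥ ↦ inf h`, `⊤ ↦ sup h`). -/
noncomputable def erealExt (h : ℝ → ℝ) (x : EReal) : EReal :=
  ⨆ r ∈ {r : ℝ | (r : EReal) ≤ x}, ((h r : ℝ) : EReal)

/-- The negative part of an extended real number, as an element of `[0,∞]`. -/
noncomputable def erealNegPart (y : EReal) : ℝ≥0∞ :=
  if -y = ⊤ then ⊤ else ENNReal.ofReal (-y).toReal

/-- The operator `S_n : P ↦ ∫ h ∘ s_n dP`, with values in `EReal` (since `h ≤ 0`, it is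
minus the `lintegral` of the negative part of the cost). -/
noncomputable def Sval (h : ℝ → ℝ) (P : ℕ → Finset Q01) (n : ℕ)
    (P' : ProbabilityMeasure (Q01 → ℝ)) : EReal :=
  - ((∫⁻ f, ENNReal.ofReal (-(h (riemannSum (P n) f))) ∂P'.toMeasure : ℝ≥0∞) : EReal)

/-- The operator `Φ_n : P ↦ ∫ h ∘ φ_n dP`, with values in `EReal` (since `h ≤ 0`, it is
minus the `lintegral` of the negative part of the cost). -/
noncomputable def Phival (h : ℝ → ℝ) (P : ℕ → Finset Q01) (n : ℕ)
    (P' : ProbabilityMeasure (Q01 → ℝ)) : EReal :=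
  - ((∫⁻ f, erealNegPart (erealExt h (phiSup P n f)) ∂P'.toMeasure : ℝ≥0∞) : EReal)

open Filter Topology Set

/-! ### Partitions and Riemann sums -/

lemma qval_strictMono : StrictMono qval := fun a b hab => by
  have : (a : ℚ) < (b : ℚ) := hab
  exact Rat.cast_lt.2 this

lemma qval_nonneg (q : Q01) : 0 ≤ qval q := by
  have := q.2.1
  simpa [qval] using this

lemma prevPt_le (S : Finset Q01) (t : Q01) : prevPt S t ≤ qval t := by
  refine csSup_le (insert_nonempty _ _) ?_
  rintro _ (rfl | ⟨s, hs, rfl⟩)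
  · exact qval_nonneg t
  · exact (qval_strictMono hs.2).le

lemma sum_qval_sub_prevPt (S : Finset Q01) :
    ∑ t ∈ S, (qval t - prevPt S t) = sSup (insert (0 : ℝ) (qval '' (S : Set Q01))) := by
  induction S using Finset.induction_on_max with
  | empty => simp
  | insert a S ha ih =>
    have ha' : a ∉ S := fun h => lt_irrefl _ (ha a h)
    have hlast : prevPt (insert a S) a = sSup (insert (0 : ℝ) (qval '' (S : Set Q01))) := by
      unfold prevPt
      congr 3
      ext s
      simp only [Finset.mem_insert, mem_ofPred_eq, Finset.mem_coe]
      exact ⟨fun h => h.1.resolve_left h.2.ne, fun h => ⟨Or.inr h, ha s h⟩⟩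
    have hrest : ∀ t ∈ S, qval t - prevPt (insert a S) t = qval t - prevPt S t := by
      intro t ht
      unfold prevPt
      congr 4
      ext s
      simp only [Finset.mem_insert, mem_ofPred_eq]
      exact ⟨fun h => ⟨h.1.resolve_left fun e => (ha t ht).not_gt (e ▸ h.2), h.2⟩,
        fun h => ⟨Or.inr h.1, h.2⟩⟩
    have hmax : IsGreatest (insert (0 : ℝ) (qval '' ((insert a S : Finset Q01) : Set Q01)))
        (qval a) := by
      refine ⟨Or.inr ⟨a, by simp, rfl⟩, ?_⟩
      rintro _ (rfl | ⟨s, hs, rfl⟩)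
      · exact qval_nonneg a
      · rcases Finset.mem_insert.1 hs with rfl | hs
        · exact le_rfl
        · exact (qval_strictMono (ha s hs)).le
    rw [Finset.sum_insert ha', Finset.sum_congr rfl hrest, ih, hlast, hmax.csSup_eq]
    ring

lemma sum_qval_sub_prevPt_eq_one {S : Finset Q01} (hS : oneQ ∈ S) :
    ∑ t ∈ S, (qval t - prevPt S t) = 1 := by
  have hone : qval oneQ = 1 := by simp [qval, oneQ]
  rw [sum_qval_sub_prevPt]
  refine IsGreatest.csSup_eq ⟨Or.inr ⟨oneQ, hS, hone⟩, ?_⟩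
  rintro _ (rfl | ⟨s, -, rfl⟩)
  · exact zero_le_one
  · rw [← hone]
    exact qval_strictMono.monotone s.2.2

lemma continuous_riemannSum (S : Finset Q01) : Continuous (riemannSum S) := by
  unfold riemannSum
  fun_prop

/-- **Jensen's inequality** for Riemann sums. -/
lemma neg_comp_riemannSum_le {h : ℝ → ℝ} (hconc : ConcaveOn ℝ univ h) {S : Finset Q01}
    (hS : oneQ ∈ S) (f : Q01 → ℝ) :
    -h (riemannSum S f) ≤ ∑ t ∈ S, (qval t - prevPt S t) * -h (f t) := by
  have hJ := hconc.le_map_sum (t := S) (w := fun t => qval t - prevPt S t) (p := f)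
    (fun t _ => sub_nonneg.2 (prevPt_le S t)) (sum_qval_sub_prevPt_eq_one hS)
    (fun _ _ => mem_univ _)
  simp only [smul_eq_mul] at hJ
  have : riemannSum S f = ∑ t ∈ S, (qval t - prevPt S t) * f t :=
    Finset.sum_congr rfl fun _ _ => mul_comm _ _
  rw [this]
  simpa only [mul_neg, Finset.sum_neg_distrib, neg_le_neg_iff] using hJ

/-! ### The extension of the cost to extended reals -/

lemma erealExt_iSup_coe {h : ℝ → ℝ} (hmono : Monotone h) (hcont : Continuous h)
    (u : ℕ → ℝ) : erealExt h (⨆ i, (u i : EReal)) = ⨆ i, (h (u i) : EReal) := by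
  refine le_antisymm (iSup₂_le fun r hr => ?_) (iSup_le fun i => ?_)
  · have key : ∀ r' < r, (h r' : EReal) ≤ ⨆ i, (h (u i) : EReal) := by
      intro r' hr'
      obtain ⟨i, hi⟩ := lt_iSup_iff.1 ((EReal.coe_lt_coe_iff.2 hr').trans_le hr)
      exact le_iSup_of_le i (EReal.coe_le_coe_iff.2 (hmono (EReal.coe_lt_coe_iff.1 hi).le))
    have hlim : Tendsto (fun r' => (h r' : EReal)) (𝓝[<] r) (𝓝 (h r : EReal)) :=
      ((continuous_coe_real_ereal.comp hcont).tendsto r).mono_left nhdsWithin_le_nhds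
    exact le_of_tendsto hlim (eventually_mem_nhdsWithin.mono key)
  · exact le_iSup₂_of_le (u i) (le_iSup (fun i => (u i : EReal)) i) le_rfl

lemma erealNegPart_iSup_coe (v : ℕ → ℝ) :
    erealNegPart (⨆ i, (v i : EReal)) = ⨅ i, ENNReal.ofReal (-v i) := by
  have hanti : Antitone fun y : EReal => (-y).toENNReal := fun a b hab =>
    EReal.toENNReal_le_toENNReal (EReal.neg_le_neg_iff.2 hab)
  have hc : Continuous fun y : EReal => (-y).toENNReal :=
    EReal.continuous_toENNReal.comp continuous_neg
  have hbot : (-(⊥ : EReal)).toENNReal = ⊤ := by rw [EReal.neg_bot, EReal.toENNReal_top]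
  exact hanti.map_iSup_of_continuousAt (g := fun i => (v i : EReal)) hc.continuousAt hbot

/-- The maximum of the Riemann sums over the partitions `P n, …, P (n + m)`. -/
noncomputable def maxRiemannSum (P : ℕ → Finset Q01) (n m : ℕ) (f : Q01 → ℝ) : ℝ :=
  partialSups (fun j => riemannSum (P (n + j)) f) m

lemma continuous_maxRiemannSum (P : ℕ → Finset Q01) (n m : ℕ) :
    Continuous (maxRiemannSum P n m) :=
  Continuous.partialSups_apply fun j _ => continuous_riemannSum (P (n + j))

lemma riemannSum_le_maxRiemannSum (P : ℕ → Finset Q01) (n m : ℕ) (f : Q01 → ℝ) :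
    riemannSum (P n) f ≤ maxRiemannSum P n m f := by
  have := le_partialSups_of_le (fun j => riemannSum (P (n + j)) f) (Nat.zero_le m)
  rwa [Nat.add_zero] at this

lemma monotone_maxRiemannSum (P : ℕ → Finset Q01) (n : ℕ) (f : Q01 → ℝ) :
    Monotone fun m => maxRiemannSum P n m f :=
  partialSups_monotone _

lemma phiSup_eq_iSup_maxRiemannSum (P : ℕ → Finset Q01) (n : ℕ) (f : Q01 → ℝ) :
    phiSup P n f = ⨆ m, (maxRiemannSum P n m f : EReal) := by
  refine le_antisymm (iSup₂_le fun k hk => ?_) (iSup_le fun m => ?_)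
  · obtain ⟨j, rfl⟩ := Nat.exists_eq_add_of_le hk
    exact le_iSup_of_le j (EReal.coe_le_coe_iff.2
      (le_partialSups (fun j => riemannSum (P (n + j)) f) j))
  · obtain ⟨j, -, hj⟩ := exists_partialSups_eq (fun j => riemannSum (P (n + j)) f) m
    rw [maxRiemannSum, hj]
    exact le_iSup₂_of_le (n + j) (Nat.le_add_right _ _) le_rfl

lemma erealNegPart_erealExt_phiSup {h : ℝ → ℝ} (hmono : Monotone h) (hcont : Continuous h)
    (P : ℕ → Finset Q01) (n : ℕ) (f : Q01 → ℝ) :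
    erealNegPart (erealExt h (phiSup P n f)) =
      ⨅ m, ENNReal.ofReal (-h (maxRiemannSum P n m f)) := by
  rw [phiSup_eq_iSup_maxRiemannSum, erealExt_iSup_coe hmono hcont, erealNegPart_iSup_coe]

/-! ### Semicontinuity of integral functionals -/

lemma lowerSemicontinuousOn_of_eqOn {X β : Type*} [TopologicalSpace X] [Preorder β] {f g : X → β}
    {s : Set X} (hf : LowerSemicontinuousOn f s) (hfg : EqOn f g s) :
    LowerSemicontinuousOn g s := fun x hx =>
  LowerSemicontinuousWithinAt.congr_of_eventuallyEq (hf x hx) hx hfg.eventuallyEq_nhdsWithin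

section Semicontinuity

variable {Ω : Type*} [MeasurableSpace Ω] [TopologicalSpace Ω] [OpensMeasurableSpace Ω]

lemma lowerSemicontinuous_lintegral_ofReal {g : Ω → ℝ} (hg : Continuous g) :
    LowerSemicontinuous fun P : ProbabilityMeasure Ω => ∫⁻ x, ENNReal.ofReal (g x) ∂P.toMeasure := by
  have hcont : ∀ k : ℕ, Continuous fun P : ProbabilityMeasure Ω =>
      ∫⁻ x, ((min (g x).toNNReal k : NNReal) : ℝ≥0∞) ∂P.toMeasure := by
    intro k
    let F : BoundedContinuousFunction Ω NNReal :=
      BoundedContinuousFunction.mkOfBound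
        ⟨fun x => min (g x).toNNReal k, (continuous_real_toNNReal.comp hg).min continuous_const⟩ k
        (fun x y => by
          have hx : ((min (g x).toNNReal k : NNReal) : ℝ) ≤ k := by
            exact_mod_cast min_le_right (g x).toNNReal (k : NNReal)
          have hy : ((min (g y).toNNReal k : NNReal) : ℝ) ≤ k := by
            exact_mod_cast min_le_right (g y).toNNReal (k : NNReal)
          have hx0 := (min (g x).toNNReal (k : NNReal)).2
          have hy0 := (min (g y).toNNReal (k : NNReal)).2
          rw [NNReal.dist_eq]
          exact abs_sub_le_of_nonneg_of_le hx0 hx hy0 hy)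
    exact continuous_iff_continuousAt.2 fun P =>
      ProbabilityMeasure.tendsto_iff_forall_lintegral_tendsto.1 tendsto_id F
  have hsup : (fun P : ProbabilityMeasure Ω => ∫⁻ x, ENNReal.ofReal (g x) ∂P.toMeasure) =
      fun P : ProbabilityMeasure Ω =>
        ⨆ k : ℕ, ∫⁻ x, ((min (g x).toNNReal k : NNReal) : ℝ≥0∞) ∂P.toMeasure := by
    funext P
    rw [← lintegral_iSup]
    · refine lintegral_congr fun x => le_antisymm ?_ (iSup_le fun k => ?_)
      · obtain ⟨k, hk⟩ := exists_nat_ge (g x).toNNReal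
        exact le_iSup_of_le k (by rw [min_eq_left hk]; rfl)
      · exact ENNReal.coe_le_coe.2 (min_le_left _ _)
    · intro k
      have := hg.measurable
      fun_prop
    · intro k l hkl x
      exact ENNReal.coe_le_coe.2 (min_le_min_left _ (by exact_mod_cast hkl))
  rw [hsup]
  exact lowerSemicontinuous_iSup fun k => (hcont k).lowerSemicontinuous

/-- The functional `P ↦ -∫ g dP` is lower semicontinuous on any set of measures on which some
continuous majorant of `g` has a constant finite integral. -/
lemma lowerSemicontinuousOn_neg_lintegral {D g : Ω → ℝ} (hD : Continuous D) (hg : Continuous g)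
    (hg0 : ∀ x, 0 ≤ g x) (hgD : ∀ x, g x ≤ D x) {s : Set (ProbabilityMeasure Ω)} {C : ℝ≥0∞}
    (hC : C ≠ ⊤) (hs : ∀ P ∈ s, ∫⁻ x, ENNReal.ofReal (D x) ∂P.toMeasure = C) :
    LowerSemicontinuousOn (fun P : ProbabilityMeasure Ω =>
      -((∫⁻ x, ENNReal.ofReal (g x) ∂P.toMeasure : ℝ≥0∞) : EReal)) s := by
  have hF : Continuous fun y : ℝ≥0∞ => -((C - y : ℝ≥0∞) : EReal) :=
    continuous_neg.comp (continuous_coe_ennreal_ereal.comp (ENNReal.continuous_sub_left hC))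
  have hFmono : Monotone fun y : ℝ≥0∞ => -((C - y : ℝ≥0∞) : EReal) := fun a b hab =>
    EReal.neg_le_neg_iff.2 (EReal.coe_ennreal_le_coe_ennreal_iff.2 (tsub_le_tsub_left hab C))
  have hlsc := hF.comp_lowerSemicontinuousOn
    ((lowerSemicontinuous_lintegral_ofReal (hD.sub hg)).lowerSemicontinuousOn s) hFmono
  refine lowerSemicontinuousOn_of_eqOn hlsc fun P hP => ?_
  have hle : ∫⁻ x, ENNReal.ofReal (g x) ∂P.toMeasure ≤ C := by
    rw [← hs P hP]
    exact lintegral_mono fun x => ENNReal.ofReal_le_ofReal (hgD x)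
  have hsub : ∫⁻ x, ENNReal.ofReal (D x - g x) ∂P.toMeasure =
      C - ∫⁻ x, ENNReal.ofReal (g x) ∂P.toMeasure := by
    rw [← hs P hP, ← lintegral_sub hg.measurable.ennreal_ofReal (ne_top_of_le_ne_top hC hle)
      (Eventually.of_forall fun x => ENNReal.ofReal_le_ofReal (hgD x))]
    exact lintegral_congr fun x => ENNReal.ofReal_sub _ (hg0 x)
  simp only [Function.comp_apply, Pi.sub_apply, hsub, ENNReal.sub_sub_cancel hC hle]

end Semicontinuity

/-! ### Probability measures with prescribed marginals -/

section Marginals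

variable {ι : Type*}

/-- The set of probability measures on `ι → ℝ` with prescribed one-dimensional marginals. -/
def withMarginals (μ : ι → Measure ℝ) : Set (ProbabilityMeasure (ι → ℝ)) :=
  {P | ∀ i, P.toMeasure.map (fun f => f i) = μ i}

lemma lintegral_eval_of_mem_withMarginals {μ : ι → Measure ℝ} {P : ProbabilityMeasure (ι → ℝ)}
    (hP : P ∈ withMarginals μ) (i : ι) {g : ℝ → ℝ≥0∞} (hg : Measurable g) :
    ∫⁻ f, g (f i) ∂P.toMeasure = ∫⁻ x, g x ∂μ i := by
  rw [← hP i, lintegral_map hg (measurable_pi_apply i)]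

lemma lintegral_sum_eval_of_mem_withMarginals {μ : ι → Measure ℝ} {P : ProbabilityMeasure (ι → ℝ)}
    (hP : P ∈ withMarginals μ) (S : Finset ι) {w : ι → ℝ} (hw : ∀ i ∈ S, 0 ≤ w i) {g : ℝ → ℝ}
    (hg : Continuous g) (hg0 : ∀ x, 0 ≤ g x) :
    ∫⁻ f, ENNReal.ofReal (∑ i ∈ S, w i * g (f i)) ∂P.toMeasure =
      ∑ i ∈ S, ENNReal.ofReal (w i) * ∫⁻ x, ENNReal.ofReal (g x) ∂μ i := by
  have hgm : Measurable fun x => ENNReal.ofReal (g x) := hg.measurable.ennreal_ofReal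
  have hgi : ∀ i, Measurable fun f : ι → ℝ => ENNReal.ofReal (g (f i)) := fun i =>
    hgm.comp (measurable_pi_apply i)
  have hpt : ∀ f : ι → ℝ, ENNReal.ofReal (∑ i ∈ S, w i * g (f i)) =
      ∑ i ∈ S, ENNReal.ofReal (w i) * ENNReal.ofReal (g (f i)) := fun f => by
    rw [ENNReal.ofReal_sum_of_nonneg fun i hi => mul_nonneg (hw i hi) (hg0 _)]
    exact Finset.sum_congr rfl fun i hi => ENNReal.ofReal_mul (hw i hi)
  simp_rw [hpt]
  rw [lintegral_finsetSum _ fun i _ => (hgi i).const_mul _]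
  refine Finset.sum_congr rfl fun i _ => ?_
  rw [lintegral_const_mul _ (hgi i), lintegral_eval_of_mem_withMarginals hP i hgm]

variable (μ : ι → Measure ℝ) [∀ i, IsProbabilityMeasure (μ i)]

lemma withMarginals_nonempty : (withMarginals μ).Nonempty :=
  ⟨⟨Measure.infinitePi μ, inferInstance⟩, fun i => Measure.infinitePi_map_eval μ i⟩

variable [Countable ι]

lemma isClosed_withMarginals : IsClosed (withMarginals μ) := by
  have : withMarginals μ = ⋂ i, {P : ProbabilityMeasure (ι → ℝ) |
      P.map (f := fun f => f i) (measurable_pi_apply i).aemeasurable =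
        (⟨μ i, inferInstance⟩ : ProbabilityMeasure ℝ)} := by
    ext P
    simp only [withMarginals, mem_ofPred_eq, mem_iInter]
    exact forall_congr' fun i => ⟨fun h => Subtype.ext h, fun h => congrArg Subtype.val h⟩
  rw [this]
  exact isClosed_iInter fun i =>
    isClosed_eq (ProbabilityMeasure.continuous_map (continuous_apply i)) continuous_const

lemma isTightMeasureSet_withMarginals :
    IsTightMeasureSet {(P : Measure (ι → ℝ)) | P ∈ withMarginals μ} := by
  rw [isTightMeasureSet_iff_exists_isCompact_measure_compl_le]
  intro ε hε
  obtain ⟨δ, hδ, hsum⟩ := ENNReal.exists_pos_sum_of_countable' hε.ne' ι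
  have hK : ∀ i, ∃ K : Set ℝ, IsCompact K ∧ μ i Kᶜ ≤ δ i := fun i => by
    obtain ⟨K, hK, hle⟩ := isTightMeasureSet_iff_exists_isCompact_measure_compl_le.1
      (isTightMeasureSet_singleton (μ := μ i)) (δ i) (hδ i)
    exact ⟨K, hK, hle _ rfl⟩
  choose K hK hKδ using hK
  refine ⟨Set.pi univ K, isCompact_univ_pi hK, ?_⟩
  rintro _ ⟨P, hP, rfl⟩
  have hcompl : (Set.pi univ K)ᶜ = ⋃ i, (fun f : ι → ℝ => f i) ⁻¹' (K i)ᶜ := by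
    ext f
    simp
  calc P.toMeasure (Set.pi univ K)ᶜ
      ≤ ∑' i, P.toMeasure ((fun f : ι → ℝ => f i) ⁻¹' (K i)ᶜ) := by
        rw [hcompl]
        exact measure_iUnion_le _
    _ = ∑' i, μ i (K i)ᶜ := by
        refine tsum_congr fun i => ?_
        rw [← hP i, Measure.map_apply (measurable_pi_apply i) (hK i).measurableSet.compl]
    _ ≤ ∑' i, δ i := ENNReal.tsum_le_tsum hKδ
    _ ≤ ε := hsum.le

lemma isCompact_withMarginals : IsCompact (withMarginals μ) := by
  have := isCompact_closure_of_isTightMeasureSet (isTightMeasureSet_withMarginals μ)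
  rwa [(isClosed_withMarginals μ).closure_eq] at this

variable {μ}

/-- A lower semicontinuous functional of the form `P ↦ -c P` with `c` finite attains a finite
minimum on the set of measures with prescribed marginals. -/
lemma exists_min_withMarginals {c : ProbabilityMeasure (ι → ℝ) → ℝ≥0∞}
    (hlsc : LowerSemicontinuousOn (fun P => -(c P : EReal)) (withMarginals μ))
    (hfin : ∀ P ∈ withMarginals μ, c P ≠ ⊤) :
    ∃ P₀ ∈ withMarginals μ, (∀ P ∈ withMarginals μ, -(c P₀ : EReal) ≤ -(c P : EReal)) ∧
      -(c P₀ : EReal) ≠ ⊥ ∧ -(c P₀ : EReal) ≠ ⊤ := by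
  obtain ⟨P₀, hP₀, hmin⟩ := LowerSemicontinuousOn.exists_isMinOn (withMarginals_nonempty μ)
    (isCompact_withMarginals μ) hlsc
  refine ⟨P₀, hP₀, fun P hP => hmin hP, ?_, ?_⟩
  · rw [Ne, EReal.neg_eq_bot_iff, EReal.coe_ennreal_eq_top_iff]
    exact hfin P₀ hP₀
  · rw [Ne, EReal.neg_eq_top_iff]
    exact EReal.coe_ennreal_ne_bot _

end Marginals

/-! ### The two operators -/

section Operators

variable {h : ℝ → ℝ} {μ : Q01 → Measure ℝ} {P : ℕ → Finset Q01} {n : ℕ}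

/-- The convexity bound on `-h ∘ s_n` is continuous and has the same finite integral with respect
to all measures with marginals `μ`. -/
lemma exists_majorant (hconc : ConcaveOn ℝ univ h) (hcont : Continuous h) (hnonpos : ∀ x, h x ≤ 0)
    (hh : ∀ q, Integrable h (μ q)) {S : Finset Q01} (hS : oneQ ∈ S) :
    ∃ (D : (Q01 → ℝ) → ℝ) (C : ℝ≥0∞), Continuous D ∧ C ≠ ⊤ ∧
      (∀ P' ∈ withMarginals μ, ∫⁻ f, ENNReal.ofReal (D f) ∂P'.toMeasure = C) ∧
      ∀ f, -h (riemannSum S f) ≤ D f := by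
  refine ⟨fun f => ∑ t ∈ S, (qval t - prevPt S t) * -h (f t), ∑ t ∈ S,
    ENNReal.ofReal (qval t - prevPt S t) * ∫⁻ x, ENNReal.ofReal (-h x) ∂μ t, ?_, ?_, ?_,
    neg_comp_riemannSum_le hconc hS⟩
  · exact continuous_finsetSum _ fun t _ =>
      continuous_const.mul (hcont.comp (continuous_apply t)).neg
  · exact ENNReal.sum_ne_top.2 fun t _ => ENNReal.mul_ne_top ENNReal.ofReal_ne_top
      (hh t).neg.lintegral_lt_top.ne
  · exact fun P' hP' => lintegral_sum_eval_of_mem_withMarginals hP' S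
      (fun t _ => sub_nonneg.2 (prevPt_le _ t)) hcont.neg fun x => neg_nonneg.2 (hnonpos x)

lemma lintegral_riemannSum_ne_top (hconc : ConcaveOn ℝ univ h) (hcont : Continuous h)
    (hnonpos : ∀ x, h x ≤ 0) (hh : ∀ q, Integrable h (μ q)) {S : Finset Q01} (hS : oneQ ∈ S)
    {P' : ProbabilityMeasure (Q01 → ℝ)} (hP' : P' ∈ withMarginals μ) :
    ∫⁻ f, ENNReal.ofReal (-h (riemannSum S f)) ∂P'.toMeasure ≠ ⊤ := by
  obtain ⟨D, C, -, hC, hDC, hSD⟩ := exists_majorant hconc hcont hnonpos hh hS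
  exact ne_top_of_le_ne_top hC
    ((lintegral_mono fun f => ENNReal.ofReal_le_ofReal (hSD f)).trans_eq (hDC P' hP'))

lemma lintegral_maxRiemannSum_ne_top (hconc : ConcaveOn ℝ univ h) (hmono : Monotone h)
    (hcont : Continuous h) (hnonpos : ∀ x, h x ≤ 0) (hh : ∀ q, Integrable h (μ q))
    (hP : oneQ ∈ P n) {P' : ProbabilityMeasure (Q01 → ℝ)} (hP' : P' ∈ withMarginals μ) (m : ℕ) :
    ∫⁻ f, ENNReal.ofReal (-h (maxRiemannSum P n m f)) ∂P'.toMeasure ≠ ⊤ :=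
  ne_top_of_le_ne_top (lintegral_riemannSum_ne_top hconc hcont hnonpos hh hP hP')
    (lintegral_mono fun f => ENNReal.ofReal_le_ofReal
      (neg_le_neg (hmono (riemannSum_le_maxRiemannSum P n m f))))

lemma lintegral_phiSup_eq_iInf (hconc : ConcaveOn ℝ univ h) (hmono : Monotone h)
    (hcont : Continuous h) (hnonpos : ∀ x, h x ≤ 0) (hh : ∀ q, Integrable h (μ q))
    (hP : oneQ ∈ P n) {P' : ProbabilityMeasure (Q01 → ℝ)} (hP' : P' ∈ withMarginals μ) :
    ∫⁻ f, erealNegPart (erealExt h (phiSup P n f)) ∂P'.toMeasure =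
      ⨅ m, ∫⁻ f, ENNReal.ofReal (-h (maxRiemannSum P n m f)) ∂P'.toMeasure := by
  simp_rw [erealNegPart_erealExt_phiSup hmono hcont]
  refine lintegral_iInf
    (fun m => (hcont.comp (continuous_maxRiemannSum P n m)).neg.measurable.ennreal_ofReal)
    (fun k l hkl f => ?_) (lintegral_maxRiemannSum_ne_top hconc hmono hcont hnonpos hh hP hP' 0)
  exact ENNReal.ofReal_le_ofReal (neg_le_neg (hmono (monotone_maxRiemannSum P n f hkl)))

lemma lintegral_phiSup_ne_top (hconc : ConcaveOn ℝ univ h) (hmono : Monotone h)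
    (hcont : Continuous h) (hnonpos : ∀ x, h x ≤ 0) (hh : ∀ q, Integrable h (μ q))
    (hP : oneQ ∈ P n) {P' : ProbabilityMeasure (Q01 → ℝ)} (hP' : P' ∈ withMarginals μ) :
    ∫⁻ f, erealNegPart (erealExt h (phiSup P n f)) ∂P'.toMeasure ≠ ⊤ := by
  rw [lintegral_phiSup_eq_iInf hconc hmono hcont hnonpos hh hP hP']
  exact ne_top_of_le_ne_top
    (lintegral_maxRiemannSum_ne_top hconc hmono hcont hnonpos hh hP hP' 0) (iInf_le _ 0)

lemma lowerSemicontinuousOn_Sval (hconc : ConcaveOn ℝ univ h) (hcont : Continuous h)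
    (hnonpos : ∀ x, h x ≤ 0) (hh : ∀ q, Integrable h (μ q)) (hP : oneQ ∈ P n) :
    LowerSemicontinuousOn (Sval h P n) (withMarginals μ) := by
  obtain ⟨D, C, hD, hC, hDC, hSD⟩ := exists_majorant hconc hcont hnonpos hh hP
  exact lowerSemicontinuousOn_neg_lintegral hD (hcont.comp (continuous_riemannSum (P n))).neg
    (fun f => neg_nonneg.2 (hnonpos _)) hSD hC hDC

lemma lowerSemicontinuousOn_Phival (hconc : ConcaveOn ℝ univ h) (hmono : Monotone h)
    (hcont : Continuous h) (hnonpos : ∀ x, h x ≤ 0) (hh : ∀ q, Integrable h (μ q))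
    (hP : oneQ ∈ P n) : LowerSemicontinuousOn (Phival h P n) (withMarginals μ) := by
  obtain ⟨D, C, hD, hC, hDC, hSD⟩ := exists_majorant hconc hcont hnonpos hh hP
  have hlsc : ∀ m, LowerSemicontinuousOn (fun P' : ProbabilityMeasure (Q01 → ℝ) =>
      -((∫⁻ f, ENNReal.ofReal (-h (maxRiemannSum P n m f)) ∂P'.toMeasure : ℝ≥0∞) : EReal))
      (withMarginals μ) := fun m =>
    lowerSemicontinuousOn_neg_lintegral hD (hcont.comp (continuous_maxRiemannSum P n m)).neg
      (fun f => neg_nonneg.2 (hnonpos _))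
      (fun f => (neg_le_neg (hmono (riemannSum_le_maxRiemannSum P n m f))).trans (hSD f)) hC hDC
  refine lowerSemicontinuousOn_of_eqOn (lowerSemicontinuousOn_iSup hlsc) fun P' hP' => ?_
  have hanti : Antitone fun y : ℝ≥0∞ => -(y : EReal) := fun a b hab =>
    EReal.neg_le_neg_iff.2 (EReal.coe_ennreal_le_coe_ennreal_iff.2 hab)
  have hc : Continuous fun y : ℝ≥0∞ => -(y : EReal) :=
    continuous_neg.comp continuous_coe_ennreal_ereal
  unfold Phival
  rw [lintegral_phiSup_eq_iInf hconc hmono hcont hnonpos hh hP hP']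
  exact (hanti.map_iInf_of_continuousAt hc.continuousAt rfl).symm

end Operators

/-- **Lemma.** For `h : ℝ → ℝ` concave, increasing and non-positive and marginals
`(μ_q)_{q ∈ Q}` with finite first moments and finite `h`-moments, for each `n` the
operators `S_n : P ↦ ∫ h∘s_n dP` and `Φ_n : P ↦ ∫ h∘φ_n dP` are lower semi-continuous for
the topology of weak convergence on `Π_Q(μ_q)`, attain their minima on `Π_Q(μ_q)`, and
the minimal values are finite. -/
theorem statement9
    (h : ℝ → ℝ) (hconc : ConcaveOn ℝ Set.univ h) (hmono : Monotone h)
    (hnonpos : ∀ x, h x ≤ 0)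
    (μ : Q01 → Measure ℝ) [∀ q, IsProbabilityMeasure (μ q)]
    (hmom : ∀ q, Integrable (fun x : ℝ => |x|) (μ q))
    (hh : ∀ q, Integrable h (μ q))
    (P : ℕ → Finset Q01)
    (hP01 : ∀ n, zeroQ ∈ P n ∧ oneQ ∈ P n)
    (hPmono : ∀ n, P n ⊆ P (n + 1))
    (hPunion : ∀ q : Q01, ∃ n, q ∈ P n)
    (n : ℕ) :
    LowerSemicontinuousOn (Sval h P n)
      {P' : ProbabilityMeasure (Q01 → ℝ) | ∀ q, P'.toMeasure.map (fun f => f q) = μ q} ∧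
    LowerSemicontinuousOn (Phival h P n)
      {P' : ProbabilityMeasure (Q01 → ℝ) | ∀ q, P'.toMeasure.map (fun f => f q) = μ q} ∧
    (∃ P₀, (∀ q, P₀.toMeasure.map (fun f => f q) = μ q) ∧
      (∀ P' : ProbabilityMeasure (Q01 → ℝ), (∀ q, P'.toMeasure.map (fun f => f q) = μ q) →
        Sval h P n P₀ ≤ Sval h P n P') ∧
      Sval h P n P₀ ≠ ⊥ ∧ Sval h P n P₀ ≠ ⊤) ∧
    (∃ P₀, (∀ q, P₀.toMeasure.map (fun f => f q) = μ q) ∧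
      (∀ P' : ProbabilityMeasure (Q01 → ℝ), (∀ q, P'.toMeasure.map (fun f => f q) = μ q) →
        Phival h P n P₀ ≤ Phival h P n P') ∧
      Phival h P n P₀ ≠ ⊥ ∧ Phival h P n P₀ ≠ ⊤) := by
  have hcont : Continuous h := continuousOn_univ.1 (hconc.continuousOn isOpen_univ)
  have hP := (hP01 n).2
  have hS := lowerSemicontinuousOn_Sval hconc hcont hnonpos hh hP
  have hΦ := lowerSemicontinuousOn_Phival hconc hmono hcont hnonpos hh hP
  exact ⟨hS, hΦ,
    exists_min_withMarginals hS fun _ => lintegral_riemannSum_ne_top hconc hcont hnonpos hh hP,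
    exists_min_withMarginals hΦ fun _ => lintegral_phiSup_ne_top hconc hmono hcont hnonpos hh hP⟩
end
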